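/- arXiv:1404.3403 — 12 statements merged into one kernel-verified Lean document; each statement's English description precedes it below -/
import Mathlib

section
/- Let P be a set of n elements and let k_1, …, k_n be nonnegative integers depending only on P. Let Φ be a property of P such that |Φ(X)| = k_{|X|} whenever |X| = i (i.e., the size of Φ(X) depends only on the cardinality of X). Let ⟨p_1, …, p_n⟩ be a uniformly random permutation of P, write P_i = {p_1, …, p_i}, and let E_i be the event that p_i ∈ Φ(P_i). Then the events E_1, …, E_n are mutually independent, and consequently the indicator variables X_i of these events are mutually independent. -/
open Finset

section BackwardAnalysis

variable {α : Type*} [DecidableEq α] {n : ℕ}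

/-- Swapping two positions in an initial segment leaves the set of entries of
any longer initial segment unchanged. -/
theorem image_swap_trans_Iic (σ : Fin n ≃ α) {j m i : Fin n} (hj : j ≤ m) (hm : m ≤ i) :
    image (⇑((Equiv.swap j m).trans σ)) (Iic i) = image (⇑σ) (Iic i) := by
  have key : ∀ x, Equiv.swap j m x ≤ i ↔ x ≤ i := by
    intro x
    rw [Equiv.swap_apply_def]
    split_ifs with h1 h2
    · subst h1
      exact ⟨fun _ => hj.trans hm, fun _ => hm⟩
    · subst h2
      exact ⟨fun _ => hm, fun _ => hj.trans hm⟩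
    · rfl
  ext a
  simp only [mem_image, mem_Iic, Equiv.trans_apply]
  constructor
  · rintro ⟨x, hx, rfl⟩
    exact ⟨Equiv.swap j m x, (key x).2 hx, rfl⟩
  · rintro ⟨x, hx, rfl⟩
    exact ⟨Equiv.swap j m x, (key x).2 hx, by simp⟩

/-- A property `Q` of orderings that is invariant under the swaps of position `m` with earlier
positions is independent of the event that the `m`-th entry lies in `Φ` of the `m`-th
initial segment. -/
theorem card_filter_mem_image_Iic_and [Fintype α] (k : ℕ → ℕ) (Φ : Finset α → Finset α)
    (hsub : ∀ X : Finset α, Φ X ⊆ X) (hcard : ∀ X : Finset α, (Φ X).card = k X.card)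
    (m : Fin n) (Q : (Fin n ≃ α) → Prop) [DecidablePred Q]
    (hQ : ∀ j ≤ m, ∀ σ, Q ((Equiv.swap j m).trans σ) ↔ Q σ) :
    (m + 1 : ℕ) * #{σ : Fin n ≃ α | σ m ∈ Φ (image (⇑σ) (Iic m)) ∧ Q σ}
      = #{σ : Fin n ≃ α | Q σ} * k (m + 1) := by
  have swap_count : ∀ j ∈ Iic m,
      #{σ : Fin n ≃ α | σ m ∈ Φ (image (⇑σ) (Iic m)) ∧ Q σ}
        = #((univ.filter Q).filter fun σ : Fin n ≃ α => σ j ∈ Φ (image (⇑σ) (Iic m))) := by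
    intro j hj
    have hj : j ≤ m := mem_Iic.1 hj
    have invol : ∀ σ : Fin n ≃ α,
        (Equiv.swap j m).trans ((Equiv.swap j m).trans σ) = σ := by
      intro σ
      ext x
      simp
    refine card_bij' (fun σ _ => (Equiv.swap j m).trans σ)
      (fun σ _ => (Equiv.swap j m).trans σ) ?_ ?_ (fun σ _ => invol σ) (fun σ _ => invol σ)
    · intro σ hσ
      simp only [mem_filter, mem_univ, true_and] at hσ ⊢
      rw [hQ j hj, image_swap_trans_Iic σ hj le_rfl]
      simpa using hσ.symm
    · intro σ hσ
      simp only [mem_filter, mem_univ, true_and] at hσ ⊢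
      rw [hQ j hj, image_swap_trans_Iic σ hj le_rfl]
      simpa using hσ.symm
  have fiber_count : ∀ σ : Fin n ≃ α,
      #{j ∈ Iic m | σ j ∈ Φ (image (⇑σ) (Iic m))} = k (m + 1) := by
    intro σ
    have himage : image (⇑σ) {j ∈ Iic m | σ j ∈ Φ (image (⇑σ) (Iic m))}
        = Φ (image (⇑σ) (Iic m)) := by
      ext a
      simp only [mem_image, mem_filter]
      constructor
      · rintro ⟨x, ⟨_, hx⟩, rfl⟩
        exact hx
      · intro ha
        obtain ⟨x, hx, rfl⟩ := mem_image.1 (hsub _ ha)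
        exact ⟨x, ⟨hx, ha⟩, rfl⟩
    rw [← card_image_of_injective _ σ.injective, himage, hcard,
      card_image_of_injective _ σ.injective, Fin.card_Iic]
  calc _ = ∑ j ∈ Iic m, #{σ : Fin n ≃ α | σ m ∈ Φ (image (⇑σ) (Iic m)) ∧ Q σ} := by
        rw [sum_const, Fin.card_Iic, smul_eq_mul]
    _ = ∑ j ∈ Iic m, #((univ.filter Q).filter fun σ : Fin n ≃ α => σ j ∈ Φ (image (⇑σ) (Iic m))) :=
        sum_congr rfl swap_count
    _ = ∑ σ ∈ univ.filter Q, #{j ∈ Iic m | σ j ∈ Φ (image (⇑σ) (Iic m))} :=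
        sum_card_bipartiteAbove_eq_sum_card_bipartiteBelow
          (fun (j : Fin n) (σ : Fin n ≃ α) => σ j ∈ Φ (image (⇑σ) (Iic m)))
    _ = _ := by
        rw [sum_congr rfl fun σ _ => fiber_count σ, sum_const, smul_eq_mul]

end BackwardAnalysis

/-- If the size of `Φ(X)` depends only on `|X|`, then for a uniformly random
permutation `⟨p_1, …, p_n⟩` of `P` (modeled as a uniformly random bijection
`σ : Fin n ≃ α`, with `p_i = σ i` and `P_i = σ({0,…,i})`), the events
`E_i = [p_i ∈ Φ(P_i)]` are mutually independent: for every index set `I`,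
`P(⋂_{i ∈ I} E_i) = ∏_{i ∈ I} P(E_i)`. -/
theorem backward_analysis_events_indep
    {α : Type*} [Fintype α] [DecidableEq α] (n : ℕ) (hn : Fintype.card α = n)
    (k : ℕ → ℕ) (Φ : Finset α → Finset α)
    (hsub : ∀ X : Finset α, Φ X ⊆ X)
    (hcard : ∀ X : Finset α, (Φ X).card = k X.card)
    (I : Finset (Fin n)) :
    ((Finset.univ.filter
        (fun σ : Fin n ≃ α =>
          ∀ i ∈ I, σ i ∈ Φ (Finset.image (⇑σ) (Finset.Iic i)))).card : ℝ)
        / (Nat.factorial n : ℝ)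
      = ∏ i ∈ I,
          ((Finset.univ.filter
              (fun σ : Fin n ≃ α =>
                σ i ∈ Φ (Finset.image (⇑σ) (Finset.Iic i)))).card : ℝ)
            / (Nat.factorial n : ℝ) := by
  have hfact : #(univ : Finset (Fin n ≃ α)) = n.factorial := by
    rw [card_univ, Fintype.card_equiv (Fintype.equivFinOfCardEq hn).symm, Fintype.card_fin]
  have hfact_ne : (n.factorial : ℝ) ≠ 0 := by exact_mod_cast n.factorial_ne_zero
  induction I using Finset.induction_on_min with
  | empty => simp [hfact, hfact_ne]
  | insert m s hm ih =>
    have hms : m ∉ s := fun h => lt_irrefl _ (hm m h)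
    rw [prod_insert hms, ← ih]
    have joint := card_filter_mem_image_Iic_and k Φ hsub hcard m
      (fun σ => ∀ i ∈ s, σ i ∈ Φ (image (⇑σ) (Iic i))) (by
        intro j hj σ
        refine forall₂_congr fun i hi => ?_
        have him := hm i hi
        rw [image_swap_trans_Iic σ hj him.le, Equiv.trans_apply,
          Equiv.swap_apply_of_ne_of_ne (hj.trans_lt him).ne' him.ne'])
    have single := card_filter_mem_image_Iic_and k Φ hsub hcard m (fun _ => True)
      (fun _ _ _ => Iff.rfl)
    simp only [and_true, filter_true, hfact] at single
    simp only [forall_mem_insert]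
    have joint_real := congrArg (Nat.cast (R := ℝ)) joint
    have single_real := congrArg (Nat.cast (R := ℝ)) single
    simp only [Nat.cast_mul] at joint_real single_real
    have hpos : ((m + 1 : ℕ) : ℝ) ≠ 0 := by positivity
    rw [div_mul_div_comm, div_eq_div_iff hfact_ne (mul_ne_zero hfact_ne hfact_ne)]
    apply mul_left_cancel₀ hpos
    linear_combination (n.factorial : ℝ) ^ 2 * joint_real
      - (n.factorial : ℝ) * (#{σ : Fin n ≃ α | ∀ i ∈ s, σ i ∈ Φ (image (⇑σ) (Iic i))} : ℝ)
        * single_real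
end

section
/- Let P be a set of n ≥ e² elements and let k ≥ 1 be a fixed integer. Let Φ be a property of P such that |Φ(X)| = k whenever |X| ≥ k, and |Φ(X)| = |X| whenever |X| < k. Let ⟨p_1, …, p_n⟩ be a uniformly random permutation of P, write P_i = {p_1, …, p_i}, and let X_i be the indicator of the event p_i ∈ Φ(P_i). Then for every real γ ≥ 2e, the probability that Σ_{i=1}^n X_i > γ·(2k ln n) is at most n^{−γk}. -/
open Finset

/-- The exponential of the number of indices `i` at which `f i` is selected by `Φ` from the
set of the values of `f` up to `i`. -/
noncomputable def expSelectionCount {α : Type*} [DecidableEq α] (Φ : Finset α → Finset α)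
    {m : ℕ} (f : Fin m → α) : ℝ :=
  ∏ i : Fin m, if f i ∈ Φ (Finset.image f (Finset.Iic i)) then Real.exp 1 else 1

theorem expSelectionCount_nonneg {α : Type*} [DecidableEq α] (Φ : Finset α → Finset α)
    {m : ℕ} (f : Fin m → α) : 0 ≤ expSelectionCount Φ f :=
  Finset.prod_nonneg fun i _ => by split_ifs <;> positivity

theorem expSelectionCount_eq_exp {α : Type*} [DecidableEq α] (Φ : Finset α → Finset α)
    {m : ℕ} (f : Fin m → α) :
    expSelectionCount Φ f = Real.exp ((Finset.univ.filter
      (fun i : Fin m => f i ∈ Φ (Finset.image f (Finset.Iic i)))).card : ℝ) := by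
  simp [expSelectionCount, Finset.prod_ite, ← Real.exp_nat_mul]

theorem Fin.finsetImage_snoc_univ {α : Type*} [DecidableEq α] {m : ℕ} (g : Fin m → α) (x : α) :
    Finset.image (Fin.snoc g x : Fin (m + 1) → α) Finset.univ =
      insert x (Finset.image g Finset.univ) := by
  rw [← Finset.coe_inj]
  simp [Fin.range_snoc]

theorem expSelectionCount_snoc {α : Type*} [DecidableEq α] (Φ : Finset α → Finset α)
    {m : ℕ} (g : Fin m → α) (x : α) :
    expSelectionCount Φ (Fin.snoc g x : Fin (m + 1) → α) =
      expSelectionCount Φ g *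
        if x ∈ Φ (insert x (Finset.image g Finset.univ)) then Real.exp 1 else 1 := by
  have hprefix (i : Fin m) : Finset.image (Fin.snoc g x : Fin (m + 1) → α)
      (Finset.Iic i.castSucc) = Finset.image g (Finset.Iic i) := by
    rw [← Fin.finsetImage_castSucc_Iic, Finset.image_image]
    congr 1
    ext j
    simp
  have hfull : Finset.image (Fin.snoc g x : Fin (m + 1) → α) (Finset.Iic (Fin.last m)) =
      insert x (Finset.image g Finset.univ) := by
    rw [← Fin.finsetImage_snoc_univ]
    congr 1
    ext j
    simp [Fin.le_last]
  simp [expSelectionCount, Fin.prod_univ_castSucc, hprefix, hfull]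

/-- Summing the exponential moment over all enumerations of a finite set `X`, by removing
the last element. -/
theorem sum_expSelectionCount_le {α : Type*} [Fintype α] [DecidableEq α]
    (Φ : Finset α → Finset α) (k : ℕ) (hΦ : ∀ X, (Φ X).card ≤ k) (m : ℕ) (X : Finset α)
    (hX : X.card = m) :
    ∑ f : Fin m → α with Finset.image f Finset.univ = X, expSelectionCount Φ f ≤
      m.factorial * Real.exp ((Real.exp 1 - 1) * k * (harmonic m : ℚ)) := by
  induction m generalizing X with
  | zero =>
    refine (Finset.sum_le_sum_of_subset_of_nonneg (Finset.filter_subset _ _)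
      fun f _ _ => expSelectionCount_nonneg Φ f).trans ?_
    simp [expSelectionCount]
  | succ m ih =>
    set C : ℝ := m.factorial * Real.exp ((Real.exp 1 - 1) * k * (harmonic m : ℚ)) with hC
    have hC0 : 0 ≤ C := by positivity
    have he : 0 ≤ Real.exp 1 - 1 := by linarith [Real.add_one_le_exp 1]
    let w (x : α) : ℝ := if x ∈ Φ X then Real.exp 1 else 1
    have hw0 (x : α) : 0 ≤ w x := by dsimp only [w]; split_ifs <;> positivity
    have hsplit : ∑ f : Fin (m + 1) → α with Finset.image f Finset.univ = X,
        expSelectionCount Φ f ≤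
        ∑ x ∈ X, w x * ∑ g : Fin m → α with Finset.image g Finset.univ = X.erase x,
          expSelectionCount Φ g := by
      rw [Finset.sum_filter, ← (Fin.snocEquiv fun _ : Fin (m + 1) => α).sum_comp,
        Fintype.sum_prod_type, ← Finset.sum_subset (Finset.subset_univ X)]
      · refine Finset.sum_le_sum fun x hx => ?_
        rw [Finset.mul_sum, Finset.sum_filter]
        refine Finset.sum_le_sum fun g _ => ?_
        change (if Finset.image (Fin.snoc g x : Fin (m + 1) → α) Finset.univ = X then
          expSelectionCount Φ (Fin.snoc g x : Fin (m + 1) → α) else 0) ≤ _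
        rw [Fin.finsetImage_snoc_univ, expSelectionCount_snoc]
        by_cases hins : insert x (Finset.image g Finset.univ) = X
        · have hxg : x ∉ Finset.image g Finset.univ := fun hmem => by
            rw [Finset.insert_eq_of_mem hmem] at hins
            have hle := Finset.card_image_le (s := Finset.univ) (f := g)
            rw [hins, hX, Finset.card_univ, Fintype.card_fin] at hle
            omega
          have herase : Finset.image g Finset.univ = X.erase x := by
            rw [← hins, Finset.erase_insert hxg]
          rw [if_pos hins, if_pos herase, hins, mul_comm]
        · rw [if_neg hins]
          split_ifs
          · exact mul_nonneg (hw0 x) (expSelectionCount_nonneg Φ g)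
          · simp
      · intro x _ hx
        refine Finset.sum_eq_zero fun g _ => if_neg ?_
        change Finset.image (Fin.snoc g x : Fin (m + 1) → α) Finset.univ ≠ X
        rw [Fin.finsetImage_snoc_univ]
        rintro rfl
        simp at hx
    have hsum : ∑ x ∈ X, w x ≤ (m + 1) * Real.exp ((Real.exp 1 - 1) * k / (m + 1)) := by
      have hcard : ((X.filter (· ∈ Φ X)).card : ℝ) ≤ k := by
        refine Nat.cast_le.2 ((Finset.card_le_card ?_).trans (hΦ X))
        intro x hx
        exact (Finset.mem_filter.1 hx).2
      have hwsum : ∑ x ∈ X, w x =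
          (m + 1) + (Real.exp 1 - 1) * (X.filter (· ∈ Φ X)).card := by
        have hw (x : α) : w x = 1 + (Real.exp 1 - 1) * if x ∈ Φ X then 1 else 0 := by
          dsimp only [w]; split_ifs <;> ring
        simp only [hw, Finset.sum_add_distrib, ← Finset.mul_sum, Finset.sum_boole,
          Finset.sum_const, hX, nsmul_eq_mul, mul_one]
        push_cast
        rfl
      calc ∑ x ∈ X, w x ≤ (m + 1) + (Real.exp 1 - 1) * k := by rw [hwsum]; gcongr
        _ = (m + 1) * ((Real.exp 1 - 1) * k / (m + 1) + 1) := by field_simp; ring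
        _ ≤ _ := by gcongr; exact Real.add_one_le_exp _
    calc _ ≤ ∑ x ∈ X, w x * C := hsplit.trans <| Finset.sum_le_sum fun x hx =>
          mul_le_mul_of_nonneg_left
            (ih (X.erase x) (by rw [Finset.card_erase_of_mem hx, hX]; rfl)) (hw0 x)
      _ = (∑ x ∈ X, w x) * C := by rw [Finset.sum_mul]
      _ ≤ (m + 1) * Real.exp ((Real.exp 1 - 1) * k / (m + 1)) * C := by gcongr
      _ = _ := by
        rw [hC, harmonic_succ, Nat.factorial_succ]
        push_cast
        rw [mul_add, Real.exp_add, ← div_eq_mul_inv]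
        ring

/-- Exponential moment of the selection count over uniformly random orderings. -/
theorem sum_equiv_expSelectionCount_le {α : Type*} [Fintype α] [DecidableEq α]
    (Φ : Finset α → Finset α) (k : ℕ) (hΦ : ∀ X, (Φ X).card ≤ k) (n : ℕ)
    (hn : Fintype.card α = n) :
    ∑ σ : Fin n ≃ α, expSelectionCount Φ σ ≤
      n.factorial * Real.exp ((Real.exp 1 - 1) * k * (harmonic n : ℚ)) := by
  refine le_trans ?_ (sum_expSelectionCount_le Φ k hΦ n Finset.univ hn)
  rw [← Finset.sum_image (f := fun f : Fin n → α => expSelectionCount Φ f)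
    (g := fun σ : Fin n ≃ α => (σ : Fin n → α)) (DFunLike.coe_injective.injOn)]
  refine Finset.sum_le_sum_of_subset_of_nonneg ?_
    fun f _ _ => expSelectionCount_nonneg Φ f
  intro f hf
  obtain ⟨σ, -, rfl⟩ := Finset.mem_image.1 hf
  simp [Finset.image_univ_of_surjective σ.surjective]

/-- Backward analysis tail bound (Lemma, part (A)): if `|Φ(X)| = k` whenever
`|X| ≥ k` and `|Φ(X)| = |X|` whenever `|X| < k`, then for a uniformly random
permutation (modeled as a uniformly random bijection `σ : Fin n ≃ α`, with
`p_i = σ i` and `P_i = σ({0,…,i})`), for any `γ ≥ 2e`, the probability that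
`∑ X_i > γ·(2 k ln n)` is at most `n^{-γ k}`.  Here `n ≥ e²`. -/
theorem backward_analysis_tail_exact
    {α : Type*} [Fintype α] [DecidableEq α] (n : ℕ) (hn : Fintype.card α = n)
    (hne : Real.exp 1 ^ 2 ≤ (n : ℝ))
    (k : ℕ) (hk : 1 ≤ k)
    (Φ : Finset α → Finset α)
    (hsub : ∀ X : Finset α, Φ X ⊆ X)
    (hbig : ∀ X : Finset α, k ≤ X.card → (Φ X).card = k)
    (hsmall : ∀ X : Finset α, X.card < k → (Φ X).card = X.card)
    (γ : ℝ) (hγ : 2 * Real.exp 1 ≤ γ) :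
    ((Finset.univ.filter
        (fun σ : Fin n ≃ α =>
          γ * (2 * k * Real.log n) <
            ((Finset.univ.filter
                (fun i : Fin n =>
                  σ i ∈ Φ (Finset.image (⇑σ) (Finset.Iic i)))).card : ℝ))).card : ℝ)
        / (Nat.factorial n : ℝ)
      ≤ (n : ℝ) ^ (-(γ * k)) := by
  have hΦ (X : Finset α) : (Φ X).card ≤ k := by
    rcases le_or_gt k X.card with h | h
    · exact (hbig X h).le
    · exact (hsmall X h).trans_le h.le
  have hn0 : (0 : ℝ) < n := lt_of_lt_of_le (by positivity) hne
  have hlog : 2 ≤ Real.log n := by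
    rw [Real.le_log_iff_exp_le hn0]
    rwa [← Real.exp_nat_mul, Nat.cast_ofNat, mul_one] at hne
  have he := Real.exp_one_lt_d9
  have he' := Real.exp_one_gt_d9
  have hk0 : (0 : ℝ) ≤ k := k.cast_nonneg
  have hmarkov := (Finset.sum_le_sum_of_subset_of_nonneg
    (Finset.filter_subset (fun σ : Fin n ≃ α => γ * (2 * k * Real.log n) <
      ((Finset.univ.filter (fun i : Fin n =>
        σ i ∈ Φ (Finset.image (⇑σ) (Finset.Iic i)))).card : ℝ)) Finset.univ)
    fun σ _ _ => expSelectionCount_nonneg Φ σ).trans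
      (sum_equiv_expSelectionCount_le Φ k hΦ n hn)
  have hlower := Finset.card_nsmul_le_sum (Finset.univ.filter (fun σ : Fin n ≃ α =>
      γ * (2 * k * Real.log n) < ((Finset.univ.filter (fun i : Fin n =>
        σ i ∈ Φ (Finset.image (⇑σ) (Finset.Iic i)))).card : ℝ)))
    (fun σ => expSelectionCount Φ σ) (Real.exp (γ * (2 * k * Real.log n))) (by
      intro σ hσ
      rw [expSelectionCount_eq_exp]
      exact Real.exp_le_exp.2 (Finset.mem_filter.1 hσ).2.le)
  have hbound := hlower.trans hmarkov
  rw [nsmul_eq_mul, ← le_div_iff₀ (Real.exp_pos _), mul_div_assoc, ← Real.exp_sub] at hbound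
  rw [div_le_iff₀' (by positivity), Real.rpow_def_of_pos hn0]
  refine hbound.trans ?_
  gcongr
  have hH : ((harmonic n : ℚ) : ℝ) ≤ 3 / 2 * Real.log n := by
    linarith [harmonic_le_one_add_log n]
  have hstep : (Real.exp 1 - 1) * k * ((harmonic n : ℚ) : ℝ) ≤
      γ * (k * Real.log n) := by
    calc _ ≤ (Real.exp 1 - 1) * k * (3 / 2 * Real.log n) := by
          gcongr
          exact mul_nonneg (by linarith) hk0
      _ = ((Real.exp 1 - 1) * (3 / 2)) * (k * Real.log n) := by ring
      _ ≤ _ := by gcongr; linarith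
  linarith
end

section
/- Let P be a set of n ≥ e² elements and let k ≥ 1 be a fixed integer. Let Φ be a property of P such that |Φ(X)| ≤ k for every subset X ⊆ P. Let ⟨p_1, …, p_n⟩ be a uniformly random permutation of P, write P_i = {p_1, …, p_i}, and let X_i be the indicator of the event p_i ∈ Φ(P_i). Then for every real γ ≥ 2e, the probability that Σ_{i=1}^n X_i > γ·(2k ln n) is at most n^{−γk}. -/
open Finset

/-- The exponential weight of a sequence `f`: a factor `t` for every index `i` such that `f i`
belongs to the property of the prefix of `f` ending at `i`. -/
def prefixWeight {α : Type*} [DecidableEq α] (Φ : Finset α → Finset α) (t : ℝ) {m : ℕ}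
    (f : Fin m → α) : ℝ :=
  ∏ i, if f i ∈ Φ (Finset.image f (Finset.Iic i)) then t else 1

theorem prefixWeight_eq_pow {α : Type*} [DecidableEq α] (Φ : Finset α → Finset α) (t : ℝ) {m : ℕ}
    (f : Fin m → α) :
    prefixWeight Φ t f =
      t ^ (Finset.univ.filter (fun i => f i ∈ Φ (Finset.image f (Finset.Iic i)))).card := by
  simp [prefixWeight, Finset.prod_ite]

theorem prefixWeight_nonneg {α : Type*} [DecidableEq α] (Φ : Finset α → Finset α) {t : ℝ}
    (ht : 0 ≤ t) {m : ℕ} (f : Fin m → α) : 0 ≤ prefixWeight Φ t f := by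
  rw [prefixWeight_eq_pow]; positivity

theorem image_snoc_univ {α : Type*} [DecidableEq α] {m : ℕ} (f : Fin m → α) (x : α) :
    Finset.image (Fin.snoc f x : Fin (m + 1) → α) Finset.univ
      = insert x (Finset.image f Finset.univ) := by
  ext y
  simp only [Finset.mem_image, Finset.mem_univ, true_and, Finset.mem_insert]
  constructor
  · rintro ⟨i, rfl⟩
    induction i using Fin.lastCases <;> simp
  · rintro (rfl | ⟨i, rfl⟩)
    · exact ⟨Fin.last m, Fin.snoc_last _ _⟩
    · exact ⟨i.castSucc, Fin.snoc_castSucc _ _ _⟩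

theorem image_snoc_Iic_castSucc {α : Type*} [DecidableEq α] {m : ℕ} (f : Fin m → α) (x : α)
    (i : Fin m) :
    Finset.image (Fin.snoc f x : Fin (m + 1) → α) (Finset.Iic i.castSucc)
      = Finset.image f (Finset.Iic i) := by
  rw [← Fin.map_castSuccEmb_Iic, Finset.map_eq_image, Finset.image_image]
  congr 1
  ext j
  simp

theorem prefixWeight_snoc {α : Type*} [DecidableEq α] (Φ : Finset α → Finset α) (t : ℝ) {m : ℕ}
    (f : Fin m → α) (x : α) :
    prefixWeight Φ t (Fin.snoc f x : Fin (m + 1) → α) =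
      prefixWeight Φ t f *
        if x ∈ Φ (insert x (Finset.image f Finset.univ)) then t else 1 := by
  have hIic : Finset.Iic (Fin.last m) = Finset.univ := by
    ext j; simp [Fin.le_last]
  simp only [prefixWeight, Fin.prod_univ_castSucc, image_snoc_Iic_castSucc, Fin.snoc_castSucc,
    Fin.snoc_last, hIic, image_snoc_univ]

theorem insert_image_eq_iff {α : Type*} [DecidableEq α] {m : ℕ} (f : Fin m → α) (x : α)
    {X : Finset α} (hX : X.card = m + 1) :
    insert x (Finset.image f Finset.univ) = X ↔
      x ∈ X ∧ Finset.image f Finset.univ = X.erase x := by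
  constructor
  · rintro rfl
    have hx : x ∉ Finset.image f Finset.univ := by
      intro hx
      rw [Finset.insert_eq_of_mem hx] at hX
      have := Finset.card_image_le (s := Finset.univ) (f := f)
      simp only [Finset.card_univ, Fintype.card_fin] at this
      omega
    exact ⟨Finset.mem_insert_self _ _, (Finset.erase_insert hx).symm⟩
  · rintro ⟨hx, h⟩
    rw [h, Finset.insert_erase hx]

theorem sum_prefixWeight_le {α : Type*} [Fintype α] [DecidableEq α] (Φ : Finset α → Finset α)
    {k : ℕ} (hle : ∀ X, (Φ X).card ≤ k) {t : ℝ} (ht : 1 ≤ t) (m : ℕ) :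
    ∀ X : Finset α, X.card = m →
      ∑ f : Fin m → α with Finset.image f Finset.univ = X, prefixWeight Φ t f
        ≤ ∏ i ∈ Finset.range m, ((i + 1 : ℝ) + (t - 1) * k) := by
  induction m with
  | zero =>
    intro X hX
    rw [Finset.card_eq_zero.mp hX]
    simp [prefixWeight]
  | succ m ih =>
    intro X hX
    have hrec : ∑ f : Fin (m + 1) → α with Finset.image f Finset.univ = X, prefixWeight Φ t f
        = ∑ x ∈ X, (∑ f : Fin m → α with Finset.image f Finset.univ = X.erase x,
            prefixWeight Φ t f) * if x ∈ Φ X then t else 1 := by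
      rw [Finset.sum_filter, ← (Fin.snocEquiv (fun _ : Fin (m + 1) => α)).sum_comp,
        Fintype.sum_prod_type, ← Finset.sum_filter_add_sum_filter_not Finset.univ (· ∈ X)]
      have hsnoc : ∀ (x : α) (f : Fin m → α), (Fin.snocEquiv fun _ : Fin (m + 1) => α) (x, f)
          = (Fin.snoc f x : Fin (m + 1) → α) := fun _ _ => rfl
      simp only [hsnoc, image_snoc_univ, insert_image_eq_iff _ _ hX,
        prefixWeight_snoc]
      rw [Finset.filter_univ_mem, add_eq_left.mpr]
      · refine Finset.sum_congr rfl fun x hx => ?_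
        rw [Finset.sum_mul, Finset.sum_filter]
        refine Finset.sum_congr rfl fun f _ => ?_
        by_cases hf : Finset.image f Finset.univ = X.erase x
        · simp [hx, hf, Finset.insert_erase hx]
        · simp [hf]
      · refine Finset.sum_eq_zero fun x hx => ?_
        simp [(Finset.mem_filter.mp hx).2]
    have hB : 0 ≤ ∏ i ∈ Finset.range m, ((i + 1 : ℝ) + (t - 1) * k) :=
      Finset.prod_nonneg fun i _ => by
        have : 0 ≤ t - 1 := by linarith
        positivity
    have hfac : ∑ x ∈ X, (if x ∈ Φ X then t else 1) ≤ ((m + 1 : ℝ) + (t - 1) * k) := by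
      have hsplit : ∀ x, (if x ∈ Φ X then t else 1) = 1 + if x ∈ Φ X then t - 1 else 0 := by
        intro x; split_ifs <;> ring
      have hcard : ((X.filter (· ∈ Φ X)).card : ℝ) ≤ k := by
        refine Nat.cast_le.mpr (le_trans (Finset.card_le_card fun x hx => ?_) (hle X))
        exact (Finset.mem_filter.mp hx).2
      simp only [hsplit, Finset.sum_add_distrib, ← Finset.sum_filter, Finset.sum_const,
        nsmul_eq_mul, hX]
      push_cast
      nlinarith
    rw [hrec, Finset.prod_range_succ]
    calc _ ≤ ∑ x ∈ X, (∏ i ∈ Finset.range m, ((i + 1 : ℝ) + (t - 1) * k)) *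
            if x ∈ Φ X then t else 1 := by
          refine Finset.sum_le_sum fun x hx => mul_le_mul_of_nonneg_right (ih _ ?_) ?_
          · rw [Finset.card_erase_of_mem hx, hX]; rfl
          · split_ifs <;> linarith
      _ ≤ _ := by
          rw [← Finset.mul_sum]
          exact mul_le_mul_of_nonneg_left hfac hB

theorem prod_range_add_le_factorial_mul_exp (n : ℕ) {c : ℝ} (hc : 0 ≤ c) :
    ∏ i ∈ Finset.range n, ((i + 1 : ℝ) + c)
      ≤ n.factorial * Real.exp (c * (1 + Real.log n)) := by
  have hprod : ∏ i ∈ Finset.range n, ((i + 1 : ℝ) + c)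
      ≤ n.factorial * Real.exp (c * (harmonic n : ℝ)) := by
    rw [← Finset.prod_range_add_one_eq_factorial, harmonic]
    push_cast
    rw [Finset.mul_sum, Real.exp_sum, ← Finset.prod_mul_distrib]
    refine Finset.prod_le_prod (fun i _ => by positivity) fun i _ => ?_
    have hi : (0 : ℝ) < i + 1 := by positivity
    calc (i + 1 : ℝ) + c = (i + 1) * (c * (i + 1 : ℝ)⁻¹ + 1) := by field_simp; ring
      _ ≤ _ := mul_le_mul_of_nonneg_left (Real.add_one_le_exp _) hi.le
  refine hprod.trans ?_
  gcongr
  exact harmonic_le_one_add_log n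

theorem sum_equiv_prefixWeight_le {α : Type*} [Fintype α] [DecidableEq α] {n : ℕ}
    (hn : Fintype.card α = n) (Φ : Finset α → Finset α) {k : ℕ} (hle : ∀ X, (Φ X).card ≤ k)
    {t : ℝ} (ht : 1 ≤ t) :
    ∑ σ : Fin n ≃ α, prefixWeight Φ t σ
      ≤ n.factorial * Real.exp ((t - 1) * k * (1 + Real.log n)) := by
  have ht' : 0 ≤ t - 1 := by linarith
  refine le_trans ?_ ((sum_prefixWeight_le Φ hle ht n Finset.univ hn).trans
    (prod_range_add_le_factorial_mul_exp n (by positivity)))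
  rw [← Finset.sum_image (s := Finset.univ) (g := fun σ : Fin n ≃ α => (σ : Fin n → α))
    (f := prefixWeight Φ t) (DFunLike.coe_injective.injOn)]
  refine Finset.sum_le_sum_of_subset_of_nonneg ?_ fun f _ _ =>
    prefixWeight_nonneg Φ (by linarith) f
  intro f hf
  obtain ⟨σ, -, rfl⟩ := Finset.mem_image.mp hf
  simp [Finset.image_univ_of_surjective σ.surjective]

/-- Backward analysis tail bound (Lemma, part (B)): if `|Φ(X)| ≤ k` for every
`X ⊆ P`, then for a uniformly random permutation (modeled as a uniformly random
bijection `σ : Fin n ≃ α`, with `p_i = σ i` and `P_i = σ({0,…,i})`), for any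
`γ ≥ 2e`, the probability that `∑ X_i > γ·(2 k ln n)` is at most `n^{-γ k}`.
Here `n ≥ e²`. -/
theorem backward_analysis_tail_le
    {α : Type*} [Fintype α] [DecidableEq α] (n : ℕ) (hn : Fintype.card α = n)
    (hne : Real.exp 1 ^ 2 ≤ (n : ℝ))
    (k : ℕ) (hk : 1 ≤ k)
    (Φ : Finset α → Finset α)
    (hsub : ∀ X : Finset α, Φ X ⊆ X)
    (hle : ∀ X : Finset α, (Φ X).card ≤ k)
    (γ : ℝ) (hγ : 2 * Real.exp 1 ≤ γ) :
    ((Finset.univ.filter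
        (fun σ : Fin n ≃ α =>
          γ * (2 * k * Real.log n) <
            ((Finset.univ.filter
                (fun i : Fin n =>
                  σ i ∈ Φ (Finset.image (⇑σ) (Finset.Iic i)))).card : ℝ))).card : ℝ)
        / (Nat.factorial n : ℝ)
      ≤ (n : ℝ) ^ (-(γ * k)) := by
  have hn0 : (0 : ℝ) < n := lt_of_lt_of_le (by positivity) hne
  have hlog : 2 ≤ Real.log n := by
    rw [Real.le_log_iff_exp_le hn0]
    refine le_of_eq_of_le ?_ hne
    rw [← Real.exp_nat_mul]; norm_num
  have he : 2 ≤ Real.exp 1 := by linarith [Real.add_one_le_exp (1 : ℝ)]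
  have hmgf := sum_equiv_prefixWeight_le hn Φ hle (t := Real.exp 1) (by linarith)
  set a := γ * (2 * k * Real.log n) with ha
  set A := Finset.univ.filter (fun σ : Fin n ≃ α => a <
    ((Finset.univ.filter
      (fun i : Fin n => σ i ∈ Φ (Finset.image (⇑σ) (Finset.Iic i)))).card : ℝ))
  have hmarkov : A.card * Real.exp a ≤ ∑ σ : Fin n ≃ α, prefixWeight Φ (Real.exp 1) σ := by
    rw [← nsmul_eq_mul]
    refine (Finset.card_nsmul_le_sum A (fun σ => prefixWeight Φ (Real.exp 1) σ) _
      fun σ hσ => ?_).trans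
      (Finset.sum_le_sum_of_subset_of_nonneg (Finset.subset_univ _) fun σ _ _ =>
        prefixWeight_nonneg Φ (by positivity) σ)
    rw [prefixWeight_eq_pow, ← Real.exp_nat_mul, mul_one]
    exact Real.exp_le_exp.mpr (Finset.mem_filter.mp hσ).2.le
  have hexp : (Real.exp 1 - 1) * k * (1 + Real.log n) - a ≤ Real.log n * -(γ * k) := by
    have hk0 : (0 : ℝ) ≤ k := Nat.cast_nonneg k
    have h1 : (Real.exp 1 - 1) * (1 + Real.log n) ≤ γ * Real.log n := by nlinarith
    rw [ha]
    nlinarith [mul_le_mul_of_nonneg_left h1 hk0]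
  rw [div_le_iff₀ (by positivity), Real.rpow_def_of_pos hn0]
  calc (A.card : ℝ) = A.card * Real.exp a * Real.exp (-a) := by
        rw [mul_assoc, ← Real.exp_add]; simp
    _ ≤ n.factorial * Real.exp ((Real.exp 1 - 1) * k * (1 + Real.log n)) * Real.exp (-a) :=
        mul_le_mul_of_nonneg_right (hmarkov.trans hmgf) (Real.exp_pos _).le
    _ = Real.exp ((Real.exp 1 - 1) * k * (1 + Real.log n) - a) * n.factorial := by
        rw [mul_assoc, ← Real.exp_add, mul_comm, ← sub_eq_add_neg]
    _ ≤ _ := by gcongr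
end

section
/- Let P be a set of n ≥ e² elements, let c > 1 and let k ≥ 1 be an integer. Let Φ be a property of P. Let ⟨p_1, …, p_n⟩ be a uniformly random permutation of P, write P_i = {p_1, …, p_i}, and let X_i be the indicator of the event p_i ∈ Φ(P_i). Suppose that with probability at least 1 − n^{−c}, |Φ(P_i)| ≤ k holds simultaneously for all i = 1, …, n. Then for every real γ ≥ 2e, the probability that Σ_{i=1}^n X_i > γ·(2k ln n) is at most n^{−γk} + n^{−c}. Moreover, if |Φ(X)| ≤ k holds deterministically for all subsets X ⊆ P, the bound n^{−γk} alone holds. -/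
open Finset

/-- The number of `i` such that the `i`-th element of the enumeration `σ` belongs to the property
`Φ` of the set of the first elements up to and including the `i`-th one. -/
def backwardCount {α : Type*} [DecidableEq α] {n : ℕ} (Φ : Finset α → Finset α)
    (σ : Fin n ≃ α) : ℕ :=
  #{i : Fin n | σ i ∈ Φ (image σ (Iic i))}

/-- The enumerations of `α` ending in `a` correspond to the enumerations of the complement
of `a`. -/
def equivLastEquiv {α : Type*} [DecidableEq α] (n : ℕ) (a : α) :
    {σ : Fin (n + 1) ≃ α // σ (Fin.last n) = a} ≃ (Fin n ≃ {x : α // x ≠ a}) :=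
  ((finSuccEquivLast.equivCongr (Equiv.refl α)).subtypeEquiv (by
    intro σ
    simp [Equiv.equivCongr])).trans (Equiv.optionSubtype a)

theorem equivLastEquiv_apply {α : Type*} [DecidableEq α] {n : ℕ} {a : α}
    (σ : {σ : Fin (n + 1) ≃ α // σ (Fin.last n) = a}) (i : Fin n) :
    (equivLastEquiv n a σ i : α) = σ.1 i.castSucc := by
  simp [equivLastEquiv, Equiv.equivCongr]

/-- The property induced by `Φ` on the complement of a point. -/
def restrictProperty {α : Type*} [DecidableEq α] (Φ : Finset α → Finset α) (a : α)
    (X : Finset {x : α // x ≠ a}) : Finset {x : α // x ≠ a} :=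
  (Φ (X.map (Function.Embedding.subtype _))).subtype (· ≠ a)

theorem card_restrictProperty_le {α : Type*} [DecidableEq α] (Φ : Finset α → Finset α) (a : α)
    (X : Finset {x : α // x ≠ a}) :
    #(restrictProperty Φ a X) ≤ #(Φ (X.map (Function.Embedding.subtype _))) := by
  rw [restrictProperty, card_subtype]
  exact card_filter_le _ _

theorem backwardCount_eq_add {α : Type*} [Fintype α] [DecidableEq α] {n : ℕ}
    (Φ : Finset α → Finset α) {a : α} (σ : {σ : Fin (n + 1) ≃ α // σ (Fin.last n) = a}) :
    backwardCount Φ σ.1 =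
      backwardCount (restrictProperty Φ a) (equivLastEquiv n a σ) +
        if a ∈ Φ univ then 1 else 0 := by
  have himage (i : Fin n) : image σ.1 (Iic i.castSucc) =
      (image (equivLastEquiv n a σ) (Iic i)).map (Function.Embedding.subtype _) := by
    ext x
    simp only [mem_image, mem_Iic, mem_map, Function.Embedding.subtype_apply]
    constructor
    · rintro ⟨j, hj, rfl⟩
      have hjn : j ≠ Fin.last n := (hj.trans_lt (Fin.castSucc_lt_last i)).ne
      obtain ⟨j, rfl⟩ := Fin.exists_castSucc_eq.2 hjn
      exact ⟨_, ⟨j, Fin.castSucc_le_castSucc_iff.1 hj, rfl⟩, equivLastEquiv_apply σ j⟩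
    · rintro ⟨_, ⟨j, hj, rfl⟩, rfl⟩
      exact ⟨j.castSucc, Fin.castSucc_le_castSucc_iff.2 hj, (equivLastEquiv_apply σ j).symm⟩
  have hlast : image σ.1 (Iic (Fin.last n)) = univ := by
    have hIic : Iic (Fin.last n) = univ := Iic_top
    rw [hIic]
    exact image_univ_equiv σ.1
  simp only [backwardCount, card_filter, Fin.sum_univ_castSucc]
  rw [hlast, σ.2]
  congr 1
  refine sum_congr rfl fun i _ => ?_
  simp only [himage, restrictProperty, mem_subtype, equivLastEquiv_apply]

/-- Exponential moment bound for backward analysis. -/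
theorem sum_pow_backwardCount_le (k : ℕ) {w : ℝ} (hw : 1 ≤ w) (n : ℕ) :
    ∀ {α : Type*} [Fintype α] [DecidableEq α], Fintype.card α = n →
      ∀ Φ : Finset α → Finset α, (∀ X, #(Φ X) ≤ k) →
        ∑ σ : Fin n ≃ α, w ^ backwardCount Φ σ ≤
          n.factorial * ∏ i ∈ range n, (1 + (w - 1) * k * ((i + 1 : ℕ) : ℝ)⁻¹) := by
  induction n with
  | zero =>
    intro α _ _ hα Φ _
    have : IsEmpty α := Fintype.card_eq_zero_iff.1 hα
    simp [backwardCount, Fintype.card_le_one_iff_subsingleton, Equiv.equiv_subsingleton_cod]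
  | succ n ih =>
    intro α _ _ hα Φ hΦ
    set B : ℝ := n.factorial * ∏ i ∈ range n, (1 + (w - 1) * k * ((i + 1 : ℕ) : ℝ)⁻¹) with hB
    have hw' : 0 ≤ w - 1 := sub_nonneg.2 hw
    have hB0 : 0 ≤ B := by positivity
    have hfiber (a : α) : ∑ σ : Fin (n + 1) ≃ α with σ (Fin.last n) = a, w ^ backwardCount Φ σ ≤
        B * (1 + (w - 1) * if a ∈ Φ univ then 1 else 0) := by
      have hcard : Fintype.card {x : α // x ≠ a} = n := by
        rw [Fintype.card_subtype_compl, Fintype.card_subtype_eq, hα, Nat.add_sub_cancel]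
      have hbound := ih hcard (restrictProperty Φ a)
        fun X => (card_restrictProperty_le Φ a X).trans (hΦ _)
      have hweight : w ^ (if a ∈ Φ univ then 1 else 0) =
          1 + (w - 1) * if a ∈ Φ univ then (1 : ℝ) else 0 := by
        split_ifs <;> simp
      rw [← hweight, ← sum_subtype_eq_sum_filter, subtype_univ]
      simp only [backwardCount_eq_add, pow_add]
      rw [← sum_mul, (equivLastEquiv n a).sum_comp
        fun τ => w ^ backwardCount (restrictProperty Φ a) τ]
      gcongr
    calc ∑ σ : Fin (n + 1) ≃ α, w ^ backwardCount Φ σ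
        = ∑ a, ∑ σ : Fin (n + 1) ≃ α with σ (Fin.last n) = a, w ^ backwardCount Φ σ :=
          (sum_fiberwise _ _ _).symm
      _ ≤ ∑ a, B * (1 + (w - 1) * if a ∈ Φ univ then 1 else 0) := sum_le_sum fun a _ => hfiber a
      _ = B * ((n + 1 : ℕ) + (w - 1) * #(Φ univ)) := by
          rw [← mul_sum, sum_add_distrib, ← mul_sum]
          simp [hα]
      _ ≤ B * ((n + 1 : ℕ) + (w - 1) * k) := by
          gcongr
          exact hΦ univ
      _ = _ := by
          rw [prod_range_succ, Nat.factorial_succ, hB]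
          push_cast
          field_simp

theorem sum_exp_backwardCount_le {α : Type*} [Fintype α] [DecidableEq α] {n : ℕ}
    (hn : Fintype.card α = n) (k : ℕ) (Φ : Finset α → Finset α) (hΦ : ∀ X, #(Φ X) ≤ k) :
    ∑ σ : Fin n ≃ α, Real.exp 1 ^ backwardCount Φ σ ≤
      n.factorial * Real.exp ((Real.exp 1 - 1) * k * (1 + Real.log n)) := by
  have he : 1 ≤ Real.exp 1 := Real.one_le_exp zero_le_one
  have he' : 0 ≤ Real.exp 1 - 1 := sub_nonneg.2 he
  refine (sum_pow_backwardCount_le k he n hn Φ hΦ).trans ?_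
  gcongr
  calc ∏ i ∈ range n, (1 + (Real.exp 1 - 1) * k * ((i + 1 : ℕ) : ℝ)⁻¹)
      ≤ ∏ i ∈ range n, Real.exp ((Real.exp 1 - 1) * k * ((i + 1 : ℕ) : ℝ)⁻¹) := by
        refine prod_le_prod (fun i _ => by positivity) fun i _ => ?_
        rw [add_comm]
        exact Real.add_one_le_exp _
    _ = Real.exp ((Real.exp 1 - 1) * k * (harmonic n : ℝ)) := by
        rw [← Real.exp_sum, ← mul_sum]
        simp [harmonic]
    _ ≤ _ := by
        gcongr
        exact harmonic_le_one_add_log n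

/-- Backward analysis tail bound when the property is always small. -/
theorem card_backwardCount_tail_le {α : Type*} [Fintype α] [DecidableEq α] {n : ℕ}
    (hn : Fintype.card α = n) (hne : Real.exp 1 ^ 2 ≤ (n : ℝ)) (k : ℕ)
    (Φ : Finset α → Finset α) (hΦ : ∀ X, #(Φ X) ≤ k) {γ : ℝ} (hγ : 2 * Real.exp 1 ≤ γ) :
    (#{σ : Fin n ≃ α | γ * (2 * k * Real.log n) < backwardCount Φ σ} : ℝ) / n.factorial ≤
      (n : ℝ) ^ (-(γ * k)) := by
  have hn0 : (0 : ℝ) < n := lt_of_lt_of_le (by positivity) hne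
  have hlog : 2 ≤ Real.log n := by
    rw [Real.le_log_iff_exp_le hn0]
    simpa [← Real.exp_nat_mul] using hne
  have he : 0 ≤ Real.exp 1 - 1 := sub_nonneg.2 (Real.one_le_exp zero_le_one)
  set T := γ * (2 * k * Real.log n) with hT
  have hmarkov : (#{σ : Fin n ≃ α | T < backwardCount Φ σ} : ℝ) * Real.exp T ≤
      ∑ σ : Fin n ≃ α, Real.exp 1 ^ backwardCount Φ σ := by
    rw [← nsmul_eq_mul]
    refine (card_nsmul_le_sum _ _ _ fun σ hσ => ?_).trans
      (sum_le_sum_of_subset_of_nonneg (filter_subset _ _) fun _ _ _ => by positivity)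
    rw [← Real.exp_nat_mul, mul_one]
    exact Real.exp_le_exp.2 (mem_filter.1 hσ).2.le
  have hexponent : (Real.exp 1 - 1) * k * (1 + Real.log n) ≤ Real.log n * -(γ * k) + T := by
    calc (Real.exp 1 - 1) * k * (1 + Real.log n)
        ≤ (Real.exp 1 - 1) * k * (2 * Real.log n) := by
          gcongr
          linarith
      _ = k * Real.log n * (2 * (Real.exp 1 - 1)) := by ring
      _ ≤ k * Real.log n * γ := by
          gcongr
          linarith
      _ = _ := by rw [hT]; ring
  rw [div_le_iff₀ (by positivity), Real.rpow_def_of_pos hn0]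
  refine le_of_mul_le_mul_right ?_ (Real.exp_pos T)
  calc _ ≤ _ := hmarkov.trans (sum_exp_backwardCount_le hn k Φ hΦ)
    _ ≤ n.factorial * Real.exp (Real.log n * -(γ * k) + T) := by gcongr
    _ = _ := by rw [Real.exp_add]; ring

/-- Corollary (backward analysis, high-probability form): if with probability at
least `1 - n^{-c}` we have `|Φ(P_i)| ≤ k` simultaneously for all `i`, then for
any `γ ≥ 2e` the probability that `∑ X_i > γ·(2 k ln n)` is at most
`n^{-γ k} + n^{-c}`; moreover, if `|Φ(X)| ≤ k` holds deterministically for all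
subsets `X`, then the bound `n^{-γ k}` alone holds.  The uniformly random
permutation `⟨p_1, …, p_n⟩` of `P` is modeled as a uniformly random bijection
`σ : Fin n ≃ α`, with `p_i = σ i` and `P_i = σ({0,…,i})`; here `n ≥ e²`. -/
theorem backward_analysis_corollary
    {α : Type*} [Fintype α] [DecidableEq α] (n : ℕ) (hn : Fintype.card α = n)
    (hne : Real.exp 1 ^ 2 ≤ (n : ℝ))
    (k : ℕ) (hk : 1 ≤ k)
    (c : ℝ) (hc : 1 < c)
    (Φ : Finset α → Finset α)
    (hsub : ∀ X : Finset α, Φ X ⊆ X)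
    (hgood :
      1 - (n : ℝ) ^ (-c) ≤
        ((Finset.univ.filter
            (fun σ : Fin n ≃ α =>
              ∀ i : Fin n,
                (Φ (Finset.image (⇑σ) (Finset.Iic i))).card ≤ k)).card : ℝ)
          / (Nat.factorial n : ℝ))
    (γ : ℝ) (hγ : 2 * Real.exp 1 ≤ γ) :
    (((Finset.univ.filter
        (fun σ : Fin n ≃ α =>
          γ * (2 * k * Real.log n) <
            ((Finset.univ.filter
                (fun i : Fin n =>
                  σ i ∈ Φ (Finset.image (⇑σ) (Finset.Iic i)))).card : ℝ))).card : ℝ)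
        / (Nat.factorial n : ℝ)
      ≤ (n : ℝ) ^ (-(γ * k)) + (n : ℝ) ^ (-c))
    ∧ ((∀ X : Finset α, (Φ X).card ≤ k) →
        ((Finset.univ.filter
            (fun σ : Fin n ≃ α =>
              γ * (2 * k * Real.log n) <
                ((Finset.univ.filter
                    (fun i : Fin n =>
                      σ i ∈ Φ (Finset.image (⇑σ) (Finset.Iic i)))).card : ℝ))).card : ℝ)
            / (Nat.factorial n : ℝ)
          ≤ (n : ℝ) ^ (-(γ * k))) := by
  refine ⟨?_, fun hΦ => card_backwardCount_tail_le hn hne k Φ hΦ hγ⟩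
  let Ψ : Finset α → Finset α := fun X => if #(Φ X) ≤ k then Φ X else ∅
  have hΨ (X : Finset α) : #(Ψ X) ≤ k := by
    dsimp only [Ψ]
    split_ifs with h <;> simp [h]
  let G : Finset (Fin n ≃ α) := {σ | ∀ i, #(Φ (image σ (Iic i))) ≤ k}
  have htail := card_backwardCount_tail_le hn hne k Ψ hΨ hγ
  have hcompl : (#Gᶜ : ℝ) / n.factorial ≤ (n : ℝ) ^ (-c) := by
    have hcard : (#G : ℝ) + #Gᶜ = n.factorial := by
      have hequiv : Fintype.card (Fin n ≃ α) = n.factorial := by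
        rw [Fintype.card_equiv (Fintype.equivFinOfCardEq hn).symm, Fintype.card_fin]
      rw [← hequiv]
      exact_mod_cast card_add_card_compl G
    have hfac : (0 : ℝ) < n.factorial := by positivity
    have hsum : (#G : ℝ) / n.factorial + #Gᶜ / n.factorial = 1 := by
      rw [← add_div, hcard, div_self hfac.ne']
    linarith
  refine le_trans ?_ (add_le_add htail hcompl)
  rw [← add_div]
  gcongr
  norm_cast
  refine (card_le_card fun σ hσ => ?_).trans (card_union_le _ _)
  by_cases hG : σ ∈ G
  · refine mem_union_left _ (mem_filter.2 ⟨mem_univ _, ?_⟩)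
    have hcount : backwardCount Ψ σ = backwardCount Φ σ := by
      simp only [backwardCount, Ψ, if_pos ((mem_filter.1 hG).2 _)]
    rw [hcount]
    exact (mem_filter.1 hσ).2
  · exact mem_union_right _ (mem_compl.2 hG)
end

section
/- For every integer d ≥ 1 and every real Δ with 0 < Δ ≤ 1, the d-dimensional Lebesgue measure of the set {p = (p_1, …, p_d) ∈ [0,1]^d : p_1·p_2·⋯·p_d ≤ Δ} equals Σ_{i=0}^{d−1} (Δ/i!)·(ln(1/Δ))^i. -/
open MeasureTheory

/-- The set of points of the unit cube with coordinate product at most `Δ`. -/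
def lowPointVolumeSet (d : ℕ) (Δ : ℝ) : Set (Fin d → ℝ) :=
  {p | (∀ i, p i ∈ Set.Icc (0 : ℝ) 1) ∧ ∏ i, p i ≤ Δ}

lemma measurableSet_lowPointVolumeSet (d : ℕ) (Δ : ℝ) :
    MeasurableSet (lowPointVolumeSet d Δ) := by
  apply IsClosed.measurableSet
  have h : lowPointVolumeSet d Δ =
      (Set.univ.pi fun _ : Fin d => Set.Icc (0 : ℝ) 1) ∩ {p | ∏ i, p i ≤ Δ} := by
    ext p
    simp only [lowPointVolumeSet, Set.mem_inter_iff, Set.mem_univ_pi, Set.mem_ofPred_eq]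
  rw [h]
  exact (isClosed_set_pi fun _ _ => isClosed_Icc).inter
    (isClosed_le (by fun_prop) continuous_const)

lemma volume_lowPointVolumeSet_of_one_le (d : ℕ) {Δ : ℝ} (h : 1 ≤ Δ) :
    volume (lowPointVolumeSet d Δ) = 1 := by
  have hs : lowPointVolumeSet d Δ = Set.univ.pi fun _ : Fin d => Set.Icc (0 : ℝ) 1 := by
    ext p
    simp only [lowPointVolumeSet, Set.mem_ofPred_eq, Set.mem_univ_pi, and_iff_left_iff_imp]
    intro hp
    exact (Finset.prod_le_one (fun i _ => (hp i).1) fun i _ => (hp i).2).trans h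
  rw [hs, volume_pi_pi]
  simp

lemma volume_lowPointVolumeSet_succ (d : ℕ) (Δ : ℝ) :
    volume (lowPointVolumeSet (d + 1) Δ) =
      ∫⁻ x, volume {q : Fin d → ℝ | Fin.cons x q ∈ lowPointVolumeSet (d + 1) Δ} := by
  have hm := measurableSet_lowPointVolumeSet (d + 1) Δ
  have e := (volume_preserving_piFinSuccAbove (fun _ : Fin (d + 1) => ℝ) 0).symm
  rw [← e.measure_preimage hm.nullMeasurableSet, Measure.volume_eq_prod,
    Measure.prod_apply (e.measurable hm)]
  refine lintegral_congr fun x => congrArg volume ?_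
  ext q
  simp [MeasurableEquiv.piFinSuccAbove, Fin.consEquiv]

lemma volume_slice_lowPointVolumeSet (d : ℕ) {Δ : ℝ} (hΔ0 : 0 < Δ) (hΔ1 : Δ ≤ 1) (x : ℝ) :
    volume {q : Fin d → ℝ | Fin.cons x q ∈ lowPointVolumeSet (d + 1) Δ} =
      (Set.Icc 0 Δ).indicator 1 x +
        (Set.Ioc Δ 1).indicator (fun x => volume (lowPointVolumeSet d (Δ / x))) x := by
  by_cases hx : x ∈ Set.Icc (0 : ℝ) 1
  · rcases le_or_gt x Δ with h | h
    · have hs : {q : Fin d → ℝ | Fin.cons x q ∈ lowPointVolumeSet (d + 1) Δ} =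
          lowPointVolumeSet d 1 := by
        ext q
        simp only [lowPointVolumeSet, Set.mem_ofPred_eq, Fin.forall_fin_succ, Fin.cons_zero,
          Fin.cons_succ, Fin.prod_univ_succ]
        constructor
        · rintro ⟨⟨-, hq⟩, -⟩
          exact ⟨hq, Finset.prod_le_one (fun i _ => (hq i).1) fun i _ => (hq i).2⟩
        · rintro ⟨hq, hp⟩
          exact ⟨⟨hx, hq⟩, (mul_le_of_le_one_right hx.1 hp).trans h⟩
      rw [hs, volume_lowPointVolumeSet_of_one_le d le_rfl,
        Set.indicator_of_mem (Set.mem_Icc.2 ⟨hx.1, h⟩), Set.indicator_of_notMem (fun h' => h.not_gt h'.1)]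
      simp
    · have hs : {q : Fin d → ℝ | Fin.cons x q ∈ lowPointVolumeSet (d + 1) Δ} =
          lowPointVolumeSet d (Δ / x) := by
        ext q
        simp only [lowPointVolumeSet, Set.mem_ofPred_eq, Fin.forall_fin_succ, Fin.cons_zero,
          Fin.cons_succ, Fin.prod_univ_succ, le_div_iff₀' (hΔ0.trans h)]
        tauto
      rw [hs, Set.indicator_of_notMem (fun h' => h.not_ge h'.2),
        Set.indicator_of_mem (Set.mem_Ioc.2 ⟨h, hx.2⟩), zero_add]
  · have hs : {q : Fin d → ℝ | Fin.cons x q ∈ lowPointVolumeSet (d + 1) Δ} = ∅ := by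
      ext q
      simp only [lowPointVolumeSet, Set.mem_ofPred_eq, Fin.forall_fin_succ, Fin.cons_zero,
        Set.mem_empty_iff_false, iff_false]
      tauto
    rw [hs, Set.indicator_of_notMem (fun h' => hx ⟨h'.1, h'.2.trans hΔ1⟩),
      Set.indicator_of_notMem (fun h' => hx ⟨hΔ0.le.trans h'.1.le, h'.2⟩)]
    simp

lemma integral_div_mul_log_pow {Δ : ℝ} (hΔ0 : 0 < Δ) (hΔ1 : Δ ≤ 1) (i : ℕ) :
    IntervalIntegrable
        (fun x => Δ / x / (Nat.factorial i : ℝ) * Real.log (1 / (Δ / x)) ^ i) volume Δ 1 ∧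
      ∫ x in Δ..1, Δ / x / (Nat.factorial i : ℝ) * Real.log (1 / (Δ / x)) ^ i =
        Δ / (Nat.factorial (i + 1) : ℝ) * Real.log (1 / Δ) ^ (i + 1) := by
  have hpos : ∀ x ∈ Set.uIcc Δ 1, 0 < x := fun x hx => by
    rw [Set.uIcc_of_le hΔ1] at hx
    exact hΔ0.trans_le hx.1
  have hint : IntervalIntegrable
      (fun x => Δ / x / (Nat.factorial i : ℝ) * Real.log (1 / (Δ / x)) ^ i) volume Δ 1 := by
    apply ContinuousOn.intervalIntegrable
    have h0 : ∀ x ∈ Set.uIcc Δ 1, x ≠ 0 := fun x hx => (hpos x hx).ne'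
    have h1 : ContinuousOn (fun x => Δ / x) (Set.uIcc Δ 1) :=
      continuousOn_const.div continuousOn_id h0
    have h2 : ∀ x ∈ Set.uIcc Δ 1, Δ / x ≠ 0 := fun x hx => div_ne_zero hΔ0.ne' (h0 x hx)
    exact (h1.div_const _).mul (((continuousOn_const.div h1 h2).log
      fun x hx => one_div_ne_zero (h2 x hx)).pow i)
  refine ⟨hint, ?_⟩
  have hderiv : ∀ x ∈ Set.uIcc Δ 1, HasDerivAt
      (fun x => Δ / (Nat.factorial (i + 1) : ℝ) * Real.log (x / Δ) ^ (i + 1))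
      (Δ / x / (Nat.factorial i : ℝ) * Real.log (1 / (Δ / x)) ^ i) x := by
    intro x hx
    have hx0 := hpos x hx
    refine (((((hasDerivAt_id x).div_const Δ).log (div_pos hx0 hΔ0).ne').pow (i + 1)).const_mul
      (Δ / (Nat.factorial (i + 1) : ℝ))).congr_deriv ?_
    have hf : (Nat.factorial i : ℝ) ≠ 0 := by positivity
    rw [one_div_div, Nat.factorial_succ]
    push_cast
    simp only [id]
    field_simp
  rw [intervalIntegral.integral_eq_sub_of_hasDerivAt hderiv hint]
  simp [div_self hΔ0.ne']

lemma lintegral_sum_log_pow (d : ℕ) {Δ : ℝ} (hΔ0 : 0 < Δ) (hΔ1 : Δ ≤ 1) :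
    ∫⁻ x in Set.Ioc Δ 1, ENNReal.ofReal (∑ i ∈ Finset.range d,
        Δ / x / (Nat.factorial i : ℝ) * Real.log (1 / (Δ / x)) ^ i) =
      ENNReal.ofReal (∑ i ∈ Finset.range d,
        Δ / (Nat.factorial (i + 1) : ℝ) * Real.log (1 / Δ) ^ (i + 1)) := by
  have hint := fun i => (integral_div_mul_log_pow hΔ0 hΔ1 i).1
  rw [← ofReal_integral_eq_lintegral_ofReal]
  · rw [← intervalIntegral.integral_of_le hΔ1,
      intervalIntegral.integral_finsetSum fun i _ => hint i]
    simp only [(integral_div_mul_log_pow hΔ0 hΔ1 _).2]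
  · exact integrable_finsetSum _ fun i _ =>
      (intervalIntegrable_iff_integrableOn_Ioc_of_le hΔ1).1 (hint i)
  · filter_upwards [ae_restrict_mem measurableSet_Ioc] with x hx
    have hx0 : 0 < x := hΔ0.trans hx.1
    have hlog : 0 ≤ Real.log (1 / (Δ / x)) := by
      rw [one_div_div]
      exact Real.log_nonneg ((one_le_div hΔ0).2 hx.1.le)
    exact Finset.sum_nonneg fun i _ => by positivity

lemma volume_lowPointVolumeSet_succ_eq (d : ℕ)
    (ih : ∀ Δ : ℝ, 0 < Δ → Δ < 1 → volume (lowPointVolumeSet d Δ) = ENNReal.ofReal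
      (∑ i ∈ Finset.range d, Δ / (Nat.factorial i : ℝ) * Real.log (1 / Δ) ^ i))
    {Δ : ℝ} (hΔ0 : 0 < Δ) (hΔ1 : Δ ≤ 1) :
    volume (lowPointVolumeSet (d + 1) Δ) = ENNReal.ofReal
      (∑ i ∈ Finset.range (d + 1), Δ / (Nat.factorial i : ℝ) * Real.log (1 / Δ) ^ i) := by
  have hlog : 0 ≤ Real.log (1 / Δ) := Real.log_nonneg ((one_le_div hΔ0).2 hΔ1)
  rw [volume_lowPointVolumeSet_succ]
  simp only [volume_slice_lowPointVolumeSet d hΔ0 hΔ1]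
  rw [lintegral_add_left (measurable_one.indicator measurableSet_Icc),
    lintegral_indicator_one measurableSet_Icc, lintegral_indicator measurableSet_Ioc,
    setLIntegral_congr_fun measurableSet_Ioc fun x hx =>
      ih (Δ / x) (div_pos hΔ0 (hΔ0.trans hx.1)) ((div_lt_one (hΔ0.trans hx.1)).2 hx.1),
    lintegral_sum_log_pow d hΔ0 hΔ1, Real.volume_Icc,
    ← ENNReal.ofReal_add (by linarith) (Finset.sum_nonneg fun i _ => by positivity),
    Finset.sum_range_succ']
  congr 1
  simp [add_comm]

lemma volume_lowPointVolumeSet_of_lt_one (d : ℕ) :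
    ∀ Δ : ℝ, 0 < Δ → Δ < 1 → volume (lowPointVolumeSet d Δ) = ENNReal.ofReal
      (∑ i ∈ Finset.range d, Δ / (Nat.factorial i : ℝ) * Real.log (1 / Δ) ^ i) := by
  induction d with
  | zero =>
    intro Δ _ h
    simp [lowPointVolumeSet, h.not_ge]
  | succ d ih => exact fun Δ h0 h1 => volume_lowPointVolumeSet_succ_eq d ih h0 h1.le

/-- For `0 < Δ ≤ 1` and `d ≥ 1`, the Lebesgue measure of the set of points of
the unit hypercube `[0,1]^d` whose coordinate product (point volume) is at most
`Δ` equals `∑_{i=0}^{d-1} (Δ / i!) · (ln(1/Δ))^i`. -/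
theorem volume_low_point_volume
    (d : ℕ) (hd : 1 ≤ d) (Δ : ℝ) (hΔ0 : 0 < Δ) (hΔ1 : Δ ≤ 1) :
    volume {p : Fin d → ℝ | (∀ i, p i ∈ Set.Icc (0 : ℝ) 1) ∧ ∏ i, p i ≤ Δ}
      = ENNReal.ofReal
          (∑ i ∈ Finset.range d, Δ / (Nat.factorial i : ℝ) * Real.log (1 / Δ) ^ i) := by
  obtain ⟨n, rfl⟩ := Nat.exists_eq_add_of_le' hd
  exact volume_lowPointVolumeSet_succ_eq n (volume_lowPointVolumeSet_of_lt_one n) hΔ0 hΔ1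
end

section
/- There is an absolute constant c with the following property. Let S = {s_1, …, s_n} be any set of n ≥ 2 distinct sites in ℝ², let d ≥ 1, and let α_1, …, α_n ∈ [0,1]^d be arbitrary parametric points associated with the sites. Then the number of distinct candidate sets realized over the whole plane, i.e. the cardinality of the collection {C(x) : x ∈ ℝ²}, is at most c·n⁴. -/
open EuclideanSpace

/-- The candidate set of a point `x ∈ ℝ²`: the set of indices `i` such that the
point `(α_i, dist(x, s_i)) ∈ ℝ^{d+1}` is a staircase point (Pareto minimum) of
the point set `{(α_1, ℓ_1), …, (α_n, ℓ_n)}`, i.e. no other point of that set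
dominates it coordinatewise. -/
def candSet {n d : ℕ} (s : Fin n → EuclideanSpace ℝ (Fin 2))
    (α : Fin n → Fin d → ℝ) (x : EuclideanSpace ℝ (Fin 2)) : Set (Fin n) :=
  {i | ∀ j : Fin n,
      (α j, dist x (s j)) ≠ (α i, dist x (s i)) →
      ¬((∀ m, α j m ≤ α i m) ∧ dist x (s j) ≤ dist x (s i))}

/-- The list of signs at `x` of the affine functions in `L`. -/
noncomputable def signVector {E : Type*} [AddCommGroup E] [Module ℝ E] (L : List (E →ᵃ[ℝ] ℝ)) (x : E) :
    List SignType :=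
  L.map fun f => SignType.sign (f x)

section SignVector

variable {E : Type*} [AddCommGroup E] [Module ℝ E]

lemma sign_lineMap_of_sign_eq {a b t : ℝ} (h : SignType.sign a = SignType.sign b)
    (ht : t ∈ Set.Icc (0 : ℝ) 1) :
    SignType.sign (AffineMap.lineMap a b t) = SignType.sign a := by
  obtain ⟨h0, h1⟩ := ht
  rw [AffineMap.lineMap_apply_ring']
  rcases lt_trichotomy a 0 with ha | ha | ha
  · rw [sign_neg ha] at h ⊢
    have hb : b < 0 := sign_eq_neg_one_iff.1 h.symm
    refine sign_neg ?_
    by_contra! hc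
    nlinarith [mul_nonneg h0 (neg_nonneg.2 hb.le),
      mul_nonneg (sub_nonneg.2 h1) (neg_nonneg.2 ha.le)]
  · subst ha
    have hb : b = 0 := sign_eq_zero_iff.1 (by rw [← h, sign_zero])
    simp [hb]
  · rw [sign_pos ha] at h ⊢
    have hb : 0 < b := sign_eq_one_iff.1 h.symm
    refine sign_pos ?_
    by_contra! hc
    nlinarith [mul_nonneg h0 hb.le, mul_nonneg (sub_nonneg.2 h1) ha.le]

lemma exists_lineMap_eq_zero {a b : ℝ} (ha : a < 0) (hb : 0 < b) :
    ∃ t ∈ Set.Icc (0 : ℝ) 1, AffineMap.lineMap a b t = 0 := by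
  have hab : 0 < b - a := by linarith
  refine ⟨-a / (b - a), ⟨by apply div_nonneg <;> linarith, ?_⟩, ?_⟩
  · rw [div_le_one hab]; linarith
  · rw [AffineMap.lineMap_apply_ring']; field_simp; ring

lemma signVector_lineMap {L : List (E →ᵃ[ℝ] ℝ)} {x y : E} {t : ℝ}
    (h : signVector L x = signVector L y) (ht : t ∈ Set.Icc (0 : ℝ) 1) :
    signVector L (AffineMap.lineMap x y t) = signVector L x := by
  refine List.map_congr_left fun f hf => ?_
  rw [AffineMap.apply_lineMap]
  exact sign_lineMap_of_sign_eq (List.map_inj_left.1 h f hf) ht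

lemma exists_zero_of_signVector_eq {K : Set E} (hK : Convex ℝ K) (f : E →ᵃ[ℝ] ℝ)
    {L : List (E →ᵃ[ℝ] ℝ)} {x y : E} (hx : x ∈ K) (hy : y ∈ K)
    (h : signVector L x = signVector L y) (hfx : f x < 0) (hfy : 0 < f y) :
    ∃ z ∈ K ∩ {z | f z = 0}, signVector L z = signVector L x := by
  obtain ⟨t, ht, h0⟩ := exists_lineMap_eq_zero hfx hfy
  exact ⟨AffineMap.lineMap x y t,
    ⟨hK.lineMap_mem hx hy ht, by rw [Set.mem_ofPred_eq, AffineMap.apply_lineMap, h0]⟩,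
    signVector_lineMap h ht⟩

lemma sign_eq_of_signVector_eq {K : Set E} (hK : Convex ℝ K) (f : E →ᵃ[ℝ] ℝ)
    {L : List (E →ᵃ[ℝ] ℝ)} {x y : E} (hx : x ∈ K) (hy : y ∈ K)
    (h : signVector L x = signVector L y)
    (hZ : signVector L x ∉ signVector L '' (K ∩ {z | f z = 0})) :
    SignType.sign (f x) = SignType.sign (f y) := by
  have hx0 : f x ≠ 0 := fun h0 => hZ ⟨x, ⟨hx, h0⟩, rfl⟩
  have hy0 : f y ≠ 0 := fun h0 => hZ ⟨y, ⟨hy, h0⟩, h.symm⟩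
  rcases hx0.lt_or_gt with hx1 | hx1 <;> rcases hy0.lt_or_gt with hy1 | hy1
  · rw [sign_neg hx1, sign_neg hy1]
  · obtain ⟨z, hz, hzx⟩ := exists_zero_of_signVector_eq hK f hx hy h hx1 hy1
    exact absurd ⟨z, hz, hzx⟩ hZ
  · obtain ⟨z, hz, hzy⟩ := exists_zero_of_signVector_eq hK f hy hx h.symm hy1 hx1
    exact absurd ⟨z, hz, hzy.trans h.symm⟩ hZ
  · rw [sign_pos hx1, sign_pos hy1]

/-- Adding one affine function `f` to the list creates at most two new sign vectors for each
sign vector that is realized on the zero set of `f`. -/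
lemma encard_signVector_cons_le {K : Set E} (hK : Convex ℝ K) (f : E →ᵃ[ℝ] ℝ)
    (L : List (E →ᵃ[ℝ] ℝ)) :
    (signVector (f :: L) '' K).encard ≤ (signVector L '' K).encard +
      2 * (signVector L '' (K ∩ {z | f z = 0})).encard := by
  classical
  set Z := signVector L '' (K ∩ {z | f z = 0})
  let g : List SignType → List SignType := fun σ =>
    (if h : σ ∉ Z ∧ ∃ x ∈ K, signVector L x = σ then SignType.sign (f h.2.choose) else 0) :: σ
  have hsub : signVector (f :: L) '' K ⊆
      g '' (signVector L '' K) ∪ (List.cons 1 '' Z ∪ List.cons (-1) '' Z) := by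
    rintro _ ⟨x, hx, rfl⟩
    have hcons : signVector (f :: L) x = SignType.sign (f x) :: signVector L x := rfl
    rw [hcons]
    by_cases hZ : signVector L x ∈ Z
    · rcases lt_trichotomy (f x) 0 with h | h | h
      · rw [sign_neg h]
        exact Or.inr (Or.inr ⟨_, hZ, rfl⟩)
      · refine Or.inl ⟨_, ⟨x, hx, rfl⟩, ?_⟩
        simp [g, hZ, h]
      · rw [sign_pos h]
        exact Or.inr (Or.inl ⟨_, hZ, rfl⟩)
    · refine Or.inl ⟨_, ⟨x, hx, rfl⟩, ?_⟩
      have h : signVector L x ∉ Z ∧ ∃ y ∈ K, signVector L y = signVector L x :=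
        ⟨hZ, x, hx, rfl⟩
      have hs := h.2.choose_spec
      simp only [g, dif_pos h]
      rw [sign_eq_of_signVector_eq hK f hx hs.1 hs.2.symm hZ]
  calc (signVector (f :: L) '' K).encard
      ≤ (g '' (signVector L '' K)).encard +
          ((List.cons 1 '' Z).encard + (List.cons (-1) '' Z).encard) :=
        (Set.encard_le_encard hsub).trans ((Set.encard_union_le _ _).trans
          (add_le_add le_rfl (Set.encard_union_le _ _)))
    _ ≤ (signVector L '' K).encard + (Z.encard + Z.encard) :=
        add_le_add (Set.encard_image_le _ _)
          (add_le_add (Set.encard_image_le _ _) (Set.encard_image_le _ _))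
    _ = _ := by rw [two_mul]

lemma finrank_vectorSpan_inter_zero_lt [FiniteDimensional ℝ E] {K : Set E} (f : E →ᵃ[ℝ] ℝ)
    {x y : E} (hx : x ∈ K) (hy : y ∈ K) (hxy : f x ≠ f y) :
    Module.finrank ℝ (vectorSpan ℝ (K ∩ {z | f z = 0})) < Module.finrank ℝ (vectorSpan ℝ K) := by
  refine Submodule.finrank_lt_finrank_of_lt (lt_of_le_of_ne
    (vectorSpan_mono ℝ Set.inter_subset_left) fun heq => hxy ?_)
  have hker : vectorSpan ℝ (K ∩ {z | f z = 0}) ≤ LinearMap.ker f.linear := by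
    rw [vectorSpan, Submodule.span_le]
    rintro _ ⟨a, ha, b, hb, rfl⟩
    have ha0 : f a = 0 := ha.2
    have hb0 : f b = 0 := hb.2
    rw [SetLike.mem_coe, LinearMap.mem_ker, AffineMap.linearMap_vsub, ha0, hb0, vsub_self]
  have hmem := hker (heq ▸ vsub_mem_vectorSpan ℝ hx hy)
  rw [LinearMap.mem_ker, AffineMap.linearMap_vsub, vsub_eq_sub] at hmem
  exact sub_eq_zero.1 hmem

/-- A list of affine functions realizes polynomially many sign vectors on a convex set, with
exponent the dimension of the set. -/
theorem encard_signVector_image_le [FiniteDimensional ℝ E] (L : List (E →ᵃ[ℝ] ℝ)) (k : ℕ)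
    {K : Set E} (hK : Convex ℝ K) (hk : Module.finrank ℝ (vectorSpan ℝ K) ≤ k) :
    (signVector L '' K).encard ≤ ((2 * L.length + 1) ^ k : ℕ) := by
  induction L generalizing K k with
  | nil =>
    refine (Set.encard_le_one_iff.2 ?_).trans (by simp)
    rintro _ _ ⟨x, -, rfl⟩ ⟨y, -, rfl⟩
    rfl
  | cons f L ih =>
    by_cases hf : ∃ x ∈ K, ∃ y ∈ K, f x ≠ f y
    · obtain ⟨x, hx, y, hy, hxy⟩ := hf
      have hlt := finrank_vectorSpan_inter_zero_lt f hx hy hxy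
      obtain ⟨k, rfl⟩ : ∃ m, k = m + 1 := ⟨k - 1, by omega⟩
      have hconv : Convex ℝ (K ∩ {z | f z = 0}) :=
        hK.inter ((convex_singleton (0 : ℝ)).affine_preimage f)
      refine (encard_signVector_cons_le hK f L).trans
        ((add_le_add (ih _ hK hk) (mul_le_mul_right (ih k hconv (by omega)) 2)).trans ?_)
      norm_cast
      rw [List.length_cons]
      have hpow : (2 * L.length + 1) ^ k ≤ (2 * (L.length + 1) + 1) ^ k :=
        Nat.pow_le_pow_left (by omega) k
      rw [pow_succ, pow_succ]
      nlinarith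
    · push Not at hf
      rcases K.eq_empty_or_nonempty with rfl | ⟨x, hx⟩
      · simp
      have himage : signVector (f :: L) '' K =
          List.cons (SignType.sign (f x)) '' (signVector L '' K) := by
        rw [Set.image_image]
        refine Set.image_congr fun y hy => ?_
        rw [hf x hx y hy]
        rfl
      rw [himage]
      refine (Set.encard_image_le _ _).trans ((ih k hK hk).trans ?_)
      exact_mod_cast Nat.pow_le_pow_left (by simp) k

end SignVector

/-- Half the difference of the squared distances to `p` and `q`, as an affine function. -/
noncomputable def bisectorMap {V : Type*} [NormedAddCommGroup V] [InnerProductSpace ℝ V]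
    (p q : V) : V →ᵃ[ℝ] ℝ :=
  (innerₛₗ ℝ (q - p)).toAffineMap + AffineMap.const ℝ V ((‖p‖ ^ 2 - ‖q‖ ^ 2) / 2)

lemma bisectorMap_apply {V : Type*} [NormedAddCommGroup V] [InnerProductSpace ℝ V] (p q x : V) :
    bisectorMap p q x = (dist x p ^ 2 - dist x q ^ 2) / 2 := by
  rw [dist_eq_norm, dist_eq_norm, norm_sub_sq_real, norm_sub_sq_real]
  simp only [bisectorMap, AffineMap.coe_add, Pi.add_apply, LinearMap.coe_toAffineMap,
    AffineMap.const_apply, innerₛₗ_apply_apply, real_inner_comm x, inner_sub_right]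
  ring

lemma sign_bisectorMap {V : Type*} [NormedAddCommGroup V] [InnerProductSpace ℝ V] (p q x : V) :
    SignType.sign (bisectorMap p q x) = SignType.sign (dist x p - dist x q) := by
  have hp := dist_nonneg (x := x) (y := p)
  have hq := dist_nonneg (x := x) (y := q)
  rw [bisectorMap_apply]
  rcases lt_trichotomy (dist x p) (dist x q) with h | h | h
  · rw [sign_neg, sign_neg] <;> nlinarith
  · simp [h]
  · rw [sign_pos, sign_pos] <;> nlinarith

/-- The bisector maps of all ordered pairs of sites. -/
noncomputable def bisectorList {n : ℕ} (s : Fin n → EuclideanSpace ℝ (Fin 2)) :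
    List (EuclideanSpace ℝ (Fin 2) →ᵃ[ℝ] ℝ) :=
  (Finset.univ : Finset (Fin n × Fin n)).toList.map fun p => bisectorMap (s p.1) (s p.2)

lemma length_bisectorList {n : ℕ} (s : Fin n → EuclideanSpace ℝ (Fin 2)) :
    (bisectorList s).length = n * n := by
  simp [bisectorList]

lemma candSet_eq_of_signVector_eq {n d : ℕ} (s : Fin n → EuclideanSpace ℝ (Fin 2))
    (α : Fin n → Fin d → ℝ) {x y : EuclideanSpace ℝ (Fin 2)}
    (h : signVector (bisectorList s) x = signVector (bisectorList s) y) :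
    candSet s α x = candSet s α y := by
  have hsign : ∀ i j, SignType.sign (dist x (s j) - dist x (s i)) =
      SignType.sign (dist y (s j) - dist y (s i)) := fun i j => by
    rw [← sign_bisectorMap, ← sign_bisectorMap]
    exact List.map_inj_left.1 h _ (List.mem_map.2 ⟨(j, i), by simp, rfl⟩)
  have hle : ∀ i j, dist x (s j) ≤ dist x (s i) ↔ dist y (s j) ≤ dist y (s i) := fun i j => by
    rw [← sub_nonpos, ← sign_nonpos_iff, hsign, sign_nonpos_iff, sub_nonpos]
  have heq : ∀ i j, dist x (s j) = dist x (s i) ↔ dist y (s j) = dist y (s i) := fun i j => by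
    rw [le_antisymm_iff, le_antisymm_iff, hle, hle]
  ext i
  simp only [candSet, Set.mem_ofPred_eq, ne_eq, Prod.mk.injEq, hle, heq]

/-- There is an absolute constant `c` such that for any `n ≥ 2` distinct sites
in the plane with arbitrary parametric points in `[0,1]^d`, the number of
distinct candidate sets realized over the whole plane is at most `c·n⁴`. -/
theorem card_candidate_sets_le :
    ∃ c : ℕ, 0 < c ∧
      ∀ (n d : ℕ), 2 ≤ n → 1 ≤ d →
      ∀ s : Fin n → EuclideanSpace ℝ (Fin 2), Function.Injective s →
      ∀ α : Fin n → Fin d → ℝ, (∀ i j, α i j ∈ Set.Icc (0 : ℝ) 1) →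
        (Set.range (fun x : EuclideanSpace ℝ (Fin 2) => candSet s α x)).ncard
          ≤ c * n ^ 4 := by
  refine ⟨9, by norm_num, fun n d hn _ s _ α _ => ?_⟩
  have hcount := encard_signVector_image_le (bisectorList s) 2 (K := Set.univ) convex_univ
    ((Submodule.finrank_le _).trans (by simp))
  rw [Set.image_univ, length_bisectorList] at hcount
  have hfactor : (candSet s α).FactorsThrough (signVector (bisectorList s)) :=
    fun x y h => candSet_eq_of_signVector_eq s α h
  obtain ⟨e, he⟩ := (Function.factorsThrough_iff _).1 hfactor
  have hrange : Set.range (fun x => candSet s α x) =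
      e '' Set.range (signVector (bisectorList s)) := by
    rw [← Set.range_comp, ← he]
  have hncard : (Set.range (fun x => candSet s α x)).encard ≤ ((2 * (n * n) + 1) ^ 2 : ℕ) := by
    rw [hrange]
    exact (Set.encard_image_le _ _).trans hcount
  refine (ENat.toNat_le_of_le_natCast hncard).trans ?_
  have h1 : 1 ≤ n * n := by nlinarith
  calc (2 * (n * n) + 1) ^ 2 ≤ (3 * (n * n)) ^ 2 := Nat.pow_le_pow_left (by omega) 2
    _ = 9 * n ^ 4 := by ring
end

section
/- Fix an integer d ≥ 1. For every γ > 0 there exists a constant c = c(γ, d) such that the following holds for all n ≥ 2 and all integers k ≥ 1. Let S = {s_1, …, s_n} be distinct sites in ℝ² in general position (no four sites lie on a common circle), and sample for each site a parametric point α_i ∈ [0,1]^d independently, with the d coordinates of each α_i independent and the j-th coordinate drawn from an atomless probability distribution μ_j on [0,1]. Then with probability at least 1 − n^{−γ} over this sampling, simultaneously for every point x ∈ ℝ², the k-th proxy set satisfies |Proxy_k(x, S)| ≤ c·k·ln n. -/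
open MeasureTheory

/-- The `k` nearest neighbors of `x` among the sites indexed by `T`: indices
`i ∈ T` such that fewer than `k` sites of `T` are strictly closer to `x`. -/
def nearK {n : ℕ} (s : Fin n → EuclideanSpace ℝ (Fin 2)) (T : Set (Fin n))
    (k : ℕ) (x : EuclideanSpace ℝ (Fin 2)) : Set (Fin n) :=
  {i | i ∈ T ∧ ({l | l ∈ T ∧ dist x (s l) < dist x (s i)}).ncard < k}

/-- The `k`-th proxy set of `x`: the union, over all prefixes of the volume
ordering (the prefix ending at site `m` being the set of sites whose point
volume is at most that of `m`), of the `k` nearest neighbors of `x` within that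
prefix. -/
def proxySet {n d : ℕ} (s : Fin n → EuclideanSpace ℝ (Fin 2))
    (α : Fin n → Fin d → ℝ) (k : ℕ) (x : EuclideanSpace ℝ (Fin 2)) : Set (Fin n) :=
  ⋃ m : Fin n, nearK s {l | ∏ j, α l j ≤ ∏ j, α m j} k x

open Finset in
/-- The positions `i` of a permutation with fewer than `K` smaller entries to their left. -/
def lowRecords {n : ℕ} (K : ℕ) (σ : Equiv.Perm (Fin n)) : Finset (Fin n) :=
  univ.filter fun i => (univ.filter fun l => l < i ∧ σ l < σ i).card < K

/-- The permutation of `Fin (n + 1)` sending the last position to `p` whose remaining entries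
have the relative order prescribed by `e`. -/
def insertLast {n : ℕ} (p : Fin (n + 1)) (e : Equiv.Perm (Fin n)) : Equiv.Perm (Fin (n + 1)) :=
  (finSuccEquiv' (Fin.last n)).trans ((Equiv.optionCongr e).trans (finSuccEquiv' p).symm)

theorem insertLast_last {n : ℕ} (p : Fin (n + 1)) (e : Equiv.Perm (Fin n)) :
    insertLast p e (Fin.last n) = p := by
  simp [insertLast]

theorem insertLast_castSucc {n : ℕ} (p : Fin (n + 1)) (e : Equiv.Perm (Fin n)) (i : Fin n) :
    insertLast p e i.castSucc = p.succAbove (e i) := by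
  have : finSuccEquiv' (Fin.last n) i.castSucc = some i := by
    rw [← Fin.succAbove_last_apply, finSuccEquiv'_succAbove]
  simp [insertLast, this]

theorem insertLast_bijective (n : ℕ) :
    Function.Bijective
      (fun q : Fin (n + 1) × Equiv.Perm (Fin n) => insertLast q.1 q.2) := by
  rw [Fintype.bijective_iff_injective_and_card]
  refine ⟨?_, by simp [Fintype.card_perm, Nat.factorial_succ]⟩
  rintro ⟨p, e⟩ ⟨p', e'⟩ h
  have hp : p = p' := by
    simpa only [insertLast_last] using DFunLike.congr_fun h (Fin.last n)
  subst hp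
  have he : e = e' := by
    ext i
    have := DFunLike.congr_fun h i.castSucc
    simp only [insertLast_castSucc] at this
    rw [Fin.succAbove_right_injective this]
  rw [he]

theorem card_lowRecords_insertLast {n : ℕ} (K : ℕ) (p : Fin (n + 1)) (e : Equiv.Perm (Fin n)) :
    (lowRecords K (insertLast p e)).card
      = (lowRecords K e).card + if (p : ℕ) < K then 1 else 0 := by
  classical
  have hcast : ∀ i : Fin n,
      (Finset.univ.filter fun l =>
        l < i.castSucc ∧ insertLast p e l < insertLast p e i.castSucc).card
      = (Finset.univ.filter fun l => l < i ∧ e l < e i).card := by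
    intro i
    rw [Finset.card_filter, Finset.card_filter, Fin.sum_univ_castSucc]
    simp [insertLast_castSucc, insertLast_last, not_lt.2 (Fin.le_last _),
      (Fin.strictMono_succAbove p).lt_iff_lt]
  have hlast :
      (Finset.univ.filter fun l =>
        l < Fin.last n ∧ insertLast p e l < insertLast p e (Fin.last n)).card = p := by
    have : (Finset.univ.filter fun l =>
        l < Fin.last n ∧ insertLast p e l < insertLast p e (Fin.last n))
        = (Finset.Iio p).map (insertLast p e).symm.toEmbedding := by
      ext l
      simp only [Finset.mem_filter, Finset.mem_univ, true_and, Finset.mem_map_equiv,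
        Equiv.symm_symm, Finset.mem_Iio, insertLast_last]
      refine ⟨fun h => h.2, fun h => ⟨?_, h⟩⟩
      refine lt_of_le_of_ne (Fin.le_last _) ?_
      rintro rfl
      rw [insertLast_last] at h
      exact lt_irrefl _ h
    rw [this, Finset.card_map, Fin.card_Iio]
  unfold lowRecords
  rw [Finset.card_filter, Finset.card_filter, Fin.sum_univ_castSucc, hlast]
  simp only [hcast]

theorem sum_two_pow_card_lowRecords (K n : ℕ) :
    ∑ σ : Equiv.Perm (Fin n), 2 ^ (lowRecords K σ).card
      = ∏ r ∈ Finset.range n, (r + 1 + min K (r + 1)) := by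
  induction n with
  | zero => simp [lowRecords]
  | succ n ih =>
    rw [← (insertLast_bijective n).sum_comp, Fintype.sum_prod_type, Finset.prod_range_succ, ← ih]
    simp only [card_lowRecords_insertLast, pow_add]
    simp only [← Finset.sum_mul]
    rw [← Finset.mul_sum]
    congr 1
    have h : ∀ p : Fin (n + 1), 2 ^ (if (p : ℕ) < K then 1 else 0)
        = 1 + if (p : ℕ) < K then 1 else 0 := by
      intro p; split_ifs <;> rfl
    simp only [h, Finset.sum_add_distrib, ← Finset.card_filter]
    simp [Fin.card_filter_val_lt, min_comm]

theorem sum_two_pow_card_lowRecords_le (K n : ℕ) :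
    ∑ σ : Equiv.Perm (Fin n), (2 : ℝ) ^ (lowRecords K σ).card
      ≤ n.factorial * Real.exp (K * (1 + Real.log n)) := by
  have h := sum_two_pow_card_lowRecords K n
  have h' : ∑ σ : Equiv.Perm (Fin n), (2 : ℝ) ^ (lowRecords K σ).card
      = ∏ r ∈ Finset.range n, ((r : ℝ) + 1 + min (K : ℝ) (r + 1)) := by
    exact_mod_cast congrArg (Nat.cast : ℕ → ℝ) h
  rw [h']
  calc ∏ r ∈ Finset.range n, ((r : ℝ) + 1 + min (K : ℝ) (r + 1))
      ≤ ∏ r ∈ Finset.range n, (((r : ℝ) + 1) * Real.exp (K * ((r : ℝ) + 1)⁻¹)) := by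
        refine Finset.prod_le_prod (fun r _ => by positivity) fun r _ => ?_
        have hr : (0 : ℝ) < (r : ℝ) + 1 := by positivity
        calc (r : ℝ) + 1 + min (K : ℝ) (r + 1) ≤ (r : ℝ) + 1 + K := by gcongr; exact min_le_left _ _
          _ = ((r : ℝ) + 1) * (K * ((r : ℝ) + 1)⁻¹ + 1) := by field_simp; ring
          _ ≤ _ := by gcongr; exact Real.add_one_le_exp _
    _ = n.factorial * Real.exp (K * harmonic n) := by
        rw [Finset.prod_mul_distrib, ← Real.exp_sum, ← Finset.mul_sum,
          ← Finset.prod_range_add_one_eq_factorial]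
        push_cast [harmonic]
        rfl
    _ ≤ _ := by
        gcongr
        exact harmonic_le_one_add_log n

theorem exists_smul_add_smul_of_mul_neg {V ι : Type*} [AddCommGroup V] [Module ℝ V]
    (f : ι → V →ₗ[ℝ] ℝ) (g : V →ₗ[ℝ] ℝ) (W : Submodule ℝ V) {v w : V} (hv : v ∈ W) (hw : w ∈ W)
    (hvw : g v * g w < 0) (hf : ∀ i, SignType.sign (f i v) = SignType.sign (f i w)) :
    ∃ u ∈ W, g u = 0 ∧ ∀ i, SignType.sign (f i u) = SignType.sign (f i v) := by
  have hgv : 0 < |g v| := abs_pos.2 (left_ne_zero_of_mul hvw.ne)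
  have hgw : 0 < |g w| := abs_pos.2 (right_ne_zero_of_mul hvw.ne)
  refine ⟨|g w| • v + |g v| • w, W.add_mem (W.smul_mem _ hv) (W.smul_mem _ hw), ?_, fun i => ?_⟩
  · simp only [map_add, map_smul, smul_eq_mul]
    rcases mul_neg_iff.1 hvw with ⟨h1, h2⟩ | ⟨h1, h2⟩
    · rw [abs_of_pos h1, abs_of_neg h2]; ring
    · rw [abs_of_neg h1, abs_of_pos h2]; ring
  · simp only [map_add, map_smul, smul_eq_mul]
    have hi := hf i
    rcases lt_trichotomy (f i v) 0 with h | h | h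
    · rw [sign_neg h] at hi ⊢
      have h2 := sign_eq_neg_one_iff.1 hi.symm
      exact sign_neg (add_neg (mul_neg_of_pos_of_neg hgw h) (mul_neg_of_pos_of_neg hgv h2))
    · rw [h, sign_zero] at hi ⊢
      rw [sign_eq_zero_iff.1 hi.symm]
      simp
    · rw [sign_pos h] at hi ⊢
      have h2 := sign_eq_one_iff.1 hi.symm
      exact sign_pos (add_pos (mul_pos hgw h) (mul_pos hgv h2))

/-- The number of sign vectors realised by `m` linear functionals on a subspace of dimension at
most `D` is at most `(2 * m + 1) ^ D`. -/
theorem ncard_sign_image_le {V : Type*} [AddCommGroup V] [Module ℝ V] [FiniteDimensional ℝ V]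
    (m : ℕ) : ∀ (D : ℕ) (f : Fin m → V →ₗ[ℝ] ℝ) (W : Submodule ℝ V), Module.finrank ℝ W ≤ D →
    ((fun w i => SignType.sign (f i w)) '' (W : Set V)).ncard ≤ (2 * m + 1) ^ D := by
  induction m with
  | zero =>
    intro D f W _
    simpa using Set.ncard_le_one_of_subsingleton
      ((fun w i => SignType.sign (f i w)) '' (W : Set V))
  | succ m ih =>
    intro D f W hD
    let P : V → Fin m → SignType := fun w i => SignType.sign (f i.castSucc w)
    let g : V →ₗ[ℝ] ℝ := f (Fin.last m)
    have hsplit : ∀ w, (fun i => SignType.sign (f i w))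
        = Fin.snoc (α := fun _ => SignType) (P w) (SignType.sign (g w)) := by
      intro w
      ext i
      refine Fin.lastCases ?_ (fun j => ?_) i
      · simp [g]
      · simp [P]
    by_cases hg : ∀ w ∈ W, g w = 0
    · have hsub : (fun w i => SignType.sign (f i w)) '' (W : Set V)
          ⊆ (fun t => Fin.snoc (α := fun _ => SignType) t 0) '' (P '' (W : Set V)) := by
        rintro _ ⟨w, hw, rfl⟩
        refine ⟨P w, ⟨w, hw, rfl⟩, ?_⟩
        simp only [hsplit, hg w hw, sign_zero]
      calc _ ≤ _ := Set.ncard_le_ncard hsub (Set.toFinite _)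
        _ ≤ (P '' (W : Set V)).ncard := Set.ncard_image_le (Set.toFinite _)
        _ ≤ (2 * m + 1) ^ D := ih D (fun i => f i.castSucc) W hD
        _ ≤ _ := Nat.pow_le_pow_left (by omega) _
    · push Not at hg
      obtain ⟨w₀, hw₀, hgw₀⟩ := hg
      let W₀ : Submodule ℝ V := W ⊓ LinearMap.ker g
      have hlt : W₀ < W := by
        refine lt_of_le_of_ne inf_le_left fun h => hgw₀ ?_
        have : w₀ ∈ W₀ := h ▸ hw₀
        exact this.2
      have hrank : Module.finrank ℝ W₀ < D := (Submodule.finrank_lt_finrank_of_lt hlt).trans_le hD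
      obtain ⟨E, rfl⟩ : ∃ E, D = E + 1 := ⟨D - 1, by omega⟩
      let T₀ : Set (Fin m → SignType) := P '' (W₀ : Set V)
      classical
      let e : (Fin m → SignType) → SignType := fun t =>
        if t ∈ T₀ then 0 else if h : ∃ w ∈ W, P w = t then SignType.sign (g h.choose) else 0
      have hsub : (fun w i => SignType.sign (f i w)) '' (W : Set V)
          ⊆ (fun t => Fin.snoc (α := fun _ => SignType) t (e t)) '' (P '' (W : Set V))
            ∪ ((fun t => Fin.snoc (α := fun _ => SignType) t 1) '' T₀
            ∪ (fun t => Fin.snoc (α := fun _ => SignType) t (-1)) '' T₀) := by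
        rintro _ ⟨w, hw, rfl⟩
        simp only [hsplit]
        by_cases ht : P w ∈ T₀
        · rcases lt_trichotomy (g w) 0 with h | h | h
          · exact Or.inr (Or.inr ⟨P w, ht, by simp only [sign_neg h]⟩)
          · exact Or.inl ⟨P w, ⟨w, hw, rfl⟩, by simp only [e, if_pos ht, h, sign_zero]⟩
          · exact Or.inr (Or.inl ⟨P w, ht, by simp only [sign_pos h]⟩)
        · refine Or.inl ⟨P w, ⟨w, hw, rfl⟩, ?_⟩
          have hex : ∃ v ∈ W, P v = P w := ⟨w, hw, rfl⟩
          have he : e (P w) = SignType.sign (g hex.choose) := by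
            simp only [e, if_neg ht, dif_pos hex]
          have hne : ∀ v ∈ W, P v = P w → g v ≠ 0 := fun v hv hvw h0 => ht ⟨v, ⟨hv, h0⟩, hvw⟩
          obtain ⟨hv, hvw⟩ := hex.choose_spec
          have h1 := hne _ hv hvw
          have h2 := hne w hw rfl
          have hmul : ¬ g hex.choose * g w < 0 := by
            intro hneg
            obtain ⟨u, hu, hgu, hfu⟩ := exists_smul_add_smul_of_mul_neg
              (fun i : Fin m => f i.castSucc) g W hv hw hneg (congrFun hvw)
            exact hne u hu ((funext hfu).trans hvw) hgu
          simp only [he]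
          congr 1
          rcases lt_or_gt_of_ne h1 with a | a <;> rcases lt_or_gt_of_ne h2 with b | b
          · rw [sign_neg a, sign_neg b]
          · exact absurd (mul_neg_of_neg_of_pos a b) hmul
          · exact absurd (mul_neg_of_pos_of_neg a b) hmul
          · rw [sign_pos a, sign_pos b]
      have hW := ih (E + 1) (fun i => f i.castSucc) W hD
      have hW₀ := ih E (fun i => f i.castSucc) W₀ (by omega)
      calc _ ≤ _ := Set.ncard_le_ncard hsub (Set.toFinite _)
        _ ≤ _ := Set.ncard_union_le _ _
        _ ≤ _ := Nat.add_le_add_left (Set.ncard_union_le _ _) _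
        _ ≤ (2 * m + 1) ^ (E + 1) + ((2 * m + 1) ^ E + (2 * m + 1) ^ E) :=
            Nat.add_le_add ((Set.ncard_image_le (Set.toFinite _)).trans hW)
              (Nat.add_le_add ((Set.ncard_image_le (Set.toFinite _)).trans hW₀)
                ((Set.ncard_image_le (Set.toFinite _)).trans hW₀))
        _ = (2 * m + 1) ^ E * (2 * (m + 1) + 1) := by ring
        _ ≤ (2 * (m + 1) + 1) ^ E * (2 * (m + 1) + 1) :=
            Nat.mul_le_mul_right _ (Nat.pow_le_pow_left (by omega) _)
        _ = _ := (pow_succ _ _).symm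

theorem lintegral_pi_le_of_sum_perm_le {Ω : Type*} [MeasurableSpace Ω] (P : Measure Ω)
    [IsProbabilityMeasure P] (n : ℕ) (F : (Fin n → Ω) → ENNReal) (hF : Measurable F) (C : ENNReal)
    (h : ∀ α, ∑ σ : Equiv.Perm (Fin n), F (α ∘ σ) ≤ n.factorial * C) :
    ∫⁻ α, F α ∂(Measure.pi fun _ : Fin n => P) ≤ C := by
  have hσ : ∀ σ : Equiv.Perm (Fin n),
      MeasurePreserving (fun α : Fin n → Ω => α ∘ σ) (Measure.pi fun _ => P)
        (Measure.pi fun _ => P) := by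
    intro σ
    convert measurePreserving_piCongrLeft (α := fun _ : Fin n => Ω) (fun _ => P) σ.symm using 1
    ext α i
    have := Equiv.piCongrLeft_apply_apply (fun _ : Fin n => Ω) σ.symm α (σ i)
    simpa [MeasurableEquiv.coe_piCongrLeft] using this.symm
  have h0 : (n.factorial : ENNReal) ≠ 0 := by exact_mod_cast n.factorial_ne_zero
  have hsum : (n.factorial : ENNReal) * ∫⁻ α, F α ∂(Measure.pi fun _ : Fin n => P)
      ≤ n.factorial * C := by
    calc (n.factorial : ENNReal) * ∫⁻ α, F α ∂(Measure.pi fun _ : Fin n => P)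
        = ∑ σ : Equiv.Perm (Fin n), ∫⁻ α, F (α ∘ σ) ∂(Measure.pi fun _ : Fin n => P) := by
          simp only [fun σ => (hσ σ).lintegral_comp hF]
          simp [Fintype.card_perm]
      _ = ∫⁻ α, ∑ σ : Equiv.Perm (Fin n), F (α ∘ σ) ∂(Measure.pi fun _ : Fin n => P) :=
          (lintegral_finsetSum _ fun σ _ => hF.comp (hσ σ).measurable).symm
      _ ≤ ∫⁻ _, n.factorial * C ∂(Measure.pi fun _ : Fin n => P) := lintegral_mono h
      _ = n.factorial * C := by simp
  exact (ENNReal.mul_le_mul_iff_right h0 (ENNReal.natCast_ne_top _)).1 hsum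

/-- The indices `i` such that fewer than `k` indices `l` with `v l ≤ v i` satisfy `R l i`. -/
def shallow {n : ℕ} (R : Fin n → Fin n → Prop) (k : ℕ) (v : Fin n → ℝ) : Set (Fin n) :=
  {i | {l | v l ≤ v i ∧ R l i}.ncard < k}

theorem proxySet_subset_shallow {n d : ℕ} (s : Fin n → EuclideanSpace ℝ (Fin 2))
    (α : Fin n → Fin d → ℝ) (k : ℕ) (x : EuclideanSpace ℝ (Fin 2)) :
    proxySet s α k x ⊆
      shallow (fun l i => dist x (s l) < dist x (s i)) k (fun l => ∏ j, α l j) := by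
  intro i hi
  obtain ⟨m, hm, hcard⟩ := Set.mem_iUnion.1 hi
  refine lt_of_le_of_lt (Set.ncard_le_ncard ?_ (Set.toFinite _)) hcard
  exact fun l hl => ⟨hl.1.trans hm, hl.2⟩

theorem ncard_shallow_le {n k t : ℕ} (u v : Fin n → ℝ)
    (hu : ∀ i, {l | l ≠ i ∧ u l = u i}.ncard ≤ t) (σ : Equiv.Perm (Fin n)) :
    (shallow (fun l i => u l < u i) k (v ∘ σ)).ncard
      ≤ (lowRecords (k + t) ((Tuple.sort v)⁻¹ * σ * Tuple.sort u)).card := by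
  set π := Tuple.sort u
  set τ := Tuple.sort v
  have hπ : Monotone (u ∘ π) := Tuple.monotone_sort u
  have hτ : Monotone (v ∘ τ) := Tuple.monotone_sort v
  have hsub : shallow (fun l i => u l < u i) k (v ∘ σ)
      ⊆ π '' (lowRecords (k + t) (τ⁻¹ * σ * π) : Set (Fin n)) := by
    intro i hi
    refine ⟨π.symm i, ?_, by simp⟩
    obtain ⟨a, rfl⟩ := π.surjective i
    simp only [Equiv.symm_apply_apply, lowRecords, Finset.coe_filter, Finset.mem_univ, true_and,
      Set.mem_ofPred_eq]
    have hle : (π '' {b | b < a ∧ (τ⁻¹ * σ * π) b < (τ⁻¹ * σ * π) a})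
        ⊆ {l | (v ∘ σ) l ≤ (v ∘ σ) (π a) ∧ u l < u (π a)} ∪ {l | l ≠ π a ∧ u l = u (π a)} := by
      rintro _ ⟨b, ⟨hb, hρ⟩, rfl⟩
      have h1 : u (π b) ≤ u (π a) := hπ hb.le
      have h2 : (v ∘ σ) (π b) ≤ (v ∘ σ) (π a) := by
        simpa using hτ hρ.le
      rcases h1.lt_or_eq with h | h
      · exact Or.inl ⟨h2, h⟩
      · exact Or.inr ⟨π.injective.ne hb.ne, h⟩
    have hcard := (Set.ncard_le_ncard hle (Set.toFinite _)).trans (Set.ncard_union_le _ _)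
    rw [Set.ncard_image_of_injective _ π.injective] at hcard
    have hcoe : (Finset.univ.filter fun l => l < a ∧ (τ⁻¹ * σ * π) l < (τ⁻¹ * σ * π) a).card
        = {b | b < a ∧ (τ⁻¹ * σ * π) b < (τ⁻¹ * σ * π) a}.ncard := by
      rw [← Set.ncard_coe_finset, Finset.coe_filter_univ]
    rw [hcoe]
    have hi' : {l | (v ∘ σ) l ≤ (v ∘ σ) (π a) ∧ u l < u (π a)}.ncard < k := hi
    have := hu (π a)
    omega
  refine (Set.ncard_le_ncard hsub (Set.toFinite _)).trans
    ((Set.ncard_image_le (Set.toFinite _)).trans ?_)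
  rw [Set.ncard_coe_finset]

theorem sum_two_pow_ncard_shallow_le {n k t : ℕ} (u v : Fin n → ℝ)
    (hu : ∀ i, {l | l ≠ i ∧ u l = u i}.ncard ≤ t) :
    ∑ σ : Equiv.Perm (Fin n), (2 : ℝ) ^ (shallow (fun l i => u l < u i) k (v ∘ σ)).ncard
      ≤ n.factorial * Real.exp ((k + t : ℕ) * (1 + Real.log n)) := by
  have hreindex := (Equiv.sum_comp
    ((Equiv.mulLeft (Tuple.sort v)⁻¹).trans (Equiv.mulRight (Tuple.sort u)))
    fun σ => (2 : ℝ) ^ (lowRecords (k + t) σ).card).le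
  refine (Finset.sum_le_sum fun σ _ => ?_).trans
    (hreindex.trans (sum_two_pow_card_lowRecords_le (k + t) n))
  exact pow_le_pow_right₀ one_le_two (ncard_shallow_le u v hu σ)

theorem measurable_shallow {Ω E : Type*} [MeasurableSpace Ω] [MeasurableSpace E] {n : ℕ}
    (R : Fin n → Fin n → Prop) (k : ℕ) {V : Ω → Fin n → ℝ} (hV : Measurable V)
    (g : Set (Fin n) → E) : Measurable fun ω => g (shallow R k (V ω)) := by
  have h1 : Measurable fun ω => (fun i l => V ω l ≤ V ω i : Fin n → Fin n → Prop) := by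
    refine measurable_pi_lambda _ fun i => measurable_pi_lambda _ fun l => ?_
    exact measurableSet_setOfPred.1
      (measurableSet_le ((measurable_pi_apply l).comp hV) ((measurable_pi_apply i).comp hV))
  exact (measurable_of_countable
    fun q : Fin n → Fin n → Prop => g {i | {l | q i l ∧ R l i}.ncard < k}).comp h1

theorem measure_lt_ncard_shallow_le {d n k t : ℕ} (u : Fin n → ℝ)
    (hu : ∀ i, {l | l ≠ i ∧ u l = u i}.ncard ≤ t) (P : Measure (Fin d → ℝ))
    [IsProbabilityMeasure P] (L : ℝ) :
    (Measure.pi fun _ : Fin n => P)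
        {α | L < (shallow (fun l i => u l < u i) k (fun l => ∏ j, α l j)).ncard}
      ≤ ENNReal.ofReal
          (Real.exp ((k + t : ℕ) * (1 + Real.log n) - L * Real.log 2)) := by
  let F : (Fin n → Fin d → ℝ) → ENNReal := fun α =>
    ENNReal.ofReal (2 ^ (shallow (fun l i => u l < u i) k (fun l => ∏ j, α l j)).ncard)
  have hF : Measurable F := by
    refine measurable_shallow (V := fun α : Fin n → Fin d → ℝ => fun l => ∏ j, α l j) _ k ?_
      (fun A => ENNReal.ofReal (2 ^ A.ncard))
    fun_prop
  have hint := lintegral_pi_le_of_sum_perm_le P n F hF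
    (ENNReal.ofReal (Real.exp ((k + t : ℕ) * (1 + Real.log n)))) fun α => by
      have := sum_two_pow_ncard_shallow_le (k := k) u (fun l => ∏ j, α l j) hu
      calc ∑ σ : Equiv.Perm (Fin n), F (α ∘ σ)
          = ENNReal.ofReal (∑ σ : Equiv.Perm (Fin n),
              (2 : ℝ) ^ (shallow (fun l i => u l < u i) k ((fun l => ∏ j, α l j) ∘ σ)).ncard) := by
            rw [ENNReal.ofReal_sum_of_nonneg fun _ _ => by positivity]
            rfl
        _ ≤ _ := ENNReal.ofReal_le_ofReal this
        _ = _ := by rw [ENNReal.ofReal_mul (by positivity), ENNReal.ofReal_natCast]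
  have hε : 0 < Real.exp (L * Real.log 2) := Real.exp_pos _
  have hmarkov := (meas_ge_le_lintegral_div hF.aemeasurable
    (ENNReal.ofReal_pos.2 hε).ne' ENNReal.ofReal_ne_top).trans (ENNReal.div_le_div_right hint _)
  rw [← ENNReal.ofReal_div_of_pos hε, ← Real.exp_sub] at hmarkov
  refine (measure_mono fun α hα => ?_).trans hmarkov
  refine ENNReal.ofReal_le_ofReal ?_
  have hα' : L < (shallow (fun l i => u l < u i) k (fun l => ∏ j, α l j)).ncard := hα
  rw [← Real.rpow_natCast, Real.rpow_def_of_pos two_pos, mul_comm]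
  have := Real.log_pos one_lt_two
  gcongr

theorem dist_lt_dist_iff_inner {E : Type*} [NormedAddCommGroup E] [InnerProductSpace ℝ E]
    (x a b : E) :
    dist x a < dist x b ↔ 0 < inner ℝ ((2 : ℝ) • (a - b)) x + (‖b‖ ^ 2 - ‖a‖ ^ 2) := by
  rw [dist_eq_norm, dist_eq_norm, ← sq_lt_sq₀ (norm_nonneg _) (norm_nonneg _),
    norm_sub_sq_real, norm_sub_sq_real, real_inner_smul_left, inner_sub_left,
    real_inner_comm x a, real_inner_comm x b]
  constructor <;> intro h <;> linarith

/-- Sites in the plane induce only polynomially many orderings by distance to a point. -/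
theorem ncard_range_closer_le {n : ℕ} (s : Fin n → EuclideanSpace ℝ (Fin 2)) :
    (Set.range fun (x : EuclideanSpace ℝ (Fin 2)) (l i : Fin n) =>
      dist x (s l) < dist x (s i)).ncard ≤ (2 * (n * n) + 1) ^ 3 := by
  let f : Fin (n * n) → EuclideanSpace ℝ (Fin 2) × ℝ →ₗ[ℝ] ℝ := fun p =>
    let l := (finProdFinEquiv.symm p).1
    let i := (finProdFinEquiv.symm p).2
    (innerₛₗ ℝ ((2 : ℝ) • (s l - s i))).coprod
      ((‖s i‖ ^ 2 - ‖s l‖ ^ 2) • (LinearMap.id : ℝ →ₗ[ℝ] ℝ))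
  have hrank : Module.finrank ℝ (⊤ : Submodule ℝ (EuclideanSpace ℝ (Fin 2) × ℝ)) ≤ 3 := by
    simp
  refine le_trans ?_ (ncard_sign_image_le (n * n) 3 f ⊤ hrank)
  let D : (Fin (n * n) → SignType) → Fin n → Fin n → Prop :=
    fun t l i => t (finProdFinEquiv (l, i)) = 1
  refine le_trans (Set.ncard_le_ncard (t := D '' ((fun w i => SignType.sign (f i w)) ''
    ((⊤ : Submodule ℝ (EuclideanSpace ℝ (Fin 2) × ℝ)) : Set _))) ?_ (Set.toFinite _))
    (Set.ncard_image_le (Set.toFinite _))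
  rintro _ ⟨x, rfl⟩
  refine ⟨_, ⟨(x, 1), trivial, rfl⟩, ?_⟩
  ext l i
  simp only [D, sign_eq_one_iff, f, Equiv.symm_apply_apply, dist_lt_dist_iff_inner]
  simp [real_inner_smul_left, inner_sub_left]

theorem ncard_dist_ties_le {n : ℕ} (s : Fin n → EuclideanSpace ℝ (Fin 2))
    (hs : ∀ i₁ i₂ i₃ i₄ : Fin n,
      i₁ ≠ i₂ → i₁ ≠ i₃ → i₁ ≠ i₄ → i₂ ≠ i₃ → i₂ ≠ i₄ → i₃ ≠ i₄ →
        ¬∃ (z : EuclideanSpace ℝ (Fin 2)) (r : ℝ),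
            dist z (s i₁) = r ∧ dist z (s i₂) = r ∧ dist z (s i₃) = r ∧ dist z (s i₄) = r)
    (x : EuclideanSpace ℝ (Fin 2)) (i : Fin n) :
    {l | l ≠ i ∧ dist x (s l) = dist x (s i)}.ncard ≤ 2 := by
  by_contra! h
  obtain ⟨a, b, c, ha, hb, hc, hab, hac, hbc⟩ := (Set.two_lt_ncard_iff (Set.toFinite _)).1 h
  exact hs a b c i hab hac ha.1 hbc hb.1 hc.1 ⟨x, dist x (s i), ha.2, hb.2, hc.2, rfl⟩

/-- For every `γ > 0` there is a constant `c = c(γ, d)` such that for all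
`n ≥ 2`, `k ≥ 1`, distinct sites in general position (no four on a common
circle), and parametric points sampled coordinatewise-independently from
atomless distributions on `[0,1]`: with probability at least `1 - n^{-γ}`,
simultaneously for every `x ∈ ℝ²`, `|Proxy_k(x, S)| ≤ c·k·ln n`. -/
theorem proxy_set_size_whp (d : ℕ) (hd : 1 ≤ d) (γ : ℝ) (hγ : 0 < γ) :
    ∃ c : ℝ, 0 < c ∧
      ∀ n : ℕ, 2 ≤ n → ∀ k : ℕ, 1 ≤ k →
      ∀ s : Fin n → EuclideanSpace ℝ (Fin 2), Function.Injective s →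
      (∀ i₁ i₂ i₃ i₄ : Fin n, i₁ ≠ i₂ → i₁ ≠ i₃ → i₁ ≠ i₄ → i₂ ≠ i₃ → i₂ ≠ i₄ → i₃ ≠ i₄ →
        ¬∃ (z : EuclideanSpace ℝ (Fin 2)) (r : ℝ),
            dist z (s i₁) = r ∧ dist z (s i₂) = r ∧ dist z (s i₃) = r ∧ dist z (s i₄) = r) →
      ∀ μ : Fin d → Measure ℝ,
        (∀ j, IsProbabilityMeasure (μ j)) →
        (∀ j, ∀ a : ℝ, μ j {a} = 0) →
        (∀ j, μ j (Set.Icc (0 : ℝ) 1) = 1) →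
        ENNReal.ofReal (1 - (n : ℝ) ^ (-γ)) ≤
          Measure.pi (fun _ : Fin n => Measure.pi μ)
            {α : Fin n → Fin d → ℝ |
              ∀ x : EuclideanSpace ℝ (Fin 2),
                ((proxySet s α k x).ncard : ℝ) ≤ c * k * Real.log n} := by
  have hlog2 := Real.log_pos one_lt_two
  refine ⟨(20 + γ) / Real.log 2, by positivity, ?_⟩
  intro n hn k hk s _ hs μ hμ _ _
  set P := Measure.pi fun _ : Fin n => Measure.pi μ
  set L : ℝ := (20 + γ) / Real.log 2 * k * Real.log n
  have hn0 : (0 : ℝ) < n := by positivity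
  have hk1 : (1 : ℝ) ≤ k := by exact_mod_cast hk
  have hlogn : 1 ≤ 2 * Real.log n := by
    have : Real.log 2 ≤ Real.log n := Real.log_le_log two_pos (by exact_mod_cast hn)
    linarith [Real.log_two_gt_d9]
  let closer : EuclideanSpace ℝ (Fin 2) → Fin n → Fin n → Prop :=
    fun x l i => dist x (s l) < dist x (s i)
  let bad : (Fin n → Fin n → Prop) → Set (Fin n → Fin d → ℝ) :=
    fun R => {α | L < (shallow R k (fun l => ∏ j, α l j)).ncard}
  have hbad : ∀ R ∈ Set.range closer, P (bad R) ≤ ENNReal.ofReal ((n : ℝ) ^ (-(11 + γ))) := by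
    rintro _ ⟨x, rfl⟩
    refine (measure_lt_ncard_shallow_le (k := k) (fun l => dist x (s l))
      (ncard_dist_ties_le s hs x) (Measure.pi μ) L).trans (ENNReal.ofReal_le_ofReal ?_)
    rw [Real.rpow_def_of_pos hn0, Real.exp_le_exp]
    have hL : L * Real.log 2 = (20 + γ) * k * Real.log n := by
      simp only [L]; field_simp
    have h1 : ((k + 2 : ℕ) : ℝ) * (1 + Real.log n) ≤ 3 * k * (3 * Real.log n) := by
      push_cast
      gcongr <;> linarith
    have h2 : (11 + γ) * Real.log n * 1 ≤ (11 + γ) * Real.log n * k :=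
      mul_le_mul_of_nonneg_left hk1 (mul_nonneg (by linarith) (by linarith))
    rw [hL]
    linarith
  have hfin : (Set.range closer).Finite := Set.toFinite _
  have hcount : ((Set.range closer).ncard : ℝ) ≤ (n : ℝ) ^ (11 : ℝ) := by
    have h1 : (Set.range closer).ncard ≤ n ^ 11 := by
      calc _ ≤ (2 * (n * n) + 1) ^ 3 := ncard_range_closer_le s
        _ ≤ (3 * (n * n)) ^ 3 := Nat.pow_le_pow_left (by nlinarith) 3
        _ = 27 * n ^ 6 := by ring
        _ ≤ n ^ 5 * n ^ 6 :=
            Nat.mul_le_mul_right _ (le_trans (by norm_num) (Nat.pow_le_pow_left hn 5))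
        _ = n ^ 11 := by ring
    calc ((Set.range closer).ncard : ℝ) ≤ (n : ℝ) ^ 11 := by exact_mod_cast h1
      _ = (n : ℝ) ^ (11 : ℝ) := by rw [← Real.rpow_natCast]; norm_num
  set G : Set (Fin n → Fin d → ℝ) :=
    {α | ∀ x : EuclideanSpace ℝ (Fin 2), ((proxySet s α k x).ncard : ℝ) ≤ L}
  have hsub : Gᶜ ⊆ ⋃ R ∈ hfin.toFinset, bad R := by
    intro α hα
    simp only [G, Set.mem_compl_iff, Set.mem_ofPred_eq, not_forall, not_le] at hα
    obtain ⟨x, hx⟩ := hα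
    refine Set.mem_biUnion (x := closer x) (by simp) (hx.trans_le ?_)
    exact_mod_cast Set.ncard_le_ncard (proxySet_subset_shallow s α k x) (Set.toFinite _)
  have hGc : P Gᶜ ≤ ENNReal.ofReal ((n : ℝ) ^ (-γ)) := by
    calc P Gᶜ ≤ P (⋃ R ∈ hfin.toFinset, bad R) := measure_mono hsub
      _ ≤ ∑ R ∈ hfin.toFinset, P (bad R) := measure_biUnion_finset_le _ _
      _ ≤ hfin.toFinset.card • ENNReal.ofReal ((n : ℝ) ^ (-(11 + γ))) :=
          Finset.sum_le_card_nsmul _ _ _ fun R hR => hbad R (hfin.mem_toFinset.1 hR)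
      _ = ENNReal.ofReal ((Set.range closer).ncard * (n : ℝ) ^ (-(11 + γ))) := by
          rw [nsmul_eq_mul, ENNReal.ofReal_mul (by positivity), ENNReal.ofReal_natCast,
            Set.ncard_eq_toFinset_card _ hfin]
      _ ≤ ENNReal.ofReal ((n : ℝ) ^ (11 : ℝ) * (n : ℝ) ^ (-(11 + γ))) := by gcongr
      _ = ENNReal.ofReal ((n : ℝ) ^ (-γ)) := by
          rw [← Real.rpow_add hn0]; congr 2; ring
  rw [ENNReal.ofReal_sub _ (by positivity), ENNReal.ofReal_one, tsub_le_iff_right]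
  calc (1 : ENNReal) = P Set.univ := measure_univ.symm
    _ ≤ P G + P Gᶜ := by rw [← Set.union_compl_self G]; exact measure_union_le _ _
    _ ≤ _ := by gcongr
end

section
/- Let L be a finite set of affine functions from ℝ to ℝ (nonvertical lines in the plane) in general position, meaning the functions have pairwise distinct slopes and no three of their graphs pass through a common point. Let f ∈ L and let k ≥ 0 be an integer. Then the set {t ∈ ℝ : the number of g ∈ L with g ≠ f and g(t) < f(t) equals k} has at most k + 2 connected components. Equivalently, at most k + 2 edges of the k-level of the arrangement of L lie on the line that is the graph of f. -/
/-- The level set of the sum of a monotone and an antitone `ℕ`-valued function on `ℝ` has at most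
`k + 1` connected components: the antitone summand takes values in `{0, …, k}` on it and separates
the components. -/
theorem finite_and_ncard_components_levelSet_add_le {u d : ℝ → ℕ} (hu : Monotone u)
    (hd : Antitone d) {k : ℕ} {S : Set ℝ} (hS : ∀ t, t ∈ S ↔ u t + d t = k) :
    {C : Set ℝ | ∃ t ∈ S, C = connectedComponentIn S t}.Finite ∧
    {C : Set ℝ | ∃ t ∈ S, C = connectedComponentIn S t}.ncard ≤ k + 1 := by
  have eq_of_le : ∀ s ∈ S, ∀ t ∈ S, s ≤ t → d s = d t →
      connectedComponentIn S s = connectedComponentIn S t := by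
    intro s hs t ht hst hdst
    have hsub : Set.Icc s t ⊆ S := by
      intro x hx
      have h₁ := hu hx.1
      have h₂ := hu hx.2
      have h₃ := hd hx.1
      have h₄ := hd hx.2
      rw [hS] at *
      omega
    exact connectedComponentIn_eq
      (isPreconnected_Icc.subset_connectedComponentIn (Set.left_mem_Icc.2 hst) hsub
        (Set.right_mem_Icc.2 hst))
  have eq_of_eq : ∀ s ∈ S, ∀ t ∈ S, d s = d t →
      connectedComponentIn S s = connectedComponentIn S t := by
    intro s hs t ht h
    rcases le_total s t with hst | hts
    · exact eq_of_le s hs t ht hst h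
    · exact (eq_of_le t ht s hs hts h.symm).symm
  have hrep : ∀ C ∈ {C : Set ℝ | ∃ t ∈ S, C = connectedComponentIn S t},
      ∃ t ∈ S, C = connectedComponentIn S t := fun _ h => h
  choose! r hrS hr using hrep
  have hmaps : Set.MapsTo (fun C => d (r C))
      {C : Set ℝ | ∃ t ∈ S, C = connectedComponentIn S t} (Set.Iic k) := by
    intro C hC
    have := (hS _).1 (hrS C hC)
    simp only [Set.mem_Iic]
    omega
  have hinj : Set.InjOn (fun C => d (r C))
      {C : Set ℝ | ∃ t ∈ S, C = connectedComponentIn S t} := by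
    intro C hC C' hC' h
    rw [hr C hC, hr C' hC']
    exact eq_of_eq _ (hrS C hC) _ (hrS C' hC') h
  refine ⟨Set.Finite.of_injOn hmaps hinj (Set.finite_Iic k), ?_⟩
  calc _ ≤ (Set.Iic k).ncard := Set.ncard_le_ncard_of_injOn _ hmaps hinj (Set.finite_Iic k)
    _ = k + 1 := by simp [Set.ncard_eq_toFinset_card']


/-- The portion of the line `f` (an affine function `t ↦ f.1·t + f.2`) lying on
the `k`-level of the arrangement of `L`: the set of parameters `t` at which
exactly `k` lines of `L` other than `f` pass strictly below `(t, f(t))`. -/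
def levelPartOnLine (L : Finset (ℝ × ℝ)) (f : ℝ × ℝ) (k : ℕ) : Set ℝ :=
  {t | ({g : ℝ × ℝ | g ∈ L ∧ g ≠ f ∧ g.1 * t + g.2 < f.1 * t + f.2}).ncard = k}

/-- Let `L` be a finite set of nonvertical lines in general position (pairwise
distinct slopes, no three concurrent), `f ∈ L`, and `k ≥ 0`.  Then the set of
`t ∈ ℝ` where exactly `k` lines of `L` pass strictly below `(t, f(t))` has at
most `k + 2` connected components: at most `k + 2` edges of the `k`-level of the
arrangement of `L` lie on the line `f`. -/
theorem edges_of_level_on_line_le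
    (L : Finset (ℝ × ℝ)) (f : ℝ × ℝ) (hf : f ∈ L) (k : ℕ)
    (hslopes : ∀ g₁ ∈ L, ∀ g₂ ∈ L, g₁ ≠ g₂ → g₁.1 ≠ g₂.1)
    (hconc : ∀ g₁ ∈ L, ∀ g₂ ∈ L, ∀ g₃ ∈ L, g₁ ≠ g₂ → g₁ ≠ g₃ → g₂ ≠ g₃ →
      ¬∃ t : ℝ, g₁.1 * t + g₁.2 = g₂.1 * t + g₂.2 ∧ g₁.1 * t + g₁.2 = g₃.1 * t + g₃.2) :
    ({C : Set ℝ | ∃ t ∈ levelPartOnLine L f k,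
        C = connectedComponentIn (levelPartOnLine L f k) t}).Finite ∧
    ({C : Set ℝ | ∃ t ∈ levelPartOnLine L f k,
        C = connectedComponentIn (levelPartOnLine L f k) t}).ncard ≤ k + 2 := by
  classical
  let u : ℝ → ℕ := fun t =>
    (L.filter fun g => (g ≠ f ∧ g.1 * t + g.2 < f.1 * t + f.2) ∧ g.1 ≤ f.1).card
  let d : ℝ → ℕ := fun t =>
    (L.filter fun g => (g ≠ f ∧ g.1 * t + g.2 < f.1 * t + f.2) ∧ ¬ g.1 ≤ f.1).card
  have hu : Monotone u := by
    intro s t hst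
    refine Finset.card_le_card (Finset.monotone_filter_right L ?_)
    rintro g - ⟨⟨hgf, hlt⟩, hslope⟩
    exact ⟨⟨hgf, by nlinarith⟩, hslope⟩
  have hd : Antitone d := by
    intro s t hst
    refine Finset.card_le_card (Finset.monotone_filter_right L ?_)
    rintro g - ⟨⟨hgf, hlt⟩, hslope⟩
    exact ⟨⟨hgf, by nlinarith⟩, hslope⟩
  have hS : ∀ t, t ∈ levelPartOnLine L f k ↔ u t + d t = k := by
    intro t
    have hcard : {g : ℝ × ℝ | g ∈ L ∧ g ≠ f ∧ g.1 * t + g.2 < f.1 * t + f.2}.ncard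
        = u t + d t := by
      rw [← Finset.coe_filter, Set.ncard_coe_finset,
        ← Finset.card_filter_add_card_filter_not (fun g : ℝ × ℝ => g.1 ≤ f.1),
        Finset.filter_filter, Finset.filter_filter]
    rw [← hcard]
    rfl
  obtain ⟨hfin, hle⟩ := finite_and_ncard_components_levelSet_add_le hu hd hS
  exact ⟨hfin, hle.trans (Nat.le_succ _)⟩
end

section
/- There is an absolute constant c with the following property. Let H be a set of n affine functions from ℝ² to ℝ (nonvertical planes in ℝ³) in general position: the graphs of any two distinct functions of H intersect in a line, any three in exactly one point, and no four have a common point. Let 1 ≤ r ≤ n and let k ≥ 1 be an integer, and let R be a uniformly random subset of H of size r. For a subset R ⊆ H, a vertex of the arrangement of R is a point v = (p, z) ∈ ℝ² × ℝ such that z = h(p) for exactly three functions h ∈ R; its level is the number of h ∈ R with h(p) < z; V_{≤k}(R) denotes the set of vertices of the arrangement of R of level at most k; and for such a vertex v = (p, z), its below conflict list size is b(v) = the number of h ∈ H \ R with h(p) < z. Then the expectation over R of Σ_{v ∈ V_{≤k}(R)} b(v) is at most c·n·k³. -/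
open Finset

/-- Evaluation of the nonvertical plane with coefficients `h = (a, b, c)` at the
point `p ∈ ℝ²`:  `a·p₁ + b·p₂ + c`. -/
def evalPlane (h : ℝ × ℝ × ℝ) (p : ℝ × ℝ) : ℝ := h.1 * p.1 + h.2.1 * p.2 + h.2.2

/-- `v = (p, z)` is a vertex of the arrangement of `R`: `z = h(p)` for exactly
three planes `h ∈ R`. -/
def IsVertex (R : Finset (ℝ × ℝ × ℝ)) (v : (ℝ × ℝ) × ℝ) : Prop :=
  ({h : ℝ × ℝ × ℝ | h ∈ R ∧ evalPlane h v.1 = v.2}).ncard = 3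

/-- The level of the point `v = (p, z)` in the arrangement of `R`: the number of
planes of `R` strictly below `v`. -/
noncomputable def levelOf (R : Finset (ℝ × ℝ × ℝ)) (v : (ℝ × ℝ) × ℝ) : ℕ :=
  ({h : ℝ × ℝ × ℝ | h ∈ R ∧ evalPlane h v.1 < v.2}).ncard

/-- The size of the below conflict list of `v = (p, z)`: the number of planes of
`H \ R` strictly below `v`. -/
noncomputable def bcl (H R : Finset (ℝ × ℝ × ℝ)) (v : (ℝ × ℝ) × ℝ) : ℕ :=
  ({h : ℝ × ℝ × ℝ | h ∈ H ∧ h ∉ R ∧ evalPlane h v.1 < v.2}).ncard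

section Sampling

variable {α β : Type*} [DecidableEq α]

/-- The probability that a Bernoulli sample of `H` contains `D` and avoids `B`. -/
lemma sum_bernoulli_weight (H D B : Finset α) (p q : ℝ) (hpq : p + q = 1)
    (hD : D ⊆ H) (hB : B ⊆ H) (hDB : Disjoint D B) :
    ∑ R ∈ H.powerset with D ⊆ R ∧ Disjoint B R, p ^ #R * q ^ #(H \ R) = p ^ #D * q ^ #B := by
  have key : ∏ i ∈ H, ((if i ∈ B then 0 else p) + (if i ∈ D then 0 else q)) =
      p ^ #D * q ^ #B := by
    have h1 : ∀ i ∈ H, ((if i ∈ B then 0 else p) + (if i ∈ D then 0 else q)) =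
        (if i ∈ D then p else 1) * (if i ∈ B then q else 1) := by
      intro i _
      by_cases h : i ∈ D
      · simp [h, Finset.disjoint_left.1 hDB h]
      · by_cases h' : i ∈ B <;> simp [h, h', hpq]
    rw [Finset.prod_congr rfl h1, Finset.prod_mul_distrib, Finset.prod_ite_mem,
      Finset.prod_ite_mem, Finset.inter_eq_right.2 hD, Finset.inter_eq_right.2 hB]
    simp
  rw [← key, Finset.prod_add, Finset.sum_filter]
  refine Finset.sum_congr rfl fun R hR => ?_
  rw [Finset.mem_powerset] at hR
  split_ifs with h
  · have h1 : ∀ i ∈ R, (if i ∈ B then 0 else p) = p := fun i hi =>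
      if_neg fun hi' => Finset.disjoint_left.1 h.2 hi' hi
    have h2 : ∀ i ∈ H \ R, (if i ∈ D then 0 else q) = q := fun i hi =>
      if_neg fun hi' => (Finset.mem_sdiff.1 hi).2 (h.1 hi')
    rw [Finset.prod_congr rfl h1, Finset.prod_congr rfl h2, Finset.prod_const, Finset.prod_const]
  · symm
    by_cases hd : D ⊆ R
    · obtain ⟨i, hiB, hiR⟩ := Finset.not_disjoint_iff.1 fun hb => h ⟨hd, hb⟩
      have h1 : ∏ i ∈ R, (if i ∈ B then 0 else p) = 0 := Finset.prod_eq_zero hiR (if_pos hiB)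
      rw [h1, zero_mul]
    · obtain ⟨i, hiD, hiR⟩ := Finset.not_subset.1 hd
      have h1 : ∏ i ∈ H \ R, (if i ∈ D then 0 else q) = 0 :=
        Finset.prod_eq_zero (Finset.mem_sdiff.2 ⟨hD hiD, hiR⟩) (if_pos hiD)
      rw [h1, mul_zero]

/-- The expected size of a Bernoulli sample. -/
lemma sum_bernoulli_weight_mul_card (H : Finset α) (p q : ℝ) (hpq : p + q = 1) :
    ∑ R ∈ H.powerset, p ^ #R * q ^ #(H \ R) * #R = p * #H := by
  have h1 : ∀ R ∈ H.powerset, p ^ #R * q ^ #(H \ R) * (#R : ℝ) =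
      ∑ i ∈ H, if i ∈ R then p ^ #R * q ^ #(H \ R) else 0 := by
    intro R hR
    rw [Finset.sum_ite_mem, Finset.inter_eq_right.2 (Finset.mem_powerset.1 hR)]
    simp [mul_comm]
  rw [Finset.sum_congr rfl h1, Finset.sum_comm]
  have h2 : ∀ i ∈ H, (∑ R ∈ H.powerset, if i ∈ R then p ^ #R * q ^ #(H \ R) else 0) = p := by
    intro i hi
    have := sum_bernoulli_weight H {i} ∅ p q hpq (by simpa using hi) (by simp) (by simp)
    simpa [Finset.sum_filter] using this
  rw [Finset.sum_congr rfl h2]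
  simp [mul_comm]

/-- If every subset `R` of `H` has at most `2 * #R` configurations without conflicts, then there
are at most `6 * (k + 1) ^ 2 * #H` configurations with at most `k` conflicts. -/
lemma card_configurations_le (H : Finset α) (V : Finset β) (D B : β → Finset α)
    (hD : ∀ v ∈ V, D v ⊆ H) (hD3 : ∀ v ∈ V, #(D v) = 3) (hB : ∀ v ∈ V, B v ⊆ H)
    (hDB : ∀ v ∈ V, Disjoint (D v) (B v))
    (h0 : ∀ R ⊆ H, #{v ∈ V | D v ⊆ R ∧ Disjoint (B v) R} ≤ 2 * #R) {k : ℕ} (hk : 1 ≤ k) :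
    (#{v ∈ V | #(B v) ≤ k} : ℝ) ≤ 6 * (k + 1) ^ 2 * #H := by
  have hk0 : (0 : ℝ) < k := by exact_mod_cast hk
  set p : ℝ := 1 / (k + 1) with hp
  set q : ℝ := k / (k + 1) with hq
  have hp0 : 0 < p := by positivity
  have hq0 : 0 < q := by positivity
  have hpq : p + q = 1 := by rw [hp, hq]; field_simp; ring
  have hq1 : q ≤ 1 := by linarith
  have hqk : 1 ≤ 3 * q ^ k := by
    have h1 : q⁻¹ ≤ Real.exp (1 / k) := by
      have : q⁻¹ = 1 / k + 1 := by rw [hq]; field_simp; ring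
      rw [this]
      exact Real.add_one_le_exp _
    have h2 : (q⁻¹) ^ k ≤ Real.exp 1 := by
      calc (q⁻¹) ^ k ≤ Real.exp (1 / k) ^ k := by gcongr
        _ = Real.exp 1 := by rw [← Real.exp_nat_mul]; congr 1; field_simp
    have h3 : (q⁻¹) ^ k ≤ 3 := h2.trans Real.exp_one_lt_three.le
    rw [inv_pow] at h3
    have h4 : 0 < q ^ k := by positivity
    calc (1 : ℝ) = (q ^ k)⁻¹ * q ^ k := by field_simp
      _ ≤ 3 * q ^ k := by gcongr
  have upper : ∑ R ∈ H.powerset, p ^ #R * q ^ #(H \ R) *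
      (#{v ∈ V | D v ⊆ R ∧ Disjoint (B v) R} : ℝ) ≤ 2 * (p * #H) := by
    rw [← sum_bernoulli_weight_mul_card H p q hpq, Finset.mul_sum]
    refine Finset.sum_le_sum fun R hR => ?_
    have : (#{v ∈ V | D v ⊆ R ∧ Disjoint (B v) R} : ℝ) ≤ 2 * #R := by
      exact_mod_cast h0 R (Finset.mem_powerset.1 hR)
    calc _ ≤ p ^ #R * q ^ #(H \ R) * (2 * #R : ℝ) := by gcongr
      _ = _ := by ring
  have swap : ∑ R ∈ H.powerset, p ^ #R * q ^ #(H \ R) *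
      (#{v ∈ V | D v ⊆ R ∧ Disjoint (B v) R} : ℝ) = ∑ v ∈ V, p ^ 3 * q ^ #(B v) := by
    have h1 : ∀ R ∈ H.powerset, p ^ #R * q ^ #(H \ R) *
        (#{v ∈ V | D v ⊆ R ∧ Disjoint (B v) R} : ℝ) =
        ∑ v ∈ V, if D v ⊆ R ∧ Disjoint (B v) R then p ^ #R * q ^ #(H \ R) else 0 := by
      intro R _
      rw [← Finset.sum_filter]
      simp [mul_comm]
    rw [Finset.sum_congr rfl h1, Finset.sum_comm]
    refine Finset.sum_congr rfl fun v hv => ?_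
    rw [← Finset.sum_filter, sum_bernoulli_weight H _ _ p q hpq (hD v hv) (hB v hv) (hDB v hv),
      hD3 v hv]
  have lower : (#{v ∈ V | #(B v) ≤ k} : ℝ) * (p ^ 3 * q ^ k) ≤ ∑ v ∈ V, p ^ 3 * q ^ #(B v) := by
    calc (#{v ∈ V | #(B v) ≤ k} : ℝ) * (p ^ 3 * q ^ k)
        = ∑ v ∈ V with #(B v) ≤ k, p ^ 3 * q ^ k := by simp
      _ ≤ ∑ v ∈ V with #(B v) ≤ k, p ^ 3 * q ^ #(B v) := by
        refine Finset.sum_le_sum fun v hv => ?_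
        have := pow_le_pow_of_le_one hq0.le hq1 (Finset.mem_filter.1 hv).2
        gcongr
      _ ≤ _ := Finset.sum_le_sum_of_subset_of_nonneg (Finset.filter_subset _ _)
        fun _ _ _ => by positivity
  have total : (#{v ∈ V | #(B v) ≤ k} : ℝ) * (p ^ 3 * q ^ k) ≤ 2 * (p * #H) :=
    lower.trans (swap.symm.le.trans upper)
  set N : ℝ := (#{v ∈ V | #(B v) ≤ k} : ℝ) with hN
  have hN0 : 0 ≤ N := by positivity
  have h5 : N * p ^ 3 ≤ 6 * p * #H := by
    calc N * p ^ 3 ≤ N * p ^ 3 * (3 * q ^ k) := le_mul_of_one_le_right (by positivity) hqk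
      _ = 3 * (N * (p ^ 3 * q ^ k)) := by ring
      _ ≤ 3 * (2 * (p * #H)) := by gcongr
      _ = _ := by ring
  have h6 : N = N * p ^ 3 * (k + 1) ^ 3 := by
    rw [mul_assoc, ← mul_pow, show p * (k + 1) = 1 by rw [hp]; field_simp, one_pow, mul_one]
  calc N = N * p ^ 3 * (k + 1) ^ 3 := h6
    _ ≤ 6 * p * #H * (k + 1) ^ 3 := by gcongr
    _ = _ := by
      have : p * (k + 1) = 1 := by rw [hp]; field_simp
      linear_combination 6 * (#H : ℝ) * (k + 1) ^ 2 * this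

/-- Moving a conflict into the sample. -/
lemma sum_card_sdiff_le (H D B : Finset α) (hB : B ⊆ H) (r k : ℕ) :
    ∑ R ∈ H.powersetCard r with D ⊆ R ∧ #(B ∩ R) ≤ k, #(B \ R) ≤
      ∑ R ∈ H.powersetCard (r + 1) with D ⊆ R ∧ #(B ∩ R) ≤ k + 1, #(B ∩ R) := by
  rw [← Finset.card_sigma, ← Finset.card_sigma]
  refine Finset.card_le_card_of_injOn (fun x => ⟨insert x.2 x.1, x.2⟩) ?_ ?_
  · rintro ⟨R, h⟩ hx
    simp only [Finset.coe_sigma, Set.mem_sigma_iff, Finset.mem_coe, Finset.mem_filter,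
      Finset.mem_powersetCard, Finset.mem_sdiff, Finset.mem_inter] at hx ⊢
    obtain ⟨⟨⟨hR, hc⟩, hDR, hk⟩, hhB, hhR⟩ := hx
    refine ⟨⟨⟨Finset.insert_subset (hB hhB) hR, ?_⟩, hDR.trans (Finset.subset_insert _ _), ?_⟩,
      hhB, Finset.mem_insert_self _ _⟩
    · rw [Finset.card_insert_of_notMem hhR, hc]
    · rw [Finset.inter_insert_of_mem hhB]
      exact (Finset.card_insert_le _ _).trans (by omega)
  · rintro ⟨R, h⟩ hx ⟨R', h'⟩ hx' heq
    simp only [Finset.coe_sigma, Set.mem_sigma_iff, Finset.mem_coe, Finset.mem_filter,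
      Finset.mem_sdiff] at hx hx'
    simp only [Sigma.mk.injEq, heq_eq_eq] at heq
    obtain ⟨h1, rfl⟩ := heq
    have : R = R' := by
      rw [← Finset.erase_insert hx.2.2, h1, Finset.erase_insert hx'.2.2]
    rw [this]

/-- The Clarkson–Shor bound for the total number of further conflicts of the configurations of a
random `r`-subset having at most `k` conflicts. -/
lemma sum_conflicts_le (H : Finset α) (V : Finset β) (D B : β → Finset α)
    (hD3 : ∀ v ∈ V, #(D v) = 3) (hB : ∀ v ∈ V, B v ⊆ H)
    (hDB : ∀ v ∈ V, Disjoint (D v) (B v))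
    (h0 : ∀ R ⊆ H, #{v ∈ V | D v ⊆ R ∧ Disjoint (B v) R} ≤ 2 * #R) (r : ℕ) {k : ℕ}
    (hk : 1 ≤ k) :
    (∑ R ∈ H.powersetCard r, ∑ v ∈ V with D v ⊆ R ∧ #(B v ∩ R) ≤ k, (#(B v \ R) : ℝ)) ≤
      108 * #H * k ^ 3 * (#(H.powersetCard r) : ℝ) := by
  have hk1 : (1 : ℝ) ≤ k := by exact_mod_cast hk
  have step : (∑ R ∈ H.powersetCard r, ∑ v ∈ V with D v ⊆ R ∧ #(B v ∩ R) ≤ k, #(B v \ R)) ≤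
      ∑ R ∈ H.powersetCard (r + 1), ∑ v ∈ V with D v ⊆ R ∧ #(B v ∩ R) ≤ k + 1, #(B v ∩ R) := by
    simp only [Finset.sum_filter]
    rw [Finset.sum_comm, Finset.sum_comm (s := H.powersetCard (r + 1))]
    refine Finset.sum_le_sum fun v hv => ?_
    simpa only [Finset.sum_filter] using sum_card_sdiff_le H (D v) (B v) (hB v hv) r k
  have bound : ∀ R ∈ H.powersetCard (r + 1),
      ((∑ v ∈ V with D v ⊆ R ∧ #(B v ∩ R) ≤ k + 1, #(B v ∩ R) : ℕ) : ℝ) ≤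
        6 * (k + 2) ^ 2 * (r + 1) * (k + 1) := by
    intro R hR
    obtain ⟨hRH, hRc⟩ := Finset.mem_powersetCard.1 hR
    have h1 := card_configurations_le R {v ∈ V | D v ⊆ R} D (fun v => B v ∩ R)
      (fun v hv => (Finset.mem_filter.1 hv).2) (fun v hv => hD3 v (Finset.mem_filter.1 hv).1)
      (fun v _ => Finset.inter_subset_right)
      (fun v hv => (hDB v (Finset.mem_filter.1 hv).1).mono_right Finset.inter_subset_left)
      (fun S hS => by
        refine le_trans (Finset.card_le_card ?_) (h0 S (hS.trans hRH))
        intro v hv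
        simp only [Finset.mem_filter] at hv ⊢
        refine ⟨hv.1.1, hv.2.1, Finset.disjoint_left.2 fun x hx hxS => ?_⟩
        exact Finset.disjoint_left.1 hv.2.2 (Finset.mem_inter.2 ⟨hx, hS hxS⟩) hxS)
      (k := k + 1) (by omega)
    rw [Finset.filter_filter] at h1
    have h2 : (∑ v ∈ V with D v ⊆ R ∧ #(B v ∩ R) ≤ k + 1, #(B v ∩ R)) ≤
        #{v ∈ V | D v ⊆ R ∧ #(B v ∩ R) ≤ k + 1} * (k + 1) := by
      rw [← smul_eq_mul]
      exact Finset.sum_le_card_nsmul _ _ _ fun v hv => (Finset.mem_filter.1 hv).2.2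
    calc _ ≤ ((#{v ∈ V | D v ⊆ R ∧ #(B v ∩ R) ≤ k + 1} * (k + 1) : ℕ) : ℝ) := by
          exact_mod_cast h2
      _ = (#{v ∈ V | D v ⊆ R ∧ #(B v ∩ R) ≤ k + 1} : ℝ) * (k + 1) := by push_cast; ring
      _ ≤ 6 * ((k + 1 : ℕ) + 1) ^ 2 * #R * (k + 1) := by gcongr
      _ = _ := by rw [hRc]; push_cast; ring
  have choose_le : ((#H).choose (r + 1) : ℝ) * (r + 1) ≤ (#H).choose r * #H := by
    have h1 := Nat.choose_succ_right_eq (#H) r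
    have h2 : (#H).choose (r + 1) * (r + 1) ≤ (#H).choose r * #H := by
      rw [h1]
      exact Nat.mul_le_mul_left _ (Nat.sub_le _ _)
    exact_mod_cast h2
  have poly : 6 * ((k : ℝ) + 2) ^ 2 * (k + 1) ≤ 108 * k ^ 3 := by
    calc 6 * ((k : ℝ) + 2) ^ 2 * (k + 1) ≤ 6 * (3 * k) ^ 2 * (2 * k) := by gcongr <;> linarith
      _ = _ := by ring
  calc (∑ R ∈ H.powersetCard r, ∑ v ∈ V with D v ⊆ R ∧ #(B v ∩ R) ≤ k, (#(B v \ R) : ℝ))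
      ≤ ∑ R ∈ H.powersetCard (r + 1),
          ((∑ v ∈ V with D v ⊆ R ∧ #(B v ∩ R) ≤ k + 1, #(B v ∩ R) : ℕ) : ℝ) := by
        exact_mod_cast step
    _ ≤ ∑ R ∈ H.powersetCard (r + 1), 6 * ((k : ℝ) + 2) ^ 2 * (r + 1) * (k + 1) :=
        Finset.sum_le_sum bound
    _ = 6 * ((k : ℝ) + 2) ^ 2 * (k + 1) * ((#H).choose (r + 1) * (r + 1)) := by
        rw [Finset.sum_const, Finset.card_powersetCard, nsmul_eq_mul]; ring
    _ ≤ 108 * k ^ 3 * ((#H).choose r * #H) := by gcongr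
    _ = _ := by rw [Finset.card_powersetCard]; ring

end Sampling

section Planes

/-- The vector `u` is nonnegative in the lexicographic order on the plane. -/
def LexNonneg (u : ℝ × ℝ) : Prop := 0 < u.1 ∨ (u.1 = 0 ∧ 0 ≤ u.2)

lemma lexNonneg_or_neg (u : ℝ × ℝ) : LexNonneg u ∨ LexNonneg (-u) := by
  simp only [LexNonneg, Prod.fst_neg, Prod.snd_neg, neg_eq_zero, Left.neg_pos_iff,
    Left.nonneg_neg_iff]
  rcases lt_trichotomy u.1 0 with h | h | h
  · exact .inr (.inl h)
  · rcases le_total 0 u.2 with h' | h'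
    · exact .inl (.inr ⟨h, h'⟩)
    · exact .inr (.inr ⟨h, h'⟩)
  · exact .inl (.inl h)

lemma LexNonneg.antisymm {p q : ℝ × ℝ} (h : LexNonneg (q - p)) (h' : LexNonneg (p - q)) :
    p = q := by
  simp only [LexNonneg, Prod.fst_sub, Prod.snd_sub] at h h'
  refine Prod.ext ?_ ?_ <;> rcases h with h | h <;> rcases h' with h' | h' <;> linarith

lemma LexNonneg.smul {u : ℝ × ℝ} (h : LexNonneg u) {s : ℝ} (hs : 0 ≤ s) : LexNonneg (s • u) := by
  rcases hs.eq_or_lt with rfl | hs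
  · simp [LexNonneg]
  · rcases h with h | ⟨h, h'⟩
    · exact .inl (mul_pos hs h)
    · exact .inr ⟨by simp [h], mul_nonneg hs.le h'⟩

lemma LexNonneg.add {u v : ℝ × ℝ} (hu : LexNonneg u) (hv : LexNonneg v) : LexNonneg (u + v) := by
  simp only [LexNonneg, Prod.fst_add, Prod.snd_add] at *
  rcases hu with hu | hu <;> rcases hv with hv | hv
  · left; linarith
  · left; linarith
  · left; linarith
  · right; constructor <;> linarith

/-- The direction of the line in which two planes `a`, `b` agree. -/
def edgeDir (a b : ℝ × ℝ × ℝ) : ℝ × ℝ := (a.2.1 - b.2.1, b.1 - a.1)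

/-- The orientation of the gradients of three planes. -/
def gradDet (a b c : ℝ × ℝ × ℝ) : ℝ :=
  (a.1 - b.1) * (a.2.1 - c.2.1) - (a.2.1 - b.2.1) * (a.1 - c.1)

/-- The region below which the plane `a` is lowest among `R`. -/
def lowestRegion (R : Finset (ℝ × ℝ × ℝ)) (a : ℝ × ℝ × ℝ) : Set (ℝ × ℝ) :=
  {q | ∀ h ∈ R, evalPlane a q ≤ evalPlane h q}

lemma gradDet_ne_zero {a b c : ℝ × ℝ × ℝ} (hab : (a.1, a.2.1) ≠ (b.1, b.2.1))
    (h : ∃! p : ℝ × ℝ, evalPlane a p = evalPlane b p ∧ evalPlane a p = evalPlane c p) :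
    gradDet a b c ≠ 0 := by
  intro h0
  obtain ⟨p, ⟨hp1, hp2⟩, huniq⟩ := h
  have := huniq (p + edgeDir a b) (by
    simp only [evalPlane, edgeDir, gradDet, Prod.fst_add, Prod.snd_add] at *
    constructor
    · linear_combination hp1
    · linear_combination hp2 - h0)
  simp only [edgeDir, add_eq_left, Prod.ext_iff, Prod.fst_zero, Prod.snd_zero] at this
  exact hab (Prod.ext (by simp; linarith) (by simp; linarith))

lemma lexNonneg_smul_of_edges {R : Finset (ℝ × ℝ × ℝ)} {a b c : ℝ × ℝ × ℝ} {p q : ℝ × ℝ}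
    (hb : b ∈ R) (hc : c ∈ R) (hpb : evalPlane a p = evalPlane b p)
    (hpc : evalPlane a p = evalPlane c p) (hdet : 0 < gradDet a b c) {σ : ℝ}
    (h1 : LexNonneg (σ • edgeDir a b)) (h2 : LexNonneg (σ • edgeDir c a))
    (hq : q ∈ lowestRegion R a) : LexNonneg (σ • (q - p)) := by
  have hqb := hq b hb
  have hqc := hq c hc
  have key : σ • (q - p) = (gradDet a b c)⁻¹ •
      ((evalPlane c q - evalPlane a q) • (σ • edgeDir a b) +
        (evalPlane b q - evalPlane a q) • (σ • edgeDir c a)) := by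
    rw [eq_inv_smul_iff₀ hdet.ne']
    ext
    · simp only [evalPlane, edgeDir, gradDet, Prod.smul_fst, Prod.fst_add, Prod.fst_sub,
        smul_eq_mul] at *
      linear_combination σ * (a.2.1 - b.2.1) * hpc - σ * (a.2.1 - c.2.1) * hpb
    · simp only [evalPlane, edgeDir, gradDet, Prod.smul_snd, Prod.snd_add, Prod.snd_sub,
        smul_eq_mul] at *
      linear_combination σ * (b.1 - a.1) * hpc - σ * (c.1 - a.1) * hpb
  rw [key]
  exact (((h1.smul (sub_nonneg.2 hqc)).add (h2.smul (sub_nonneg.2 hqb)))).smul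
    (inv_nonneg.2 hdet.le)

/-- `p` is the lexicographically extreme point, minimal for `σ = 1` and maximal for `σ = -1`, of
the region in which `a` is lowest. -/
def IsLexExtreme (R : Finset (ℝ × ℝ × ℝ)) (a : ℝ × ℝ × ℝ) (σ : ℝ) (p : ℝ × ℝ) : Prop :=
  p ∈ lowestRegion R a ∧ ∀ q ∈ lowestRegion R a, LexNonneg (σ • (q - p))

lemma IsLexExtreme.unique {R : Finset (ℝ × ℝ × ℝ)} {a : ℝ × ℝ × ℝ} {σ : ℝ} (hσ : σ ≠ 0)
    {p q : ℝ × ℝ} (hp : IsLexExtreme R a σ p) (hq : IsLexExtreme R a σ q) : p = q := by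
  have h1 := hp.2 q hq.1
  have h2 := hq.2 p hp.1
  rw [smul_sub] at h1 h2
  exact smul_right_injective _ hσ (h1.antisymm h2)

lemma exists_isLexExtreme_of_pos {R : Finset (ℝ × ℝ × ℝ)} {a b c : ℝ × ℝ × ℝ} {p : ℝ × ℝ}
    (ha : a ∈ R) (hb : b ∈ R) (hc : c ∈ R) (hpb : evalPlane a p = evalPlane b p)
    (hpc : evalPlane a p = evalPlane c p) (hp : p ∈ lowestRegion R a)
    (hdet : 0 < gradDet a b c) :
    ∃ h ∈ R, evalPlane h p = evalPlane a p ∧ (IsLexExtreme R h 1 p ∨ IsLexExtreme R h (-1) p) := by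
  have hpB : p ∈ lowestRegion R b := fun h hh => hpb ▸ hp h hh
  have hpC : p ∈ lowestRegion R c := fun h hh => hpc ▸ hp h hh
  have hdet1 : 0 < gradDet b c a := by
    have : gradDet b c a = gradDet a b c := by simp only [gradDet]; ring
    rwa [this]
  have hdet2 : 0 < gradDet c a b := by
    have : gradDet c a b = gradDet a b c := by simp only [gradDet]; ring
    rwa [this]
  have A : ∀ σ, LexNonneg (σ • edgeDir a b) → LexNonneg (σ • edgeDir c a) →
      IsLexExtreme R a σ p := fun σ h1 h2 =>
    ⟨hp, fun q hq => lexNonneg_smul_of_edges hb hc hpb hpc hdet h1 h2 hq⟩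
  have B : ∀ σ, LexNonneg (σ • edgeDir b c) → LexNonneg (σ • edgeDir a b) →
      IsLexExtreme R b σ p := fun σ h1 h2 =>
    ⟨hpB, fun q hq => lexNonneg_smul_of_edges hc ha (hpb ▸ hpc) hpb.symm hdet1 h1 h2 hq⟩
  have C : ∀ σ, LexNonneg (σ • edgeDir c a) → LexNonneg (σ • edgeDir b c) →
      IsLexExtreme R c σ p := fun σ h1 h2 =>
    ⟨hpC, fun q hq => lexNonneg_smul_of_edges ha hb hpc.symm (hpc ▸ hpb) hdet2 h1 h2 hq⟩
  have sign : ∀ u : ℝ × ℝ, LexNonneg ((1 : ℝ) • u) ∨ LexNonneg ((-1 : ℝ) • u) := by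
    simpa only [one_smul, neg_smul] using lexNonneg_or_neg
  rcases sign (edgeDir a b) with h1 | h1 <;> rcases sign (edgeDir c a) with h2 | h2 <;>
    rcases sign (edgeDir b c) with h3 | h3
  · exact ⟨a, ha, rfl, .inl (A 1 h1 h2)⟩
  · exact ⟨a, ha, rfl, .inl (A 1 h1 h2)⟩
  · exact ⟨b, hb, hpb.symm, .inl (B 1 h3 h1)⟩
  · exact ⟨c, hc, hpc.symm, .inr (C (-1) h2 h3)⟩
  · exact ⟨c, hc, hpc.symm, .inl (C 1 h2 h3)⟩
  · exact ⟨b, hb, hpb.symm, .inr (B (-1) h3 h1)⟩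
  · exact ⟨a, ha, rfl, .inr (A (-1) h1 h2)⟩
  · exact ⟨a, ha, rfl, .inr (A (-1) h1 h2)⟩

/-- A vertex of the lower envelope is a lexicographically extreme vertex of one of its faces. -/
lemma exists_isLexExtreme {R : Finset (ℝ × ℝ × ℝ)} {a b c : ℝ × ℝ × ℝ} {p : ℝ × ℝ}
    (ha : a ∈ R) (hb : b ∈ R) (hc : c ∈ R) (hpb : evalPlane a p = evalPlane b p)
    (hpc : evalPlane a p = evalPlane c p) (hp : p ∈ lowestRegion R a)
    (hdet : gradDet a b c ≠ 0) :
    ∃ h ∈ R, evalPlane h p = evalPlane a p ∧ (IsLexExtreme R h 1 p ∨ IsLexExtreme R h (-1) p) := by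
  rcases hdet.lt_or_gt with h | h
  · refine exists_isLexExtreme_of_pos ha hc hb hpc hpb hp ?_
    have : gradDet a c b = - gradDet a b c := by simp only [gradDet]; ring
    linarith
  · exact exists_isLexExtreme_of_pos ha hb hc hpb hpc hp h

/-- The planes of `H` through the point `v`. -/
noncomputable def planesThrough (H : Finset (ℝ × ℝ × ℝ)) (v : (ℝ × ℝ) × ℝ) :
    Finset (ℝ × ℝ × ℝ) := {h ∈ H | evalPlane h v.1 = v.2}

/-- The planes of `H` strictly below the point `v`. -/
noncomputable def planesBelow (H : Finset (ℝ × ℝ × ℝ)) (v : (ℝ × ℝ) × ℝ) :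
    Finset (ℝ × ℝ × ℝ) := {h ∈ H | evalPlane h v.1 < v.2}

lemma isVertex_iff_card (R : Finset (ℝ × ℝ × ℝ)) (v : (ℝ × ℝ) × ℝ) :
    IsVertex R v ↔ #(planesThrough R v) = 3 := by
  rw [IsVertex, ← Set.ncard_coe_finset, planesThrough, Finset.coe_filter]

lemma levelOf_eq_card {H R : Finset (ℝ × ℝ × ℝ)} (hR : R ⊆ H) (v : (ℝ × ℝ) × ℝ) :
    levelOf R v = #(planesBelow H v ∩ R) := by
  rw [levelOf, ← Set.ncard_coe_finset]
  congr 1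
  ext h
  simp only [planesBelow, Set.mem_ofPred_eq, Finset.mem_coe, Finset.mem_inter, Finset.mem_filter]
  exact ⟨fun hh => ⟨⟨hR hh.1, hh.2⟩, hh.1⟩, fun hh => ⟨hh.2, hh.1.2⟩⟩

lemma bcl_eq_card (H R : Finset (ℝ × ℝ × ℝ)) (v : (ℝ × ℝ) × ℝ) :
    bcl H R v = #(planesBelow H v \ R) := by
  rw [bcl, ← Set.ncard_coe_finset]
  congr 1
  ext h
  simp only [planesBelow, Set.mem_ofPred_eq, Finset.mem_coe, Finset.mem_sdiff, Finset.mem_filter]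
  tauto

/-- No four planes of `H` have a common point. -/
def NoFourConcurrent (H : Finset (ℝ × ℝ × ℝ)) : Prop :=
  ∀ h₁ ∈ H, ∀ h₂ ∈ H, ∀ h₃ ∈ H, ∀ h₄ ∈ H,
    h₁ ≠ h₂ → h₁ ≠ h₃ → h₁ ≠ h₄ → h₂ ≠ h₃ → h₂ ≠ h₄ → h₃ ≠ h₄ →
    ¬∃ p : ℝ × ℝ, evalPlane h₁ p = evalPlane h₂ p ∧
        evalPlane h₁ p = evalPlane h₃ p ∧ evalPlane h₁ p = evalPlane h₄ p

/-- Any three planes of `H` have exactly one common point. -/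
def ThreeMeetOnce (H : Finset (ℝ × ℝ × ℝ)) : Prop :=
  ∀ h₁ ∈ H, ∀ h₂ ∈ H, ∀ h₃ ∈ H, h₁ ≠ h₂ → h₁ ≠ h₃ → h₂ ≠ h₃ →
    ∃! p : ℝ × ℝ, evalPlane h₁ p = evalPlane h₂ p ∧ evalPlane h₁ p = evalPlane h₃ p

lemma NoFourConcurrent.card_planesThrough_le {H : Finset (ℝ × ℝ × ℝ)} (hH : NoFourConcurrent H)
    (v : (ℝ × ℝ) × ℝ) : #(planesThrough H v) ≤ 3 := by
  by_contra! hlt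
  obtain ⟨T, hT, hc⟩ := Finset.exists_subset_card_eq (Nat.succ_le_of_lt hlt)
  obtain ⟨a, b, c, d, hab, hac, had, hbc, hbd, hcd, rfl⟩ := Finset.card_eq_four.1 hc
  simp only [Finset.insert_subset_iff, Finset.singleton_subset_iff, planesThrough,
    Finset.mem_filter] at hT
  obtain ⟨ha, hb, hc, hd⟩ := hT
  exact hH a ha.1 b hb.1 c hc.1 d hd.1 hab hac had hbc hbd hcd
    ⟨v.1, ha.2.trans hb.2.symm, ha.2.trans hc.2.symm, ha.2.trans hd.2.symm⟩

lemma NoFourConcurrent.isVertex_iff {H R : Finset (ℝ × ℝ × ℝ)} (hH : NoFourConcurrent H)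
    (hR : R ⊆ H) (v : (ℝ × ℝ) × ℝ) :
    IsVertex R v ↔ IsVertex H v ∧ planesThrough H v ⊆ R := by
  have hsub : planesThrough R v ⊆ planesThrough H v := Finset.filter_subset_filter _ hR
  simp only [isVertex_iff_card]
  constructor
  · intro h
    have heq : planesThrough R v = planesThrough H v :=
      Finset.eq_of_subset_of_card_le hsub (h ▸ hH.card_planesThrough_le v)
    exact ⟨heq ▸ h, heq ▸ Finset.filter_subset _ _⟩
  · rintro ⟨h, hs⟩
    have heq : planesThrough R v = planesThrough H v :=
      hsub.antisymm fun x hx => Finset.mem_filter.2 ⟨hs hx, (Finset.mem_filter.1 hx).2⟩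
    rw [heq, h]

lemma ThreeMeetOnce.finite_vertices {H : Finset (ℝ × ℝ × ℝ)} (hH : ThreeMeetOnce H) :
    {v | IsVertex H v}.Finite := by
  refine Set.Finite.of_injOn (f := planesThrough H) (t := (H.powerset : Set _)) ?_ ?_
    (Finset.finite_toSet _)
  · intro v _
    exact Finset.mem_coe.2 (Finset.mem_powerset.2 (Finset.filter_subset _ _))
  · intro v hv w _ heq
    rw [Set.mem_ofPred_eq, isVertex_iff_card] at hv
    obtain ⟨a, b, c, hab, hac, hbc, habc⟩ := Finset.card_eq_three.1 hv
    have hmem : ∀ h ∈ ({a, b, c} : Finset (ℝ × ℝ × ℝ)),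
        h ∈ H ∧ evalPlane h v.1 = v.2 ∧ evalPlane h w.1 = w.2 := by
      intro h hh
      rw [← habc] at hh
      have hw := heq ▸ hh
      exact ⟨(Finset.mem_filter.1 hh).1, (Finset.mem_filter.1 hh).2, (Finset.mem_filter.1 hw).2⟩
    obtain ⟨ha, hav, haw⟩ := hmem a (by simp)
    obtain ⟨hb, hbv, hbw⟩ := hmem b (by simp)
    obtain ⟨hc, hcv, hcw⟩ := hmem c (by simp)
    have h1 : v.1 = w.1 := (hH a ha b hb c hc hab hac hbc).unique
      ⟨hav.trans hbv.symm, hav.trans hcv.symm⟩ ⟨haw.trans hbw.symm, haw.trans hcw.symm⟩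
    exact Prod.ext h1 (by rw [← hav, ← haw, h1])

/-- The lower envelope of `R` has at most `2 * #R` vertices. -/
lemma card_envelope_vertices_le {H R : Finset (ℝ × ℝ × ℝ)} (hR : R ⊆ H)
    (hgrad : ∀ h₁ ∈ H, ∀ h₂ ∈ H, h₁ ≠ h₂ → (h₁.1, h₁.2.1) ≠ (h₂.1, h₂.2.1))
    (hthree : ThreeMeetOnce H) (V : Finset ((ℝ × ℝ) × ℝ)) (hV : ∀ v ∈ V, IsVertex H v) :
    #{v ∈ V | planesThrough H v ⊆ R ∧ Disjoint (planesBelow H v) R} ≤ 2 * #R := by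
  have hcard : #(R ×ˢ ({1, -1} : Finset ℝ)) = 2 * #R := by
    rw [Finset.card_product, Finset.card_pair (by norm_num), mul_comm]
  rw [← hcard]
  refine Finset.card_le_card_of_forall_subsingleton
    (fun v x => evalPlane x.1 v.1 = v.2 ∧ IsLexExtreme R x.1 x.2 v.1) ?_ ?_
  · intro v hv
    obtain ⟨hvV, hsub, hdisj⟩ := Finset.mem_filter.1 hv
    obtain ⟨a, b, c, hab, hac, hbc, habc⟩ :=
      Finset.card_eq_three.1 ((isVertex_iff_card H v).1 (hV v hvV))
    have hmem : ∀ h ∈ ({a, b, c} : Finset (ℝ × ℝ × ℝ)), h ∈ R ∧ evalPlane h v.1 = v.2 := by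
      intro h hh
      rw [← habc] at hh
      exact ⟨hsub hh, (Finset.mem_filter.1 hh).2⟩
    obtain ⟨ha, hav⟩ := hmem a (by simp)
    obtain ⟨hb, hbv⟩ := hmem b (by simp)
    obtain ⟨hc, hcv⟩ := hmem c (by simp)
    have hlow : v.1 ∈ lowestRegion R a := by
      intro h hh
      rw [hav]
      by_contra! hlt
      exact Finset.disjoint_left.1 hdisj (Finset.mem_filter.2 ⟨hR hh, hlt⟩) hh
    obtain ⟨h, hh, hhv, hext⟩ := exists_isLexExtreme ha hb hc (hav.trans hbv.symm)
      (hav.trans hcv.symm) hlow (gradDet_ne_zero (hgrad a (hR ha) b (hR hb) hab)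
        (hthree a (hR ha) b (hR hb) c (hR hc) hab hac hbc))
    rcases hext with hext | hext
    · exact ⟨(h, 1), by simp [hh], hhv.trans hav, hext⟩
    · exact ⟨(h, -1), by simp [hh], hhv.trans hav, hext⟩
  · rintro ⟨h, σ⟩ hx v ⟨_, hv, hve⟩ w ⟨_, hw, hwe⟩
    have hσ : σ ≠ 0 := by
      have := (Finset.mem_product.1 hx).2
      simp only [Finset.mem_insert, Finset.mem_singleton] at this
      rcases this with rfl | rfl <;> norm_num
    have h1 : v.1 = w.1 := hve.unique hσ hwe
    exact Prod.ext h1 (by rw [← hv, ← hw, h1])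

end Planes

/-- There is an absolute constant `c` such that for any `n` nonvertical planes
`H` in `ℝ³` in general position (any two distinct graphs meet in a line, any
three in exactly one point, no four in a common point), any `1 ≤ r ≤ n`, and any
`k ≥ 1`: the expectation, over a uniformly random `r`-subset `R` of `H`, of
`∑_{v ∈ V_{≤k}(R)} b(v)` is at most `c·n·k³`. -/
theorem expected_below_conflict_sum_le :
    ∃ c : ℝ, 0 < c ∧
      ∀ (n r k : ℕ) (H : Finset (ℝ × ℝ × ℝ)), H.card = n → 1 ≤ r → r ≤ n → 1 ≤ k →
      (∀ h₁ ∈ H, ∀ h₂ ∈ H, h₁ ≠ h₂ → (h₁.1, h₁.2.1) ≠ (h₂.1, h₂.2.1)) →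
      (∀ h₁ ∈ H, ∀ h₂ ∈ H, ∀ h₃ ∈ H, h₁ ≠ h₂ → h₁ ≠ h₃ → h₂ ≠ h₃ →
        ∃! p : ℝ × ℝ, evalPlane h₁ p = evalPlane h₂ p ∧ evalPlane h₁ p = evalPlane h₃ p) →
      (∀ h₁ ∈ H, ∀ h₂ ∈ H, ∀ h₃ ∈ H, ∀ h₄ ∈ H,
        h₁ ≠ h₂ → h₁ ≠ h₃ → h₁ ≠ h₄ → h₂ ≠ h₃ → h₂ ≠ h₄ → h₃ ≠ h₄ →
        ¬∃ p : ℝ × ℝ, evalPlane h₁ p = evalPlane h₂ p ∧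
            evalPlane h₁ p = evalPlane h₃ p ∧ evalPlane h₁ p = evalPlane h₄ p) →
      (∑ R ∈ H.powersetCard r,
          ∑ᶠ v ∈ {v : (ℝ × ℝ) × ℝ | IsVertex R v ∧ levelOf R v ≤ k}, (bcl H R v : ℝ))
        / ((H.powersetCard r).card : ℝ)
        ≤ c * n * k ^ 3 := by
  refine ⟨108, by norm_num, ?_⟩
  intro n r k H hn _ hrn hk hgrad hthree hfour
  have hfour' : NoFourConcurrent H := hfour
  have hfin := ThreeMeetOnce.finite_vertices hthree
  have hmemV : ∀ v, v ∈ hfin.toFinset ↔ IsVertex H v := fun v => by simp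
  have hsum : ∀ R ∈ H.powersetCard r,
      ∑ᶠ v ∈ {v : (ℝ × ℝ) × ℝ | IsVertex R v ∧ levelOf R v ≤ k}, (bcl H R v : ℝ) =
      ∑ v ∈ hfin.toFinset with planesThrough H v ⊆ R ∧ #(planesBelow H v ∩ R) ≤ k,
        (#(planesBelow H v \ R) : ℝ) := by
    intro R hR
    have hRH := (Finset.mem_powersetCard.1 hR).1
    rw [← finsum_mem_coe_finset]
    simp only [bcl_eq_card]
    congr! 3 with v
    simp only [Set.mem_ofPred_eq, Finset.mem_coe, Finset.mem_filter, hmemV,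
      hfour'.isVertex_iff hRH v, levelOf_eq_card hRH v, and_assoc]
  have hpos : (0 : ℝ) < #(H.powersetCard r) := by
    rw [Finset.card_powersetCard, hn]
    exact_mod_cast Nat.choose_pos hrn
  rw [div_le_iff₀ hpos, Finset.sum_congr rfl hsum, ← hn]
  refine sum_conflicts_le H hfin.toFinset (planesThrough H) (planesBelow H)
    (fun v hv => (isVertex_iff_card H v).1 ((hmemV v).1 hv))
    (fun v _ => Finset.filter_subset _ _) (fun v _ => ?_)
    (fun R hR => card_envelope_vertices_le hR hgrad hthree _ fun v hv => (hmemV v).1 hv) r hk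
  refine Finset.disjoint_left.2 fun h h1 h2 => ?_
  exact (Finset.mem_filter.1 h2).2.ne (Finset.mem_filter.1 h1).2
end

section
/- Let S be a finite set of points (sites) in the Euclidean plane ℝ², let s ∈ S, and let k ≥ 1 be an integer. Define the k environment of s as env_k(s, S) = {x ∈ ℝ² : the number of sites s' ∈ S with dist(x, s') < dist(x, s) is at most k − 1}, i.e., the set of points for which s is one of their k nearest neighbors in S. Then env_k(s, S) is star-shaped with respect to s: for every x ∈ env_k(s, S), the entire closed segment from s to x is contained in env_k(s, S). -/
/-- The `k` environment of the site `s` with respect to the finite site set `S`: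
the set of points `x ∈ ℝ²` for which at most `k - 1` sites of `S` are strictly
closer to `x` than `s` is, i.e. `s` is one of the `k` nearest neighbors of `x`
in `S`. -/
def envK (S : Finset (EuclideanSpace ℝ (Fin 2))) (s : EuclideanSpace ℝ (Fin 2))
    (k : ℕ) : Set (EuclideanSpace ℝ (Fin 2)) :=
  {x | ({s' : EuclideanSpace ℝ (Fin 2) | s' ∈ S ∧ dist x s' < dist x s}).ncard ≤ k - 1}

/-- The `k` environment of a site `s ∈ S` is star-shaped with respect to `s`:
for every `x` in it, the closed segment from `s` to `x` is contained in it. -/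
theorem envK_starShaped (S : Finset (EuclideanSpace ℝ (Fin 2)))
    (s : EuclideanSpace ℝ (Fin 2)) (hs : s ∈ S) (k : ℕ) (hk : 1 ≤ k)
    (x : EuclideanSpace ℝ (Fin 2)) (hx : x ∈ envK S s k) :
    segment ℝ s x ⊆ envK S s k := by
  intro y hy
  refine le_trans (Set.ncard_le_ncard ?_ (S.finite_toSet.subset fun _ h => h.1)) hx
  rintro t ⟨ht, hlt⟩
  have hadd : dist s y + dist y x = dist s x := dist_add_dist_of_mem_segment hy
  refine ⟨ht, ?_⟩
  calc dist x t ≤ dist x y + dist y t := dist_triangle x y t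
    _ < dist x y + dist y s := by gcongr
    _ = dist x s := by rw [dist_comm x y, dist_comm y s, dist_comm x s, add_comm, hadd]
end

section
/- Let p_1, …, p_n be n points sampled independently and uniformly at random from the unit square [0,1]². For every γ > 0 there exists a constant c = c(γ) such that for all n ≥ 2, the probability that the number of staircase points of {p_1, …, p_n} exceeds c·ln n is at most n^{−γ}. -/
open MeasureTheory

/-- The staircase (set of Pareto minima) of a point set `P ⊆ ℝ^d`: points of `P`
dominated by no other point of `P` (where `q` dominates `p` if every coordinate
of `q` is at most the corresponding coordinate of `p`). -/
def stair {d : ℕ} (P : Set (Fin d → ℝ)) : Set (Fin d → ℝ) :=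
  {p | p ∈ P ∧ ∀ q ∈ P, q ≠ p → ¬∀ i, q i ≤ p i}

open scoped ENNReal

/-- The strict left-to-right minima of the sequence `y` that lie below the level `m`. -/
noncomputable def recordsBelow {n : ℕ} (m : ℝ) (y : Fin n → ℝ) : Finset (Fin n) := by
  classical exact Finset.univ.filter fun i => y i < m ∧ ∀ j < i, y i < y j

/-- The strict left-to-right minima of the sequence `y`. -/
noncomputable def records {n : ℕ} (y : Fin n → ℝ) : Finset (Fin n) := by
  classical exact Finset.univ.filter fun i => ∀ j < i, y i < y j

lemma mem_records {n : ℕ} {y : Fin n → ℝ} {i : Fin n} :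
    i ∈ records y ↔ ∀ j < i, y i < y j := by
  simp [records]

lemma card_recordsBelow_cons {n : ℕ} (m u : ℝ) (t : Fin n → ℝ) :
    (recordsBelow m (Fin.cons u t : Fin (n + 1) → ℝ)).card =
      if u < m then (recordsBelow u t).card + 1 else (recordsBelow m t).card := by
  classical
  unfold recordsBelow
  rw [Fin.card_filter_univ_succ]
  simp only [Fin.cons_zero, Fin.cons_succ, Fin.not_lt_zero, IsEmpty.forall_iff, implies_true,
    and_true, Fin.forall_fin_succ, Fin.succ_pos, forall_true_left, Fin.succ_lt_succ_iff]
  split_ifs with h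
  · congr 2
    ext i
    simp only [Finset.mem_filter, Finset.mem_univ, true_and]
    exact ⟨fun H => H.2, fun H => ⟨H.1.trans h, H⟩⟩
  · congr 1
    ext i
    simp only [Finset.mem_filter, Finset.mem_univ, true_and]
    exact ⟨fun H => ⟨H.1, H.2.2⟩, fun H => ⟨H.1, H.1.trans_le (not_lt.1 h), H.2⟩⟩

lemma card_records_cons {n : ℕ} (u : ℝ) (t : Fin n → ℝ) :
    (records (Fin.cons u t : Fin (n + 1) → ℝ)).card = (recordsBelow u t).card + 1 := by
  classical
  unfold recordsBelow records
  rw [Fin.card_filter_univ_succ]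
  simp [Fin.forall_fin_succ]

lemma measurable_card_recordsBelow (n : ℕ) :
    Measurable fun q : ℝ × (Fin n → ℝ) => (recordsBelow q.1 q.2).card := by
  classical
  unfold recordsBelow
  simp only [Finset.card_filter]
  refine Finset.measurable_sum _ fun i _ => ?_
  refine Measurable.ite ?_ measurable_const measurable_const
  measurability

lemma measurable_card_records (n : ℕ) :
    Measurable fun y : Fin n → ℝ => (records y).card := by
  classical
  unfold records
  simp only [Finset.card_filter]
  refine Finset.measurable_sum _ fun i _ => ?_
  refine Measurable.ite ?_ measurable_const measurable_const
  measurability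

lemma measurable_two_pow {α : Type*} [MeasurableSpace α] {f : α → ℕ} (hf : Measurable f) :
    Measurable fun a => (2 : ℝ≥0∞) ^ f a :=
  (measurable_from_top (f := fun k : ℕ => (2 : ℝ≥0∞) ^ k)).comp hf

/-- Fubini for an i.i.d. sequence, splitting off its first term. -/
lemma lintegral_pi_fin_succ (ν : Measure ℝ) [IsProbabilityMeasure ν] {n : ℕ}
    {f : (Fin (n + 1) → ℝ) → ℝ≥0∞} (hf : Measurable f) :
    ∫⁻ y, f y ∂Measure.pi (fun _ : Fin (n + 1) => ν) =
      ∫⁻ u, ∫⁻ t, f (Fin.cons u t : Fin (n + 1) → ℝ) ∂Measure.pi (fun _ : Fin n => ν) ∂ν := by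
  have h := (measurePreserving_piFinSuccAbove (fun _ : Fin (n + 1) => ν) 0).symm
  rw [← h.lintegral_comp hf, lintegral_prod
    (fun q => f ((MeasurableEquiv.piFinSuccAbove (fun _ => ℝ) 0).symm q))
    (hf.comp h.measurable).aemeasurable]
  simp [MeasurableEquiv.piFinSuccAbove, Fin.insertNthEquiv]

lemma lintegral_Icc_ofReal_linear (a b m : ℝ) (ha : 0 ≤ a) (hb : 0 ≤ b) (hm : 0 ≤ m) :
    ∫⁻ u in Set.Icc 0 m, ENNReal.ofReal (a + b * u) = ENNReal.ofReal (a * m + b * m ^ 2 / 2) := by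
  rw [← ofReal_integral_eq_lintegral_ofReal]
  · congr 1
    rw [integral_Icc_eq_integral_Ioc, ← intervalIntegral.integral_of_le hm,
      intervalIntegral.integral_add (by simp) (by apply Continuous.intervalIntegrable; fun_prop),
      intervalIntegral.integral_const_mul, integral_id]
    simp
    ring
  · exact ContinuousOn.integrableOn_Icc (by fun_prop)
  · filter_upwards [ae_restrict_mem measurableSet_Icc] with u hu
    have := mul_nonneg hb hu.1
    simp only [Pi.zero_apply]
    positivity

instance isProbabilityMeasure_volume_restrict_Icc :
    IsProbabilityMeasure (volume.restrict (Set.Icc (0 : ℝ) 1)) :=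
  ⟨by simp⟩

lemma lintegral_two_pow_card_recordsBelow_le (n : ℕ) (m : ℝ) (hm : m ∈ Set.Icc (0 : ℝ) 1) :
    ∫⁻ y, 2 ^ (recordsBelow m y).card
        ∂Measure.pi (fun _ : Fin n => volume.restrict (Set.Icc (0 : ℝ) 1)) ≤
      ENNReal.ofReal (1 + n * m) := by
  induction n generalizing m with
  | zero => simp [recordsBelow]
  | succ n ih =>
    have hmeas : Measurable fun y : Fin (n + 1) → ℝ => (recordsBelow m y).card :=
      (measurable_card_recordsBelow (n + 1)).comp (measurable_const.prodMk measurable_id)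
    rw [lintegral_pi_fin_succ _ (measurable_two_pow hmeas)]
    simp only [card_recordsBelow_cons]
    obtain ⟨hm0, hm1⟩ := hm
    rw [← Set.Icc_union_Icc_eq_Icc hm0 hm1]
    refine (lintegral_union_le _ _ _).trans ?_
    rw [Set.Icc_union_Icc_eq_Icc hm0 hm1]
    have hleft : ∫⁻ u in Set.Icc 0 m, ∫⁻ t, 2 ^ (if u < m then (recordsBelow u t).card + 1
          else (recordsBelow m t).card)
          ∂Measure.pi (fun _ : Fin n => volume.restrict (Set.Icc (0 : ℝ) 1)) ≤
        ENNReal.ofReal (2 * m + n * m ^ 2) := by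
      calc _ ≤ ∫⁻ u in Set.Icc 0 m, ENNReal.ofReal (2 + (2 * n) * u) := by
            refine setLIntegral_mono' measurableSet_Icc fun u hu => ?_
            have key : ∫⁻ t, 2 * 2 ^ (recordsBelow u t).card
                ∂Measure.pi (fun _ : Fin n => volume.restrict (Set.Icc (0 : ℝ) 1)) ≤
                ENNReal.ofReal (2 + (2 * n) * u) := by
              rw [lintegral_const_mul' _ _ (by simp)]
              refine (mul_le_mul_right (ih u ⟨hu.1, hu.2.trans hm1⟩) 2).trans ?_
              rw [show (2 : ℝ≥0∞) = ENNReal.ofReal 2 by simp,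
                ← ENNReal.ofReal_mul (by norm_num)]
              exact le_of_eq (by ring_nf)
            refine le_trans (lintegral_mono fun t => ?_) key
            split_ifs with h
            · rw [pow_succ']
            · obtain rfl : u = m := le_antisymm hu.2 (not_lt.1 h)
              exact le_mul_of_one_le_left (by simp) (by norm_num)
        _ = _ := by
            rw [lintegral_Icc_ofReal_linear _ _ _ (by norm_num) (by positivity) hm0]
            congr 1
            ring
    have hright : ∫⁻ u in Set.Icc m 1, ∫⁻ t, 2 ^ (if u < m then (recordsBelow u t).card + 1
          else (recordsBelow m t).card)
          ∂Measure.pi (fun _ : Fin n => volume.restrict (Set.Icc (0 : ℝ) 1)) ≤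
        ENNReal.ofReal ((1 + n * m) * (1 - m)) := by
      calc _ ≤ ∫⁻ u in Set.Icc m 1, ENNReal.ofReal (1 + n * m) := by
            refine setLIntegral_mono' measurableSet_Icc fun u hu => ?_
            simp only [not_lt.2 hu.1, if_false]
            exact ih m ⟨hm0, hm1⟩
        _ = _ := by
            rw [setLIntegral_const, Real.volume_Icc, ENNReal.ofReal_mul (by positivity)]
    refine (add_le_add hleft hright).trans ?_
    rw [← ENNReal.ofReal_add (by positivity)
      (mul_nonneg (by positivity) (sub_nonneg.2 hm1))]
    refine ENNReal.ofReal_le_ofReal (le_of_eq ?_)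
    push_cast
    ring

lemma lintegral_two_pow_card_records_le (n : ℕ) :
    ∫⁻ y, 2 ^ (records y).card
        ∂Measure.pi (fun _ : Fin n => volume.restrict (Set.Icc (0 : ℝ) 1)) ≤
      ENNReal.ofReal (n + 1) := by
  cases n with
  | zero => simp [records]
  | succ n =>
    rw [lintegral_pi_fin_succ _ (measurable_two_pow (measurable_card_records (n + 1)))]
    simp only [card_records_cons]
    calc _ ≤ ∫⁻ u in Set.Icc (0 : ℝ) 1, ENNReal.ofReal (2 + (2 * n) * u) := by
          refine setLIntegral_mono' measurableSet_Icc fun u hu => ?_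
          simp only [pow_succ']
          rw [lintegral_const_mul' _ _ (by simp)]
          refine (mul_le_mul_right (lintegral_two_pow_card_recordsBelow_le n u hu) 2).trans ?_
          rw [show (2 : ℝ≥0∞) = ENNReal.ofReal 2 by simp, ← ENNReal.ofReal_mul (by norm_num)]
          exact le_of_eq (by ring_nf)
      _ = _ := by
          rw [lintegral_Icc_ofReal_linear _ _ _ (by norm_num) (by positivity) zero_le_one]
          congr 1
          push_cast
          ring

lemma measure_lt_card_records_le (n : ℕ) (K : ℝ) :
    Measure.pi (fun _ : Fin n => volume.restrict (Set.Icc (0 : ℝ) 1))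
        {y | K < ((records y).card : ℝ)} ≤
      ENNReal.ofReal ((n + 1) / 2 ^ K) := by
  have hK : (0 : ℝ) < 2 ^ K := by positivity
  have hsub : {y : Fin n → ℝ | K < ((records y).card : ℝ)} ⊆
      {y | ENNReal.ofReal (2 ^ K) ≤ 2 ^ (records y).card} := by
    intro y hy
    have h : (2 : ℝ) ^ K ≤ 2 ^ (records y).card := by
      rw [← Real.rpow_natCast]
      exact Real.rpow_le_rpow_of_exponent_le one_le_two (le_of_lt hy)
    simpa [ENNReal.ofReal_pow] using ENNReal.ofReal_le_ofReal h
  refine (measure_mono hsub).trans ?_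
  rw [ENNReal.ofReal_div_of_pos hK]
  exact (meas_ge_le_lintegral_div (measurable_two_pow (measurable_card_records n)).aemeasurable
    (by simpa using hK) ENNReal.ofReal_ne_top).trans
      (ENNReal.div_le_div_right (lintegral_two_pow_card_records_le n) _)

/-- Listing points by increasing abscissa, every staircase point is a record of the ordinates. -/
lemma ncard_stair_range_le {n : ℕ} (p : Fin n → Fin 2 → ℝ) (σ : Equiv.Perm (Fin n))
    (hσ : Monotone fun i => p (σ i) 0) :
    (stair (Set.range p)).ncard ≤ (records fun i => p (σ i) 1).card := by
  have hsub : stair (Set.range p) ⊆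
      (fun i => p (σ i)) '' (records fun i => p (σ i) 1 : Set (Fin n)) := by
    rintro s ⟨⟨k, rfl⟩, hs⟩
    obtain ⟨i, hi, hmin⟩ := WellFounded.has_min (wellFounded_lt (α := Fin n))
      {i | p (σ i) = p k} ⟨σ.symm k, by simp⟩
    refine ⟨i, mem_records.2 fun j hj => ?_, hi⟩
    have hne : p (σ j) ≠ p k := fun h => hmin j h hj
    have hnd := hs _ ⟨σ j, rfl⟩ hne
    rw [← show p (σ i) = p k from hi, Fin.forall_fin_two] at hnd
    by_contra! hle
    exact hnd ⟨hσ hj.le, hle⟩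
  calc _ ≤ ((fun i => p (σ i)) '' (records fun i => p (σ i) 1 : Set (Fin n))).ncard :=
        Set.ncard_le_ncard hsub (Set.toFinite _)
    _ ≤ _ := (Set.ncard_image_le (Set.toFinite _)).trans (Set.ncard_coe_finset _).le

lemma measurableSet_eq_sort {n : ℕ} (σ : Equiv.Perm (Fin n)) :
    MeasurableSet {x : Fin n → ℝ | σ = Tuple.sort x} := by
  simp only [Tuple.eq_sort_iff, Monotone, Function.comp_apply]
  measurability

lemma measurableSet_lt_card_records_comp_sort (n : ℕ) (K : ℝ) :
    MeasurableSet {q : (Fin n → ℝ) × (Fin n → ℝ) |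
      K < ((records fun i => q.2 (Tuple.sort q.1 i)).card : ℝ)} := by
  have h : {q : (Fin n → ℝ) × (Fin n → ℝ) |
        K < ((records fun i => q.2 (Tuple.sort q.1 i)).card : ℝ)} =
      ⋃ σ : Equiv.Perm (Fin n), {x : Fin n → ℝ | σ = Tuple.sort x} ×ˢ
        {y | K < ((records fun i => y (σ i)).card : ℝ)} := by
    ext q
    simp
  rw [h]
  refine MeasurableSet.iUnion fun σ => (measurableSet_eq_sort σ).prod ?_
  have hm : Measurable fun y : Fin n → ℝ => ((records fun i => y (σ i)).card : ℝ) :=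
    measurable_from_top.comp ((measurable_card_records n).comp (by fun_prop))
  exact measurableSet_lt measurable_const hm

lemma measurePreserving_coordinates (ν : Measure ℝ) [IsProbabilityMeasure ν] (n : ℕ) :
    MeasurePreserving
      (fun p : Fin n → Fin 2 → ℝ => ((fun i => p i 0, fun i => p i 1) :
        (Fin n → ℝ) × (Fin n → ℝ)))
      (Measure.pi fun _ : Fin n => Measure.pi fun _ : Fin 2 => ν)
      ((Measure.pi fun _ : Fin n => ν).prod (Measure.pi fun _ : Fin n => ν)) :=
  (measurePreserving_arrowProdEquivProdArrow ℝ ℝ (Fin n) (fun _ => ν) (fun _ => ν)).comp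
    (measurePreserving_pi _ _ fun _ => measurePreserving_finTwoArrow ν)

lemma measurePreserving_comp_perm (ν : Measure ℝ) [IsProbabilityMeasure ν] {n : ℕ}
    (σ : Equiv.Perm (Fin n)) :
    MeasurePreserving (fun (y : Fin n → ℝ) i => y (σ i))
      (Measure.pi fun _ : Fin n => ν) (Measure.pi fun _ : Fin n => ν) :=
  (measurePreserving_piCongrLeft (fun _ : Fin n => ν) σ).symm

lemma measure_lt_ncard_stair_le (n : ℕ) (K : ℝ) :
    Measure.pi (fun _ : Fin n =>
        Measure.pi (fun _ : Fin 2 => volume.restrict (Set.Icc (0 : ℝ) 1)))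
      {p : Fin n → Fin 2 → ℝ | K < ((stair (Set.range p)).ncard : ℝ)} ≤
      ENNReal.ofReal ((n + 1) / 2 ^ K) := by
  have hT := measurableSet_lt_card_records_comp_sort n K
  have hsub : {p : Fin n → Fin 2 → ℝ | K < ((stair (Set.range p)).ncard : ℝ)} ⊆
      (fun p : Fin n → Fin 2 → ℝ => ((fun i => p i 0, fun i => p i 1) :
        (Fin n → ℝ) × (Fin n → ℝ))) ⁻¹' {q : (Fin n → ℝ) × (Fin n → ℝ) |
          K < ((records fun i => q.2 (Tuple.sort q.1 i)).card : ℝ)} := by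
    intro p hp
    exact lt_of_lt_of_le (Set.mem_ofPred.1 hp) (Nat.cast_le.2 (ncard_stair_range_le p _
      (Tuple.monotone_sort fun i => p i 0)))
  refine (measure_mono hsub).trans ?_
  rw [(measurePreserving_coordinates _ n).measure_preimage hT.nullMeasurableSet,
    Measure.prod_apply hT]
  refine (lintegral_mono fun x => ?_).trans (b := ∫⁻ _, ENNReal.ofReal ((n + 1) / 2 ^ K)
    ∂Measure.pi (fun _ : Fin n => volume.restrict (Set.Icc (0 : ℝ) 1))) (by simp)
  have hm : Measurable fun y : Fin n → ℝ => ((records y).card : ℝ) :=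
    measurable_from_top.comp (measurable_card_records n)
  have h := (measurePreserving_comp_perm (volume.restrict (Set.Icc (0 : ℝ) 1))
    (Tuple.sort x)).measure_preimage
      (measurableSet_lt (measurable_const (a := K)) hm).nullMeasurableSet
  exact h.le.trans (measure_lt_card_records_le n K)

/-- For `n` points sampled independently and uniformly from the unit square
`[0,1]²`: for every `γ > 0` there is a constant `c = c(γ)` such that for all
`n ≥ 2`, the probability that the number of staircase points exceeds `c·ln n` is
at most `n^{-γ}`. -/
theorem staircase_square_whp (γ : ℝ) (hγ : 0 < γ) :
    ∃ c : ℝ, 0 < c ∧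
      ∀ n : ℕ, 2 ≤ n →
        Measure.pi (fun _ : Fin n =>
            Measure.pi (fun _ : Fin 2 => volume.restrict (Set.Icc (0 : ℝ) 1)))
          {p : Fin n → Fin 2 → ℝ | c * Real.log n < ((stair (Set.range p)).ncard : ℝ)}
          ≤ ENNReal.ofReal ((n : ℝ) ^ (-γ)) := by
  have h2 : 0 < Real.log 2 := Real.log_pos one_lt_two
  refine ⟨(γ + 2) / Real.log 2, by positivity, fun n hn => ?_⟩
  refine (measure_lt_ncard_stair_le n _).trans (ENNReal.ofReal_le_ofReal ?_)
  have hn2 : (2 : ℝ) ≤ n := by exact_mod_cast hn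
  have hn0 : (0 : ℝ) < n := by linarith
  have hpow : (2 : ℝ) ^ ((γ + 2) / Real.log 2 * Real.log n) = (n : ℝ) ^ γ * (n : ℝ) ^ 2 := by
    rw [← Real.rpow_natCast, ← Real.rpow_add hn0, Real.rpow_def_of_pos two_pos,
      Real.rpow_def_of_pos hn0]
    congr 1
    field_simp
    push_cast
    ring
  have hγn : 0 < (n : ℝ) ^ γ := by positivity
  rw [hpow, Real.rpow_neg hn0.le, inv_eq_one_div, div_le_div_iff₀ (by positivity) hγn]
  nlinarith [mul_nonneg hγn.le (show (0 : ℝ) ≤ (n : ℝ) ^ 2 - (n + 1) by nlinarith)]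
end

section
/- Fix an integer d ≥ 2, and let m, n be integers with 2 ≤ m ≤ n. Let q_1, …, q_m be points sampled independently from [0,1]^d, where for each point the d coordinates are independent and the j-th coordinate is drawn from an atomless probability distribution μ_j on [0,1]; write Q_i = {q_1, …, q_i}. Suppose K ≥ 1 and c > 0 are such that with probability at least 1 − m^{−c}, |St(Q_i)| ≤ K holds simultaneously for all i = 1, …, m. Then the probability that |⋃_{i=1}^m St(Q_i)| > 4e·K·ln n is at most n^{−2eK} + m^{−c}. -/
open MeasureTheory

/-- The indices `j ≤ i` such that no other point among the `q k`, `k ≤ i`, is at most `q j`. -/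
noncomputable def stairIdx {α : Type*} [Preorder α] {m : ℕ} (q : Fin m → α) (i : Fin m) :
    Finset (Fin m) :=
  open Classical in {j ∈ Finset.Iic i | ∀ k ≤ i, k ≠ j → ¬ q k ≤ q j}

/-- The weight `1 + a` if the `i`-th point is minimal on arrival while there are at most `K`
minimal points, and `1` otherwise. -/
noncomputable def arrivalWeight {α : Type*} [Preorder α] {m : ℕ} (K : ℝ) (a : ENNReal)
    (q : Fin m → α) (i : Fin m) : ENNReal :=
  open Classical in 1 + if i ∈ stairIdx q i ∧ ((stairIdx q i).card : ℝ) ≤ K then a else 0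

section Order

variable {α : Type*} [Preorder α] {m : ℕ}

lemma mem_stairIdx {q : Fin m → α} {i j : Fin m} :
    j ∈ stairIdx q i ↔ j ≤ i ∧ ∀ k ≤ i, k ≠ j → ¬ q k ≤ q j := by
  simp [stairIdx]

lemma mem_stairIdx_comp (q : Fin m → α) {i : Fin m} (σ : Equiv.Perm (Fin m))
    (hσ : ∀ k, σ k ≤ i ↔ k ≤ i) (j : Fin m) :
    j ∈ stairIdx (q ∘ σ) i ↔ σ j ∈ stairIdx q i := by
  simp only [mem_stairIdx, hσ, Function.comp]
  refine and_congr_right fun _ => ⟨fun h k hk hkj => ?_, fun h k hk hkj => ?_⟩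
  · have := h (σ.symm k) (by rw [← hσ]; simpa using hk) (by rintro rfl; simp at hkj)
    simpa using this
  · exact h (σ k) ((hσ k).2 hk) (fun h => hkj (σ.injective h))

lemma card_stairIdx_comp (q : Fin m → α) {i : Fin m} (σ : Equiv.Perm (Fin m))
    (hσ : ∀ k, σ k ≤ i ↔ k ≤ i) :
    (stairIdx (q ∘ σ) i).card = (stairIdx q i).card := by
  rw [← Finset.card_map σ.toEmbedding]
  congr 1
  ext j
  simp only [Finset.mem_map_equiv, mem_stairIdx_comp q σ hσ, Equiv.apply_symm_apply]

lemma swap_le_iff {i j k : Fin m} (hj : j ≤ i) (hk : k ≤ i) (l : Fin m) :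
    Equiv.swap j k l ≤ i ↔ l ≤ i := by
  by_cases h1 : l = j
  · subst h1; simp [hj, hk]
  by_cases h2 : l = k
  · subst h2; simp [hj, hk]
  rw [Equiv.swap_apply_of_ne_of_ne h1 h2]

lemma arrivalWeight_comp_swap_of_lt (K : ℝ) (a : ENNReal) (q : Fin m → α) {i j k : Fin m}
    (hj : j ≤ k) (hk : k < i) :
    arrivalWeight K a (q ∘ Equiv.swap j k) i = arrivalWeight K a q i := by
  have hσ := swap_le_iff (hj.trans hk.le) hk.le
  simp only [arrivalWeight, mem_stairIdx_comp q _ hσ, card_stairIdx_comp q _ hσ,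
    Equiv.swap_apply_of_ne_of_ne (hj.trans_lt hk).ne' hk.ne']

open Classical in
lemma arrivalWeight_comp_swap_self (K : ℝ) (a : ENNReal) (q : Fin m → α) {j k : Fin m}
    (hj : j ≤ k) :
    arrivalWeight K a (q ∘ Equiv.swap j k) k =
      1 + if j ∈ stairIdx q k ∧ ((stairIdx q k).card : ℝ) ≤ K then a else 0 := by
  have hσ := swap_le_iff hj le_rfl
  simp only [arrivalWeight, mem_stairIdx_comp q _ hσ, card_stairIdx_comp q _ hσ,
    Equiv.swap_apply_right]

lemma sum_arrivalWeight_comp_swap_le (K : ℝ) (a : ENNReal) (q : Fin m → α) (k : Fin m) :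
    ∑ j ∈ Finset.Iic k, arrivalWeight K a (q ∘ Equiv.swap j k) k ≤
      ((k : ℕ) + 1 : ℕ) + ENNReal.ofReal K * a := by
  classical
  rw [Finset.sum_congr rfl fun j hj =>
    arrivalWeight_comp_swap_self K a q (Finset.mem_Iic.1 hj), Finset.sum_add_distrib]
  gcongr
  · simp
  · by_cases hK : ((stairIdx q k).card : ℝ) ≤ K
    · simp only [hK, and_true]
      rw [← Finset.sum_filter, Finset.sum_const, nsmul_eq_mul]
      gcongr
      rw [← ENNReal.ofReal_natCast]
      refine ENNReal.ofReal_le_ofReal (le_trans ?_ hK)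
      exact_mod_cast Finset.card_le_card fun j hj => (Finset.mem_filter.1 hj).2
    · simp [hK]

end Order

section Measure

variable {α : Type*} [MeasurableSpace α] [TopologicalSpace α] [PartialOrder α]
  [OrderClosedTopology α] [SecondCountableTopology α] [OpensMeasurableSpace α] {m : ℕ}

lemma measurableSet_mem_stairIdx (i j : Fin m) :
    MeasurableSet {q : Fin m → α | j ∈ stairIdx q i} := by
  have h : {q : Fin m → α | j ∈ stairIdx q i} =
      {_q | j ≤ i} ∩ ⋂ k, ⋂ (_ : k ≤ i), ⋂ (_ : k ≠ j), {q | q k ≤ q j}ᶜ := by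
    ext q
    simp [mem_stairIdx]
  rw [h]
  refine (MeasurableSet.const (j ≤ i)).inter ?_
  refine MeasurableSet.iInter fun k => MeasurableSet.iInter fun _ => MeasurableSet.iInter fun _ => ?_
  have hk : Measurable fun q : Fin m → α => q k := measurable_pi_apply k
  have hj : Measurable fun q : Fin m → α => q j := measurable_pi_apply j
  exact (measurableSet_le hk hj).compl

lemma measurable_card_stairIdx (i : Fin m) :
    Measurable fun q : Fin m → α => ((stairIdx q i).card : ℝ) := by
  classical
  have h : (fun q : Fin m → α => ((stairIdx q i).card : ℝ)) =
      fun q => ∑ j, if j ∈ stairIdx q i then (1 : ℝ) else 0 := by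
    ext q
    simp
  rw [h]
  exact Finset.measurable_sum _ fun j _ =>
    Measurable.ite (measurableSet_mem_stairIdx i j) measurable_const measurable_const

lemma measurable_arrivalWeight (K : ℝ) (a : ENNReal) (i : Fin m) :
    Measurable fun q : Fin m → α => arrivalWeight K a q i := by
  classical
  unfold arrivalWeight
  have h : MeasurableSet {q : Fin m → α | ((stairIdx q i).card : ℝ) ≤ K} :=
    measurableSet_le (measurable_card_stairIdx i) measurable_const
  exact (Measurable.ite ((measurableSet_mem_stairIdx i i).inter h)
    measurable_const measurable_const).const_add 1

lemma lintegral_pi_comp_perm {β : Type*} [MeasurableSpace β] (ρ : Measure β) [SigmaFinite ρ]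
    (σ : Equiv.Perm (Fin m)) (f : (Fin m → β) → ENNReal) :
    ∫⁻ q, f (q ∘ σ) ∂Measure.pi (fun _ => ρ) = ∫⁻ q, f q ∂Measure.pi (fun _ => ρ) := by
  have h := measurePreserving_piCongrLeft (fun _ : Fin m => ρ) σ.symm
  rw [← h.lintegral_comp_emb (MeasurableEquiv.measurableEmbedding _) f]
  refine lintegral_congr fun q => ?_
  congr 1
  ext i
  obtain ⟨i, rfl⟩ := σ.symm.surjective i
  rw [MeasurableEquiv.coe_piCongrLeft, Equiv.piCongrLeft_apply_apply]
  simp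

/-- Backward analysis: conditionally on the arrivals after time `k` and on the unordered set of
the first `k + 1` points, the `k`-th point is uniform among those points. -/
lemma lintegral_prod_arrivalWeight_le (ρ : Measure α) [IsProbabilityMeasure ρ] (K : ℝ)
    (a : ENNReal) (s : Finset (Fin m)) :
    ∫⁻ q, ∏ i ∈ s, arrivalWeight K a q i ∂Measure.pi (fun _ => ρ) ≤
      ∏ i ∈ s, ((((i : ℕ) + 1 : ℕ) + ENNReal.ofReal K * a) / ((i : ℕ) + 1 : ℕ)) := by
  induction s using Finset.induction_on_min with
  | empty => simp
  | insert k s hk ih =>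
    have hks : k ∉ s := fun h => lt_irrefl _ (hk k h)
    rw [Finset.prod_insert hks]
    simp only [Finset.prod_insert hks]
    refine le_trans ?_ (mul_le_mul_right ih _)
    rw [← ENNReal.mul_div_right_comm, ENNReal.le_div_iff_mul_le (by simp) (by simp)]
    set Z : (Fin m → α) → ENNReal := fun q => ∏ i ∈ s, arrivalWeight K a q i
    have hZm : Measurable Z := Finset.measurable_prod _ fun i _ => measurable_arrivalWeight K a i
    have hswap : ∀ j ∈ Finset.Iic k,
        ∫⁻ q, arrivalWeight K a q k * Z q ∂Measure.pi (fun _ => ρ) =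
        ∫⁻ q, arrivalWeight K a (q ∘ Equiv.swap j k) k * Z q ∂Measure.pi (fun _ => ρ) := by
      intro j hj
      rw [← lintegral_pi_comp_perm ρ (Equiv.swap j k)]
      refine lintegral_congr fun q => ?_
      congr 1
      exact Finset.prod_congr rfl fun i hi =>
        arrivalWeight_comp_swap_of_lt K a q (Finset.mem_Iic.1 hj) (hk i hi)
    have hmeas : ∀ j, Measurable fun q : Fin m → α =>
        arrivalWeight K a (q ∘ Equiv.swap j k) k * Z q := by
      intro j
      have hcomp : Measurable fun q : Fin m → α => q ∘ Equiv.swap j k :=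
        measurable_pi_lambda _ fun i => measurable_pi_apply _
      exact ((measurable_arrivalWeight K a k).comp hcomp).mul hZm
    calc (∫⁻ q, arrivalWeight K a q k * Z q ∂Measure.pi (fun _ => ρ)) * ((k : ℕ) + 1 : ℕ)
        = ∑ j ∈ Finset.Iic k, ∫⁻ q, arrivalWeight K a (q ∘ Equiv.swap j k) k * Z q
            ∂Measure.pi (fun _ => ρ) := by
          rw [← Finset.sum_congr rfl hswap, Finset.sum_const, Fin.card_Iic, nsmul_eq_mul, mul_comm]
      _ = ∫⁻ q, (∑ j ∈ Finset.Iic k, arrivalWeight K a (q ∘ Equiv.swap j k) k) * Z q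
            ∂Measure.pi (fun _ => ρ) := by
          rw [← lintegral_finsetSum _ fun j _ => hmeas j]
          simp only [Finset.sum_mul]
      _ ≤ ∫⁻ q, (((k : ℕ) + 1 : ℕ) + ENNReal.ofReal K * a) * Z q ∂Measure.pi (fun _ => ρ) :=
          lintegral_mono fun q => mul_le_mul_left (sum_arrivalWeight_comp_swap_le K a q k) _
      _ = _ := lintegral_const_mul _ hZm

end Measure

section Staircase

variable {d m : ℕ}

lemma card_stairIdx_le_ncard (q : Fin m → Fin d → ℝ) (i : Fin m) :
    (stairIdx q i).card ≤ (stair (q '' Set.Iic i)).ncard := by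
  have hfin : (stair (q '' Set.Iic i)).Finite :=
    (Set.toFinite (q '' Set.Iic i)).subset fun p hp => hp.1
  rw [← Set.ncard_coe_finset]
  refine Set.ncard_le_ncard_of_injOn q ?_ ?_ hfin
  · intro j hj
    obtain ⟨hji, hj⟩ := mem_stairIdx.1 hj
    refine ⟨⟨j, hji, rfl⟩, ?_⟩
    rintro _ ⟨k, hk, rfl⟩ hkj
    exact hj k hk (by rintro rfl; exact hkj rfl)
  · intro j hj k hk hjk
    by_contra hne
    exact (mem_stairIdx.1 hk).2 j (mem_stairIdx.1 hj).1 hne hjk.le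

open Classical in
lemma ncard_iUnion_stair_le (q : Fin m → Fin d → ℝ) :
    (⋃ i : Fin m, stair (q '' Set.Iic i)).ncard ≤
      (Finset.univ.filter fun i => i ∈ stairIdx q i).card := by
  rw [← Set.ncard_coe_finset]
  refine le_trans (Set.ncard_le_ncard ?_ (Set.toFinite _)) (Set.ncard_image_le (f := q)
    (Set.toFinite _))
  intro p hp
  obtain ⟨i, ⟨j₀, hj₀, hp₀⟩, hp⟩ := Set.mem_iUnion.1 hp
  obtain ⟨j, hj, hmin⟩ := WellFounded.has_min (wellFounded_lt (α := Fin m)) {j | q j = p} ⟨j₀, hp₀⟩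
  have hji : j ≤ i := (not_lt.1 (hmin j₀ hp₀)).trans hj₀
  refine ⟨j, ?_, hj⟩
  simp only [Finset.coe_filter, Finset.mem_univ, true_and, Set.mem_ofPred_eq, mem_stairIdx, le_refl]
  intro k hk hkj hle
  exact hp (q k) ⟨k, hk.trans hji, rfl⟩ (fun h => hmin k h (lt_of_le_of_ne hk hkj))
    (by rw [← show q j = p from hj]; exact hle)

end Staircase

lemma prod_arrivalWeight_eq_exp {α : Type*} [Preorder α] {m : ℕ} {K : ℝ} {q : Fin m → α}
    (h : ∀ i, ((stairIdx q i).card : ℝ) ≤ K) [DecidablePred fun i => i ∈ stairIdx q i] :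
    ∏ i, arrivalWeight K (ENNReal.ofReal (Real.exp 1 - 1)) q i =
      ENNReal.ofReal (Real.exp (Finset.univ.filter fun i => i ∈ stairIdx q i).card) := by
  have he : 1 + ENNReal.ofReal (Real.exp 1 - 1) = ENNReal.ofReal (Real.exp 1) := by
    rw [← ENNReal.ofReal_one, ← ENNReal.ofReal_add (by simp) (by linarith [Real.add_one_le_exp 1])]
    simp
  have hw : ∀ i, arrivalWeight K (ENNReal.ofReal (Real.exp 1 - 1)) q i =
      if i ∈ stairIdx q i then ENNReal.ofReal (Real.exp 1) else 1 := by
    intro i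
    by_cases hi : i ∈ stairIdx q i <;> simp [arrivalWeight, h i, hi, he]
  rw [Finset.prod_congr rfl fun i _ => hw i, Finset.prod_ite, Finset.prod_const_one, mul_one,
    Finset.prod_const, ← ENNReal.ofReal_pow (Real.exp_pos _).le, ← Real.exp_nat_mul, mul_one]

lemma prod_harmonic_factor_le {K : ℝ} (hK : 0 ≤ K) (m : ℕ) :
    ∏ i : Fin m, ((((i : ℕ) + 1 : ℕ) + ENNReal.ofReal K * ENNReal.ofReal (Real.exp 1 - 1)) /
      ((i : ℕ) + 1 : ℕ)) ≤
      ENNReal.ofReal (Real.exp ((Real.exp 1 - 1) * K * (1 + Real.log m))) := by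
  have he : 0 ≤ Real.exp 1 - 1 := by linarith [Real.add_one_le_exp 1]
  have hf : ∀ i : ℕ, (((i + 1 : ℕ) : ENNReal) + ENNReal.ofReal K *
      ENNReal.ofReal (Real.exp 1 - 1)) / ((i + 1 : ℕ) : ENNReal) =
      ENNReal.ofReal (1 + (Real.exp 1 - 1) * K * ((i : ℝ) + 1)⁻¹) := by
    intro i
    have hi : (0 : ℝ) < ((i + 1 : ℕ) : ℝ) := by positivity
    rw [← ENNReal.ofReal_mul hK, ← ENNReal.ofReal_natCast,
      ← ENNReal.ofReal_add hi.le (by positivity), ← ENNReal.ofReal_div_of_pos hi]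
    congr 1
    push_cast at hi ⊢
    field_simp
  rw [Finset.prod_congr rfl fun (i : Fin m) _ => hf i,
    ← ENNReal.ofReal_prod_of_nonneg fun i _ => by positivity]
  refine ENNReal.ofReal_le_ofReal ?_
  calc ∏ i : Fin m, (1 + (Real.exp 1 - 1) * K * (((i : ℕ) : ℝ) + 1)⁻¹)
      ≤ ∏ i : Fin m, Real.exp ((Real.exp 1 - 1) * K * (((i : ℕ) : ℝ) + 1)⁻¹) :=
        Finset.prod_le_prod (fun i _ => by positivity) fun i _ => by
          rw [add_comm]; exact Real.add_one_le_exp _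
    _ = Real.exp ((Real.exp 1 - 1) * K * harmonic m) := by
        rw [← Real.exp_sum, ← Finset.mul_sum,
          Fin.sum_univ_eq_sum_range (fun i : ℕ => ((i : ℝ) + 1)⁻¹)]
        simp [harmonic]
    _ ≤ _ := by
        have := harmonic_le_one_add_log m
        gcongr

lemma chernoff_exponent_le {m n : ℕ} (hm : 2 ≤ m) (hmn : m ≤ n) {K : ℝ} (hK : 0 ≤ K) :
    Real.exp ((Real.exp 1 - 1) * K * (1 + Real.log m)) /
      Real.exp (4 * Real.exp 1 * K * Real.log n) ≤ (n : ℝ) ^ (-(2 * Real.exp 1 * K)) := by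
  have hn : (2 : ℝ) ≤ n := by exact_mod_cast hm.trans hmn
  have hm0 : (0 : ℝ) < m := by exact_mod_cast (by omega : 0 < m)
  rw [Real.rpow_def_of_pos (by linarith), ← Real.exp_sub, Real.exp_le_exp]
  have h1 : Real.log m ≤ Real.log n := Real.log_le_log hm0 (by exact_mod_cast hmn)
  have h2 : Real.log 2 ≤ Real.log n := Real.log_le_log (by norm_num) hn
  have h3 := Real.log_two_gt_d9
  have h4 := Real.add_one_le_exp 1
  have key : (Real.exp 1 - 1) * (1 + Real.log m) ≤ 2 * Real.exp 1 * Real.log n := by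
    have : (Real.exp 1 - 1) * (1 + Real.log m) ≤ (Real.exp 1 - 1) * (1 + Real.log n) := by
      gcongr; linarith
    nlinarith [Real.exp_one_lt_d9]
  nlinarith [mul_le_mul_of_nonneg_left key hK]

/-- Let `q_1, …, q_m` (with `2 ≤ m ≤ n`) be sampled independently from `[0,1]^d`
with independent coordinates, the `j`-th coordinate drawn from an atomless
probability distribution `μ_j` on `[0,1]`, and let `Q_i = {q_1, …, q_i}`.  If
with probability at least `1 - m^{-c}` we have `|St(Q_i)| ≤ K` simultaneously
for all `i`, then the probability that `|⋃_i St(Q_i)| > 4e·K·ln n` is at most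
`n^{-2eK} + m^{-c}`. -/
theorem staircase_union_whp (d : ℕ) (hd : 2 ≤ d) (m n : ℕ) (hm : 2 ≤ m) (hmn : m ≤ n)
    (μ : Fin d → Measure ℝ)
    (hprob : ∀ j, IsProbabilityMeasure (μ j))
    (hatomless : ∀ j, ∀ a : ℝ, μ j {a} = 0)
    (hsupp : ∀ j, μ j (Set.Icc (0 : ℝ) 1) = 1)
    (K c : ℝ) (hK : 1 ≤ K) (hc : 0 < c)
    (hgood :
      ENNReal.ofReal (1 - (m : ℝ) ^ (-c)) ≤
        Measure.pi (fun _ : Fin m => Measure.pi μ)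
          {q : Fin m → Fin d → ℝ |
            ∀ i : Fin m, ((stair (q '' Set.Iic i)).ncard : ℝ) ≤ K}) :
    Measure.pi (fun _ : Fin m => Measure.pi μ)
        {q : Fin m → Fin d → ℝ |
          4 * Real.exp 1 * K * Real.log n <
            (((⋃ i : Fin m, stair (q '' Set.Iic i)).ncard : ℝ))}
      ≤ ENNReal.ofReal
          ((n : ℝ) ^ (-(2 * Real.exp 1 * K)) + (m : ℝ) ^ (-c)) := by
  classical
  set ν := Measure.pi (fun _ : Fin m => Measure.pi μ)
  set T := 4 * Real.exp 1 * K * Real.log n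
  have hK0 : 0 ≤ K := by linarith
  set w : (Fin m → Fin d → ℝ) → ENNReal :=
    fun q => ∏ i, arrivalWeight K (ENNReal.ofReal (Real.exp 1 - 1)) q i with hw
  set G : Set (Fin m → Fin d → ℝ) := {q | ∀ i, ((stairIdx q i).card : ℝ) ≤ K} with hG
  have hGm : MeasurableSet G := by
    simp only [hG, Set.ofPred_forall]
    exact MeasurableSet.iInter fun i =>
      measurableSet_le (measurable_card_stairIdx i) measurable_const
  have hp : 0 ≤ (m : ℝ) ^ (-c) := by positivity
  have hp1 : (m : ℝ) ^ (-c) ≤ 1 :=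
    Real.rpow_le_one_of_one_le_of_nonpos (by exact_mod_cast (by omega : 1 ≤ m)) (by linarith)
  have hbad : ν Gᶜ ≤ ENNReal.ofReal ((m : ℝ) ^ (-c)) := by
    have hle : ENNReal.ofReal (1 - (m : ℝ) ^ (-c)) ≤ ν G :=
      hgood.trans (measure_mono fun q hq i =>
        le_trans (by exact_mod_cast card_stairIdx_le_ncard q i) (hq i))
    rw [prob_compl_eq_one_sub hGm]
    refine (tsub_le_tsub_left hle 1).trans ?_
    rw [← ENNReal.ofReal_one, ← ENNReal.ofReal_sub _ (by linarith)]
    simp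
  have hmarkov : ν {q | ENNReal.ofReal (Real.exp T) ≤ w q} ≤
      ENNReal.ofReal ((n : ℝ) ^ (-(2 * Real.exp 1 * K))) := by
    have hwm : Measurable w := Finset.measurable_prod _ fun i _ => measurable_arrivalWeight _ _ i
    refine (meas_ge_le_lintegral_div hwm.aemeasurable (by simp [Real.exp_pos]) (by simp)).trans ?_
    refine le_trans ?_ (ENNReal.ofReal_le_ofReal (chernoff_exponent_le hm hmn hK0))
    rw [ENNReal.ofReal_div_of_pos (Real.exp_pos _)]
    gcongr
    exact (lintegral_prod_arrivalWeight_le _ K _ Finset.univ).trans (prod_harmonic_factor_le hK0 m)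
  rw [ENNReal.ofReal_add (by positivity) hp]
  refine le_trans (measure_mono ?_) ((measure_union_le _ _).trans (add_le_add hmarkov hbad))
  intro q hq
  by_cases hqG : q ∈ G
  · left
    change ENNReal.ofReal (Real.exp T) ≤ w q
    rw [hw]
    simp only
    rw [prod_arrivalWeight_eq_exp hqG]
    refine ENNReal.ofReal_le_ofReal (Real.exp_le_exp.2 (le_trans (le_of_lt hq) ?_))
    exact_mod_cast ncard_iUnion_stair_le q
  · exact Or.inr hqG
end
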